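/- Let p be a prime, and let L be a first-order language expanding the language of rings, with ℚ_p given an L-structure whose ring-language reduct is the usual ring structure on ℚ_p. Assume (ℚ_p, L) is P-minimal. Then for every subset X ⊆ (ℚ_p \ {0})^m that is definable with parameters in L, the set ord(X) := {(ord x₁, …, ord xₘ) ∈ ℤ^m : (x₁, …, xₘ) ∈ X} is Presburger-definable, i.e., definable with parameters in the first-order structure (ℤ, +, −, <, 0, 1). -/

import Mathlib

open FirstOrder FirstOrder.Language FirstOrder.Ring

/-- Function symbols of the Presburger language: `0`, `1`, `+`, `−`. -/
inductive PresburgerFunc : ℕ → Type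
  | zero : PresburgerFunc 0
  | one : PresburgerFunc 0
  | add : PresburgerFunc 2
  | sub : PresburgerFunc 2

/-- Relation symbols of the Presburger language: `<`. -/
inductive PresburgerRel : ℕ → Type
  | lt : PresburgerRel 2

/-- The first-order language `(+, −, <, 0, 1)` of Presburger arithmetic. -/
def Presburger : FirstOrder.Language :=
  ⟨PresburgerFunc, PresburgerRel⟩

/-- The standard interpretation of `(+, −, <, 0, 1)` on `ℤ`. -/
instance : Presburger.Structure ℤ where
  funMap {_} f v :=
    match f with
    | .zero => 0
    | .one => 1
    | .add => v 0 + v 1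
    | .sub => v 0 - v 1
  RelMap {_} r v :=
    match r with
    | .lt => v 0 < v 1

/-- `(ℚ_p, L)` is `P`-minimal (for `L` an expansion of the language of rings via `φ`):
for every `L`-structure `K` elementarily equivalent to `ℚ_p`, every subset of `K` definable
with parameters in `L` is definable with parameters in the ring-language reduct of `K`. -/
def PMinimal (p : ℕ) [Fact p.Prime] (L : FirstOrder.Language) [L.Structure ℚ_[p] ]
    (φ : Language.ring →ᴸ L) : Prop :=
  ∀ (K : Type) [L.Structure K], ℚ_[p] ≅[L] K →
    ∀ s : Set K, (Set.univ : Set K).Definable₁ L s →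
      letI : Language.ring.Structure K := φ.reduct K
      (Set.univ : Set K).Definable₁ Language.ring s


set_option linter.all false

namespace PM

/-- affine maps between abelian groups -/
@[fun_prop]
def Aff {E F : Type} [AddCommGroup E] [AddCommGroup F] (t : E → F) : Prop :=
  ∃ (f : E →+ F) (c : F), ∀ e, t e = f e + c

section aff
variable {E F G : Type} [AddCommGroup E] [AddCommGroup F] [AddCommGroup G]

@[fun_prop]
theorem Aff.id' : Aff (fun e : E => e) := ⟨AddMonoidHom.id E, 0, by simp⟩

@[fun_prop]
theorem Aff.const (c : F) : Aff (fun _ : E => c) := ⟨0, c, by simp⟩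

@[fun_prop]
theorem Aff.comp {g : F → G} {t : E → F} (hg : Aff g) (ht : Aff t) : Aff (fun e => g (t e)) := by
  obtain ⟨f, c, h⟩ := hg
  obtain ⟨f', c', h'⟩ := ht
  exact ⟨f.comp f', f c' + c, fun e => by simp [h, h', add_assoc]⟩

@[fun_prop]
theorem Aff.prodMk {s : E → F} {t : E → G} (hs : Aff s) (ht : Aff t) :
    Aff (fun e => (s e, t e)) := by
  obtain ⟨f, c, h⟩ := hs
  obtain ⟨f', c', h'⟩ := ht
  exact ⟨f.prod f', (c, c'), fun e => by simp [h, h']⟩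

@[fun_prop]
theorem Aff.fst {t : E → F × G} (ht : Aff t) : Aff (fun e => (t e).1) := by
  obtain ⟨f, c, h⟩ := ht
  exact ⟨(AddMonoidHom.fst F G).comp f, c.1, fun e => by simp [h]⟩

@[fun_prop]
theorem Aff.snd {t : E → F × G} (ht : Aff t) : Aff (fun e => (t e).2) := by
  obtain ⟨f, c, h⟩ := ht
  exact ⟨(AddMonoidHom.snd F G).comp f, c.2, fun e => by simp [h]⟩

@[fun_prop]
theorem Aff.add {s t : E → F} (hs : Aff s) (ht : Aff t) : Aff (fun e => s e + t e) := by
  obtain ⟨f, c, h⟩ := hs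
  obtain ⟨f', c', h'⟩ := ht
  exact ⟨f + f', c + c', fun e => by simp [h, h']; abel⟩

@[fun_prop]
theorem Aff.sub {s t : E → F} (hs : Aff s) (ht : Aff t) : Aff (fun e => s e - t e) := by
  obtain ⟨f, c, h⟩ := hs
  obtain ⟨f', c', h'⟩ := ht
  exact ⟨f - f', c - c', fun e => by simp [h, h']; abel⟩

@[fun_prop]
theorem Aff.neg {s : E → F} (hs : Aff s) : Aff (fun e => - s e) := by
  obtain ⟨f, c, h⟩ := hs
  exact ⟨-f, -c, fun e => by simp [h]; abel⟩

@[fun_prop]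
theorem Aff.cmul {s : E → ℤ} (k : ℤ) (hs : Aff s) : Aff (fun e => k * s e) := by
  obtain ⟨f, c, h⟩ := hs
  exact ⟨k • f, k * c, fun e => by simp [h, mul_add]⟩

@[fun_prop]
theorem Aff.pi {ι : Type} {s : E → ι → F} (hs : ∀ i, Aff (fun e => s e i)) : Aff s := by
  choose f c h using hs
  exact ⟨AddMonoidHom.pi f, c, fun e => by ext i; simp [h]⟩


theorem Aff.app {ι : Type} {s : E → ι → F} (hs : Aff s) (i : ι) : Aff (fun e => s e i) := by
  obtain ⟨f, c, h⟩ := hs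
  exact ⟨(Pi.evalAddMonoidHom (fun _ => F) i).comp f, c i, fun e => by simp [h]⟩

end aff

/-- Closure conditions for a class of definable predicates on f.g. abelian groups. -/
structure DC (D : ∀ (E : Type) [AddCommGroup E] [AddMonoid.FG E], (E → Prop) → Prop) : Prop where
  and : ∀ {E : Type} [AddCommGroup E] [AddMonoid.FG E] {P Q : E → Prop},
    D E P → D E Q → D E (fun e => P e ∧ Q e)
  not : ∀ {E : Type} [AddCommGroup E] [AddMonoid.FG E] {P : E → Prop},
    D E P → D E (fun e => ¬ P e)
  ex' : ∀ {E : Type} [AddCommGroup E] [AddMonoid.FG E] {P : E × ℤ → Prop},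
    D (E × ℤ) P → D E (fun e => ∃ n, P (e, n))
  comp : ∀ {E F : Type} [AddCommGroup E] [AddMonoid.FG E] [AddCommGroup F] [AddMonoid.FG F]
    {P : F → Prop} {t : E → F}, D F P → Aff t → D E (fun e => P (t e))
  nonneg : D ℤ (fun n => 0 ≤ n)

namespace DC
variable {D : ∀ (E : Type) [AddCommGroup E] [AddMonoid.FG E], (E → Prop) → Prop} (hD : DC D)
variable {E F : Type} [AddCommGroup E] [AddMonoid.FG E] [AddCommGroup F] [AddMonoid.FG F]
include hD

theorem congr {P Q : E → Prop} (h : D E P) (hPQ : ∀ e, Q e ↔ P e) : D E Q := by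
  have : Q = P := funext fun e => propext (hPQ e)
  rwa [this]

theorem ex {P : E → ℤ → Prop} (h : D (E × ℤ) (fun q => P q.1 q.2)) :
    D E (fun e => ∃ n, P e n) := hD.ex' h

theorem all {P : E → ℤ → Prop} (h : D (E × ℤ) (fun q => P q.1 q.2)) :
    D E (fun e => ∀ n, P e n) :=
  hD.congr (hD.not (hD.ex' (hD.not h))) (by simp)

theorem or {P Q : E → Prop} (h : D E P) (h' : D E Q) : D E (fun e => P e ∨ Q e) :=
  hD.congr (hD.not (hD.and (hD.not h) (hD.not h'))) (by intro e; tauto)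

theorem imp {P Q : E → Prop} (h : D E P) (h' : D E Q) : D E (fun e => P e → Q e) :=
  hD.congr (hD.or (hD.not h) h') (by intro e; tauto)

theorem iff {P Q : E → Prop} (h : D E P) (h' : D E Q) : D E (fun e => P e ↔ Q e) :=
  hD.congr (hD.and (hD.imp h h') (hD.imp h' h)) (by intro e; tauto)

theorem le {s t : E → ℤ} (hs : Aff s) (ht : Aff t) : D E (fun e => s e ≤ t e) :=
  hD.congr (hD.comp (t := fun e => t e - s e) hD.nonneg (by fun_prop)) (by simp)

theorem lt {s t : E → ℤ} (hs : Aff s) (ht : Aff t) : D E (fun e => s e < t e) :=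
  hD.congr (hD.not (hD.le ht hs)) (by simp)

theorem eq {s t : E → ℤ} (hs : Aff s) (ht : Aff t) : D E (fun e => s e = t e) :=
  hD.congr (hD.and (hD.le hs ht) (hD.le ht hs)) (by intro e; exact le_antisymm_iff)

theorem dvd {t : E → ℤ} (N : ℤ) (ht : Aff t) : D E (fun e => N ∣ t e) :=
  hD.congr (hD.ex (P := fun e n => t e = N * n) (hD.eq (by fun_prop) (by fun_prop)))
    (by intro e; rfl)

theorem const (p : Prop) : D E (fun _ => p) := by
  by_cases hp : p
  · exact hD.congr (hD.le (s := fun _ => 0) (t := fun _ => 0) (by fun_prop) (by fun_prop))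
      (by simp [hp])
  · exact hD.congr (hD.lt (s := fun _ => 0) (t := fun _ => 0) (by fun_prop) (by fun_prop))
      (by simp [hp])

theorem finex {ι : Type*} {P : ι → E → Prop} (s : Finset ι) (h : ∀ i, D E (P i)) :
    D E (fun e => ∃ i ∈ s, P i e) := by
  classical
  induction s using Finset.induction_on with
  | empty => exact hD.congr (hD.const False) (by simp)
  | insert a s ha ih => exact hD.congr (hD.or (h a) ih) (by simp)

theorem fex {ι : Type*} [Finite ι] {P : ι → E → Prop} (h : ∀ i, D E (P i)) :
    D E (fun e => ∃ i, P i e) := by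
  have := Fintype.ofFinite ι
  exact hD.congr (hD.finex Finset.univ h) (by simp)

theorem fall {ι : Type*} [Finite ι] {P : ι → E → Prop} (h : ∀ i, D E (P i)) :
    D E (fun e => ∀ i, P i e) :=
  hD.congr (hD.not (hD.fex (fun i => hD.not (h i)))) (by simp)

end DC

/-- The semilinear class. -/
def SL (E : Type) [AddCommGroup E] [AddMonoid.FG E] (P : E → Prop) : Prop :=
  IsSemilinearSet {e | P e}

open Pointwise in
theorem SL_dc : DC SL where
  and h h' := h.inter h'
  not h := h.compl
  ex' {E _ _ P} h := by
    have := IsSemilinearSet.image h (AddMonoidHom.fst E ℤ)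
    unfold SL
    convert! this using 1
    ext e
    simp
  comp {E F _ _ _ _ P t} h ht := by
    obtain ⟨f, c, ht⟩ := ht
    have := IsSemilinearSet.preimage (h.vadd (-c)) f
    unfold SL
    convert! this using 1
    ext e
    simp [Set.mem_vadd_set_iff_neg_vadd_mem, ht, add_comm]
  nonneg := by
    unfold SL
    have : {n : ℤ | 0 ≤ n} = (AddSubmonoid.closure {(1:ℤ)} : Set ℤ) := by
      ext n
      simp [AddSubmonoid.mem_closure_singleton]
      constructor
      · intro h; exact ⟨n.toNat, by simpa using h⟩
      · rintro ⟨k, rfl⟩; simp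
    rw [this]
    exact (IsLinearSet.closure_of_finite (Set.finite_singleton _)).isSemilinearSet

end PM


namespace PM

def Bdd {E : Type*} (P : E → ℤ → Prop) : Prop := ∃ k : ℕ, ∀ e, {n | P e n}.encard ≤ k

namespace Bdd
variable {E F : Type*} {P Q : E → ℤ → Prop}

theorem mono (h : Bdd Q) (hPQ : ∀ e n, P e n → Q e n) : Bdd P := by
  obtain ⟨k, hk⟩ := h
  exact ⟨k, fun e => (Set.encard_le_encard (fun n hn => hPQ e n hn)).trans (hk e)⟩

theorem or (h : Bdd P) (h' : Bdd Q) : Bdd (fun e n => P e n ∨ Q e n) := by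
  obtain ⟨k, hk⟩ := h
  obtain ⟨l, hl⟩ := h'
  refine ⟨k + l, fun e => ?_⟩
  have : {n | P e n ∨ Q e n} = {n | P e n} ∪ {n | Q e n} := rfl
  rw [this]
  refine (Set.encard_union_le _ _).trans ?_
  push_cast
  exact add_le_add (hk e) (hl e)

theorem inj (h : Bdd Q) (f : E → ℤ → ℤ) (hf : ∀ e n, P e n → Q e (f e n))
    (hi : ∀ e n m, P e n → P e m → f e n = f e m → n = m) : Bdd P := by
  obtain ⟨k, hk⟩ := h
  refine ⟨k, fun e => ?_⟩
  have : Set.InjOn (f e) {n | P e n} := fun n hn m hm h => hi e n m hn hm h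
  rw [← this.encard_image]
  refine (Set.encard_le_encard ?_).trans (hk e)
  rintro _ ⟨n, hn, rfl⟩
  exact hf e n hn

theorem shift (h : Bdd P) (c : ℤ) : Bdd (fun e n => P e (n + c)) :=
  h.inj (fun _ n => n + c) (fun _ _ h => h) (fun _ _ _ _ _ h => by simpa using h)

theorem comp (h : Bdd P) (t : F → E) : Bdd (fun e n => P (t e) n) := by
  obtain ⟨k, hk⟩ := h
  exact ⟨k, fun e => hk _⟩

theorem finex {ι : Type*} {P : ι → E → ℤ → Prop} (s : Finset ι) (h : ∀ i, Bdd (P i)) :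
    Bdd (fun e n => ∃ i ∈ s, P i e n) := by
  classical
  induction s using Finset.induction_on with
  | empty => exact ⟨0, by simp⟩
  | insert a s ha ih => exact ((h a).or ih).mono (by simp)

theorem fin (s : Finset ℤ) : Bdd (fun (_ : E) n => n ∈ s) :=
  ⟨s.card, fun e => by
    have : {n : ℤ | n ∈ s} = (s : Set ℤ) := rfl
    rw [this]; simp⟩

theorem encard_bind {α β : Type*} (A : Set α) (B : α → Set β) (k l : ℕ) (hA : A.encard ≤ k)
    (hB : ∀ a, (B a).encard ≤ l) : (⋃ a ∈ A, B a).encard ≤ (k * l : ℕ) := by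
  classical
  have hf : A.Finite := Set.finite_of_encard_le_coe hA
  have : ∀ s : Finset α, (⋃ a ∈ s, B a).encard ≤ (s.card * l : ℕ) := by
    intro s
    induction s using Finset.induction_on with
    | empty => simp
    | insert a s ha ih =>
      rw [Finset.set_biUnion_insert]
      refine (Set.encard_union_le _ _).trans ?_
      rw [Finset.card_insert_of_notMem ha, add_mul, one_mul, add_comm]
      push_cast
      push_cast at ih
      exact add_le_add ih (hB a)
  obtain ⟨s, rfl⟩ := hf.exists_finset_coe
  have h := this s
  simp only [Finset.mem_coe]
  refine h.trans ?_
  rw [Set.encard_coe_eq_coe_finsetCard] at hA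
  have hA' : s.card ≤ k := by exact_mod_cast hA
  exact_mod_cast Nat.mul_le_mul_right l hA'

theorem bind {V : E × ℤ → ℤ → Prop} (h : Bdd P) (h' : Bdd V) :
    Bdd (fun e n => ∃ u, P e u ∧ V (e, u) n) := by
  obtain ⟨k, hk⟩ := h
  obtain ⟨l, hl⟩ := h'
  refine ⟨k * l, fun e => ?_⟩
  refine le_trans (Set.encard_le_encard ?_)
    (encard_bind {n | P e n} (fun u => {n | V (e, u) n}) k l (hk e) (fun u => hl _))
  rintro n ⟨u, h1, h2⟩
  simp only [Set.mem_iUnion]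
  exact ⟨u, h1, h2⟩

end Bdd

def TameN {E : Type*} (P : E → ℤ → Prop) (N : ℤ) : Prop :=
  Bdd (fun e n => ¬ (P e n ↔ P e (n + N)))

namespace TameN
variable {E F : Type*} {P Q : E → ℤ → Prop} {N : ℤ}

theorem mul (h : TameN P N) (c : ℕ) : TameN P (N * c) := by
  induction c with
  | zero => exact ⟨0, by simp⟩
  | succ c ih =>
    refine (Bdd.or ih (Bdd.shift h (N * c))).mono ?_
    intro e n hn
    have : n + N * ((c + 1 : ℕ) : ℤ) = n + N * c + N := by push_cast; ring
    rw [this] at hn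
    tauto

theorem mulInt (h : TameN P N) (c : ℤ) (hc : 0 ≤ c) : TameN P (N * c) := by
  obtain ⟨c, rfl⟩ := Int.eq_ofNat_of_zero_le hc
  exact h.mul c

theorem comp (h : TameN P N) (t : F → E) : TameN (fun e n => P (t e) n) N := Bdd.comp h t

theorem and (h : TameN P N) (h' : TameN Q N) : TameN (fun e n => P e n ∧ Q e n) N :=
  (Bdd.or h h').mono (by intro e n h; tauto)

theorem shift (h : TameN P N) (c : ℤ) : TameN (fun e n => P e (n + c)) N :=
  (Bdd.shift h c).mono (by intro e n h; beta_reduce at h; rwa [add_right_comm n N c] at h)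

end TameN

/-- Anchors -/
def Anc {E : Type*} (P : E → ℤ → Prop) (N : ℤ) (e : E) (u : ℤ) : Prop :=
  P e u ∧ ((0 ≤ u ∧ u < N) ∨ ¬ P e (u - N) ∨ ¬ P e (u + N))

/-- chains -/
def Chain {E : Type*} (P : E → ℤ → Prop) (N : ℤ) (e : E) (u n : ℤ) : Prop :=
  N ∣ n - u ∧ ∀ m, N ∣ m - u → (u ≤ m ∧ m ≤ n ∨ n ≤ m ∧ m ≤ u) → P e m

theorem Anc.bdd {E : Type*} {P : E → ℤ → Prop} {N : ℤ} (h : TameN P N) : Bdd (Anc P N) := by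
  refine (((Bdd.fin (Finset.Ico 0 N)).or h).or (Bdd.shift h (-N))).mono ?_
  rintro e n ⟨h1, h2⟩
  have : n + -N + N = n := by ring
  rw [this, ← sub_eq_add_neg]
  simp only [Finset.mem_Ico]
  tauto

theorem walk {E : Type*} {P : E → ℤ → Prop} {N : ℤ} (hN : 0 < N) (e : E) (n : ℤ) (hn : P e n) :
    ∃ u, Anc P N e u ∧ Chain P N e u n := by
  by_cases h0 : 0 ≤ n
  · obtain ⟨k, hk⟩ := Int.eq_ofNat_of_zero_le h0
    induction k using Nat.strong_induction_on generalizing n with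
    | _ k ih =>
      by_cases hlt : n < N
      · refine ⟨n, ⟨hn, Or.inl ⟨h0, hlt⟩⟩, by simp, fun m _ h => ?_⟩
        have : m = n := by omega
        rwa [this]
      by_cases hp : P e (n - N)
      · obtain ⟨u, hu, hd, hc⟩ := ih (n - N).toNat (by omega) (n - N) hp (by omega) (by omega)
        refine ⟨u, hu, ?_, fun m hm h => ?_⟩
        · have : n - u = (n - N - u) + N := by ring
          rw [this]; exact dvd_add hd dvd_rfl
        · by_cases hmn : m = n
          · rwa [hmn]
          by_cases hmn' : m ≤ n - N
          · exact hc m hm (by omega)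
          by_cases hmn2 : n ≤ m
          · exact hc m hm (by omega)
          exfalso
          have : N ∣ m - (n - N) := by
            have : m - (n - N) = (m - u) - (n - N - u) := by ring
            rw [this]; exact dvd_sub hm hd
          have := Int.le_of_dvd (by omega) this
          omega
      · refine ⟨n, ⟨hn, Or.inr (Or.inl hp)⟩, by simp, fun m _ h => ?_⟩
        have : m = n := by omega
        rwa [this]
  · push Not at h0
    obtain ⟨k, hk⟩ := Int.eq_ofNat_of_zero_le (a := -n) (by omega)
    induction k using Nat.strong_induction_on generalizing n with
    | _ k ih =>
      by_cases hp : P e (n + N)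
      · by_cases hlt : 0 ≤ n + N
        · refine ⟨n + N, ⟨hp, Or.inl ⟨hlt, by omega⟩⟩, by simp, fun m hm h => ?_⟩
          by_cases hmn : m = n
          · rwa [hmn]
          by_cases hmn' : m = n + N
          · rwa [hmn']
          exfalso
          have := Int.le_of_dvd (by omega) ((Int.dvd_neg).2 hm)
          omega
        obtain ⟨u, hu, hd, hc⟩ := ih (-(n + N)).toNat (by omega) (n + N) hp (by omega) (by omega)
        refine ⟨u, hu, ?_, fun m hm h => ?_⟩
        · have : n - u = (n + N - u) - N := by ring
          rw [this]; exact dvd_sub hd dvd_rfl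
        · by_cases hmn : m = n
          · rwa [hmn]
          by_cases hmn' : n + N ≤ m
          · exact hc m hm (by omega)
          by_cases hmn2 : m ≤ n
          · exact hc m hm (by omega)
          exfalso
          have : N ∣ (n + N) - m := by
            have : (n + N) - m = (n + N - u) - (m - u) := by ring
            rw [this]; exact dvd_sub hd hm
          have := Int.le_of_dvd (by omega) this
          omega
      · refine ⟨n, ⟨hn, Or.inr (Or.inr hp)⟩, by simp, fun m _ h => ?_⟩
        have : m = n := by omega
        rwa [this]

end PM


namespace PM

def Mn {E : Type*} (P : E × ℤ → Prop) (q : E × ℤ) : Prop := P q ∧ ∀ m, P (q.1, m) → q.2 ≤ m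

theorem Mn.bdd {E : Type*} {P : E × ℤ → Prop} {k : ℕ}
    (h : ∀ e, {n | P (e, n)}.encard ≤ (k + 1 : ℕ)) (e : E) :
    {n | P (e, n) ∧ ¬ Mn P (e, n)}.encard ≤ k := by
  by_cases hne : ∃ n, P (e, n)
  · have hfin : {n | P (e, n)}.Finite := Set.finite_of_encard_le_coe (h e)
    obtain ⟨m, hm, hmin⟩ := Set.exists_min_image _ id hfin hne
    have h1 : {n | P (e, n) ∧ ¬ Mn P (e, n)} ⊆ {n | P (e, n)} \ {m} := by
      rintro n ⟨hn, hn'⟩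
      refine ⟨hn, ?_⟩
      rintro rfl
      exact hn' ⟨hn, fun m' h' => hmin m' h'⟩
    refine (Set.encard_le_encard h1).trans ?_
    have h2 := Set.encard_diff_singleton_add_one hm
    have h3 := h e
    rw [← h2] at h3
    push_cast at h3
    exact (ENat.add_le_add_iff_right (by simp)).1 h3
  · push Not at hne
    have : {n | P (e, n) ∧ ¬ Mn P (e, n)} = ∅ := by
      ext n; simp [hne]
    rw [this]; simp

theorem DC.comp2 {D : ∀ (E : Type) [AddCommGroup E] [AddMonoid.FG E], (E → Prop) → Prop}
    (hD : DC D) {E F : Type} [AddCommGroup E] [AddMonoid.FG E] [AddCommGroup F] [AddMonoid.FG F]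
    {P : F → Prop} (h : D F P)  {t : E → F} (ht : Aff t) : D E (fun e => P (t e)) := hD.comp h ht

section
variable (D : ∀ (E : Type) [AddCommGroup E] [AddMonoid.FG E], (E → Prop) → Prop) 
variable (E : Type) [AddCommGroup E] [AddMonoid.FG E] 

def TT : Prop := ∀ P : E → Prop, D E P → SL E P
def GR : Prop := ∀ P : E × ℤ → Prop, D (E × ℤ) P → Bdd (fun e n => P (e, n)) → SL (E × ℤ) P
end

variable {D : ∀ (E : Type) [AddCommGroup E] [AddMonoid.FG E], (E → Prop) → Prop} (hD : DC D)
variable {E : Type} [AddCommGroup E] [AddMonoid.FG E]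

include hD

theorem Mn.mkD {P : E × ℤ → Prop} (h : D (E × ℤ) P) : D (E × ℤ) (Mn P) := by
  unfold Mn
  (with_reducible repeat' first | exact h | (refine DC.comp2 hD h ?_; fun_prop) | refine DC.ex hD ?_ | refine DC.all hD ?_ | refine DC.not hD ?_ | refine DC.and hD ?_ ?_ | refine DC.or hD ?_ ?_ | refine DC.imp hD ?_ ?_ | refine DC.iff hD ?_ ?_ | (refine DC.le hD ?_ ?_ <;> fun_prop) | (refine DC.lt hD ?_ ?_ <;> fun_prop) | (refine DC.eq hD ?_ ?_ <;> fun_prop) | (refine DC.dvd hD _ ?_; fun_prop))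

theorem BF (hT : TT D (E × ℤ)) {Z : E × ℤ → Prop} (hZ : D (E × ℤ) Z)
    {P : (E × ℤ) × ℤ → Prop} (hP : D ((E × ℤ) × ℤ) P) (hb : Bdd (fun e n => Z (e, n))) :
    SL ((E × ℤ) × ℤ) (fun q => Z q.1 ∧ P q) := by
  obtain ⟨k, hk⟩ := hb
  induction k generalizing Z with
  | zero =>
    refine SL_dc.congr (SL_dc.const False) ?_
    rintro ⟨⟨a, n⟩, y⟩
    have := hk a
    simp only [Nat.cast_zero, nonpos_iff_eq_zero, Set.encard_eq_zero] at this
    have h2 : n ∉ {n | Z (a, n)} := by rw [this]; simp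
    simpa using fun h => absurd h h2
  | succ k ih =>
    have hM := Mn.mkD hD hZ
    have h1 : D (E × ℤ) (fun q => ∃ n, Mn Z (q.1, n) ∧ P ((q.1, n), q.2)) := by
      (with_reducible repeat' first | exact hM | (refine DC.comp2 hD hM ?_; fun_prop) | exact hP | (refine DC.comp2 hD hP ?_; fun_prop) | refine DC.ex hD ?_ | refine DC.all hD ?_ | refine DC.not hD ?_ | refine DC.and hD ?_ ?_ | refine DC.or hD ?_ ?_ | refine DC.imp hD ?_ ?_ | refine DC.iff hD ?_ ?_ | (refine DC.le hD ?_ ?_ <;> fun_prop) | (refine DC.lt hD ?_ ?_ <;> fun_prop) | (refine DC.eq hD ?_ ?_ <;> fun_prop) | (refine DC.dvd hD _ ?_; fun_prop))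
    have h2 := ih (Z := fun q => Z q ∧ ¬ Mn Z q) (hD.and (by assumption) (hD.not hM)) (fun e => Mn.bdd hk e)
    have h3 : SL ((E × ℤ) × ℤ) (fun q => Mn Z q.1 ∧ ∃ n, Mn Z (q.1.1, n) ∧ P ((q.1.1, n), q.2)) := by
      refine SL_dc.and ?_ ?_
      · exact SL_dc.comp (hT _ hM) (by fun_prop)
      · exact SL_dc.comp (t := fun q : (E × ℤ) × ℤ => (q.1.1, q.2)) (hT _ h1) (by fun_prop)
    refine SL_dc.congr (SL_dc.or h3 h2) ?_
    rintro ⟨⟨a, n⟩, y⟩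
    constructor
    · rintro ⟨hz, hp⟩
      by_cases hm : Mn Z (a, n)
      · exact Or.inl ⟨hm, n, hm, hp⟩
      · exact Or.inr ⟨⟨hz, hm⟩, hp⟩
    · rintro (⟨hm, n', hm', hp⟩ | ⟨⟨hz, hm⟩, hp⟩)
      · have : n = n' := le_antisymm (hm.2 _ hm'.1) (hm'.2 _ hm.1)
        subst this
        exact ⟨hm.1, hp⟩
      · exact ⟨hz, hp⟩

theorem GR_of_FN (hF : ∀ P : E × ℤ → Prop, D (E × ℤ) P → (∀ e y y', P (e, y) → P (e, y') → y = y') →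
    SL (E × ℤ) P) : GR D E := by
  rintro P hP ⟨k, hk⟩
  induction k generalizing P with
  | zero =>
    refine SL_dc.congr (SL_dc.const False) ?_
    rintro ⟨a, n⟩
    have := hk a
    simp only [Nat.cast_zero, nonpos_iff_eq_zero, Set.encard_eq_zero] at this
    have h2 : n ∉ {n | P (a, n)} := by rw [this]; simp
    simpa using h2
  | succ k ih =>
    have hM := Mn.mkD hD hP
    have h2 := ih (fun q => P q ∧ ¬ Mn P q) (hD.and (by assumption) (hD.not hM)) (fun e => Mn.bdd hk e)
    have h3 := hF _ hM (by
      intro e y y' h h'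
      exact le_antisymm (h.2 _ h'.1) (h'.2 _ h.1))
    refine SL_dc.congr (SL_dc.or h3 h2) ?_
    rintro q
    constructor
    · intro h; by_cases hm : Mn P q <;> tauto
    · rintro (h | h)
      · exact h.1
      · exact h.1

variable (hU : ∀ {E : Type} [AddCommGroup E] [AddMonoid.FG E] {P : E × ℤ → Prop}, D (E × ℤ) P →
  ∃ N : ℤ, 0 < N ∧ TameN (fun e n => P (e, n)) N)
include hU

theorem step1 (hT : TT D E) (hG : GR D E) : TT D (E × ℤ) := by
  intro P hP
  obtain ⟨N, hN, hB⟩ := hU hP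
  set dP : E × ℤ → Prop := fun q => ¬ (P q ↔ P (q.1, q.2 + N)) with hdP
  have h1 : D (E × ℤ) dP := by
    (with_reducible repeat' first | exact hP | (refine DC.comp2 hD hP ?_; fun_prop) | refine DC.ex hD ?_ | refine DC.all hD ?_ | refine DC.not hD ?_ | refine DC.and hD ?_ ?_ | refine DC.or hD ?_ ?_ | refine DC.imp hD ?_ ?_ | refine DC.iff hD ?_ ?_ | (refine DC.le hD ?_ ?_ <;> fun_prop) | (refine DC.lt hD ?_ ?_ <;> fun_prop) | (refine DC.eq hD ?_ ?_ <;> fun_prop) | (refine DC.dvd hD _ ?_; fun_prop))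
  have h2 : SL (E × ℤ) dP := hG _ h1 hB
  have h3 : SL (E × ℤ) (fun q => dP q ∧ P q) := by
    refine hG _ (hD.and h1 hP) (Bdd.mono hB ?_)
    intro e n h; exact h.1
  have h4 : ∀ r : ℤ, SL E (fun e => ∃ y0, ∀ y, y0 ≤ y → N ∣ y - r → P (e, y)) := by
    intro r
    apply hT
    (with_reducible repeat' first | exact hP | (refine DC.comp2 hD hP ?_; fun_prop) | refine DC.ex hD ?_ | refine DC.all hD ?_ | refine DC.not hD ?_ | refine DC.and hD ?_ ?_ | refine DC.or hD ?_ ?_ | refine DC.imp hD ?_ ?_ | refine DC.iff hD ?_ ?_ | (refine DC.le hD ?_ ?_ <;> fun_prop) | (refine DC.lt hD ?_ ?_ <;> fun_prop) | (refine DC.eq hD ?_ ?_ <;> fun_prop) | (refine DC.dvd hD _ ?_; fun_prop))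
  have hS := SL_dc
  have h5 : SL (E × ℤ) (fun q => (∃ e, q.2 ≤ e ∧ N ∣ e - q.2 ∧ (dP (q.1, e) ∧ P (q.1, e)) ∧
      ∀ e', q.2 ≤ e' → e' < e → dP (q.1, e') → ¬ N ∣ e' - q.2)) := by
    (with_reducible repeat' first | exact h2 | (refine DC.comp2 hS h2 ?_; fun_prop) | exact h3 | (refine DC.comp2 hS h3 ?_; fun_prop) | refine DC.ex hS ?_ | refine DC.all hS ?_ | refine DC.not hS ?_ | refine DC.and hS ?_ ?_ | refine DC.or hS ?_ ?_ | refine DC.imp hS ?_ ?_ | refine DC.iff hS ?_ ?_ | (refine DC.le hS ?_ ?_ <;> fun_prop) | (refine DC.lt hS ?_ ?_ <;> fun_prop) | (refine DC.eq hS ?_ ?_ <;> fun_prop) | (refine DC.dvd hS _ ?_; fun_prop))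
  have h6 : SL (E × ℤ) (fun q => (∀ e, q.2 ≤ e → N ∣ e - q.2 → ¬ dP (q.1, e)) ∧
      ∃ r ∈ Finset.Ico 0 N, N ∣ q.2 - r ∧ ∃ y0, ∀ y, y0 ≤ y → N ∣ y - r → P (q.1, y)) := by
    refine hS.and ?_ ?_
    · (with_reducible repeat' first | exact h2 | (refine DC.comp2 hS h2 ?_; fun_prop) | refine DC.ex hS ?_ | refine DC.all hS ?_ | refine DC.not hS ?_ | refine DC.and hS ?_ ?_ | refine DC.or hS ?_ ?_ | refine DC.imp hS ?_ ?_ | refine DC.iff hS ?_ ?_ | (refine DC.le hS ?_ ?_ <;> fun_prop) | (refine DC.lt hS ?_ ?_ <;> fun_prop) | (refine DC.eq hS ?_ ?_ <;> fun_prop) | (refine DC.dvd hS _ ?_; fun_prop))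
    · refine hS.finex _ fun r => ?_
      refine hS.and (hS.dvd _ (by fun_prop)) ?_
      exact hS.comp (t := fun q : E × ℤ => q.1) (h4 r) (by fun_prop)
  -- walking
  have key : ∀ (a : E) (y : ℤ) (k : ℕ), (∀ i < k, ¬ dP (a, y + N * i)) →
      (P (a, y) ↔ P (a, y + N * k)) := by
    intro a y k
    induction k with
    | zero => simp
    | succ k ih =>
      intro h
      rw [ih (fun i hi => h i (by omega))]
      have := h k (by omega)
      simp only [hdP, not_not] at this
      rw [this]
      have e : y + N * k + N = y + N * ((k + 1 : ℕ) : ℤ) := by push_cast; ring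
      rw [e]
  refine hS.congr (hS.or h5 h6) ?_
  rintro ⟨a, y⟩
  by_cases hex : ∃ k : ℕ, dP (a, y + N * k)
  · classical
    have hk := Nat.find_spec hex
    have hkm : ∀ i < Nat.find hex, ¬ dP (a, y + N * i) := fun i hi => Nat.find_min hex hi
    set k := Nat.find hex
    have hP' := key a y k hkm
    constructor
    · intro h
      refine Or.inl ⟨y + N * k, by simp; positivity, by simp, ⟨hk, hP'.1 h⟩, ?_⟩
      rintro e' h1 h2 h3 ⟨c, hc⟩
      simp only at h1 h2 h3 hc
      have hc0 : 0 ≤ c := by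
        by_contra hneg
        have : N * c < 0 := mul_neg_of_pos_of_neg hN (by omega)
        omega
      obtain ⟨c, rfl⟩ := Int.eq_ofNat_of_zero_le hc0
      have e1 : e' = y + N * (c : ℕ) := by omega
      subst e1
      refine hkm c ?_ h3
      have : N * (c : ℤ) < N * k := by omega
      have := lt_of_mul_lt_mul_left this hN.le
      exact_mod_cast this
    · rintro (⟨e, h1, ⟨c, hc⟩, ⟨h3, h4⟩, h5⟩ | ⟨h, -⟩)
      · simp only at h1 hc h3 h4 h5
        have hc0 : 0 ≤ c := by
          by_contra hneg
          have : N * c < 0 := mul_neg_of_pos_of_neg hN (by omega)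
          omega
        obtain ⟨c, rfl⟩ := Int.eq_ofNat_of_zero_le hc0
        have e1 : e = y + N * (c : ℕ) := by omega
        subst e1
        rw [key a y c]
        · exact h4
        · intro i hi hdi
          refine h5 _ ?_ ?_ hdi (by simp)
          · simp; positivity
          · simp; 
            exact mul_lt_mul_of_pos_left (by exact_mod_cast hi) hN
      · exact absurd hk (h _ (by simp; positivity) (by simp))
  · push Not at hex
    have hev : ∀ k : ℕ, (P (a, y) ↔ P (a, y + N * k)) := fun k => key a y k (fun i _ => hex i)
    constructor
    · intro h
      refine Or.inr ⟨?_, y % N, ?_, ?_, y, ?_⟩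
      · rintro e h1 ⟨c, hc⟩
        simp only at h1 hc
        have hc0 : 0 ≤ c := by
          by_contra hneg
          have : N * c < 0 := mul_neg_of_pos_of_neg hN (by omega)
          omega
        obtain ⟨c, rfl⟩ := Int.eq_ofNat_of_zero_le hc0
        have e1 : e = y + N * (c : ℕ) := by omega
        subst e1
        exact hex c
      · simp [Int.emod_nonneg _ hN.ne', Int.emod_lt_of_pos _ hN]
      · exact Int.dvd_self_sub_emod
      · intro z hz hd
        have : N ∣ z - y := by
          have h1 : N ∣ y - y % N := Int.dvd_self_sub_emod
          have : z - y = (z - y % N) - (y - y % N) := by ring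
          rw [this]; exact dvd_sub hd h1
        obtain ⟨c, hc⟩ := this
        have hc0 : 0 ≤ c := by
          by_contra hneg
          have : N * c < 0 := mul_neg_of_pos_of_neg hN (by omega)
          omega
        obtain ⟨c, rfl⟩ := Int.eq_ofNat_of_zero_le hc0
        have e1 : z = y + N * (c : ℕ) := by omega
        subst e1
        exact (hev c).1 h
    · rintro (⟨e, h1, ⟨c, hc⟩, ⟨h3, h4⟩, h5⟩ | ⟨h, r, hr, hd, y0, hy⟩)
      · simp only at h1 hc h3 h4 h5
        have hc0 : 0 ≤ c := by
          by_contra hneg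
          have : N * c < 0 := mul_neg_of_pos_of_neg hN (by omega)
          omega
        obtain ⟨c, rfl⟩ := Int.eq_ofNat_of_zero_le hc0
        have e1 : e = y + N * (c : ℕ) := by omega
        subst e1
        exact absurd h3 (hex c)
      · simp only at hd hy
        rw [hev (y0 - y).toNat]
        apply hy
        · have : (y0 - y) ≤ N * ((y0 - y).toNat : ℤ) := by
            have := Int.self_le_toNat (y0 - y)
            nlinarith
          omega
        · have : y + N * ((y0 - y).toNat : ℤ) - r = (y - r) + N * ((y0 - y).toNat : ℤ) := by ring
          rw [this]
          exact dvd_add hd (by simp)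

end PM


namespace PM

def UpP {E : Type*} (G : (E × ℤ) × ℤ → Prop) (q : (E × ℤ) × ℤ) : Prop :=
  ∃ y y', G ((q.1.1, q.2), y) ∧ G ((q.1.1, q.2 + q.1.2), y') ∧ y < y'

def EqP {E : Type*} (G : (E × ℤ) × ℤ → Prop) (q : ((E × ℤ) × ℤ) × ℤ) : Prop :=
  ∃ y, G ((q.1.1.1, q.2), y) ∧ G ((q.1.1.1, q.2 + q.1.1.2), y + q.1.2)

variable {D : ∀ (E : Type) [AddCommGroup E] [AddMonoid.FG E], (E → Prop) → Prop} (hD : DC D)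
variable {E : Type} [AddCommGroup E] [AddMonoid.FG E]

theorem chain_mono {E : Type*} {G : (E × ℤ) × ℤ → Prop} {N : ℤ} (hN : 0 < N)
    (hf : ∀ b y y', G (b, y) → G (b, y') → y = y') {e : E} {u n m y' z : ℤ}
    (hn : Chain (fun e n => UpP G ((e, N), n)) N e u n)
    (hm : Chain (fun e n => UpP G ((e, N), n)) N e u m) (hnm : n < m)
    (hy' : G ((e, n + N), y')) (hz : G ((e, m), z)) : y' ≤ z := by
  have hup : ∀ l, N ∣ l - n → n ≤ l → l ≤ m → UpP G ((e, N), l) := by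
    intro l hl h1 h2
    have hlu : N ∣ l - u := by
      have : l - u = (l - n) + (n - u) := by ring
      rw [this]; exact dvd_add hl hn.1
    by_cases h : l ≤ u
    · exact hn.2 l hlu (by omega)
    · exact hm.2 l hlu (by omega)
  have claim : ∀ k : ℕ, n + N * (k + 1) ≤ m → ∃ z, G ((e, n + N * (k + 1)), z) ∧ y' ≤ z := by
    intro k
    induction k with
    | zero => intro h; exact ⟨y', by simpa using hy', le_rfl⟩
    | succ k ih =>
      intro h
      push_cast at h
      obtain ⟨z, hz, hyz⟩ := ih (by nlinarith)
      obtain ⟨a, b, ha, hb, hab⟩ := hup (n + N * (k + 1)) (by simp) (by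
        have : 0 ≤ N * ((k : ℤ) + 1) := by positivity
        omega) (by nlinarith)
      simp only at ha hb
      have := hf _ _ _ ha hz
      refine ⟨b, ?_, by omega⟩
      have e1 : n + N * (((k + 1 : ℕ) : ℤ) + 1) = n + N * (k + 1) + N := by push_cast; ring
      rw [e1]; exact hb
  have hd : N ∣ m - n := by
    have : m - n = (m - u) - (n - u) := by ring
    rw [this]; exact dvd_sub hm.1 hn.1
  obtain ⟨c, hc⟩ := hd
  have hc0 : 0 < c := by
    by_contra hneg
    have : N * c ≤ 0 := mul_nonpos_of_nonneg_of_nonpos hN.le (by omega)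
    omega
  obtain ⟨k, rfl⟩ : ∃ k : ℕ, c = k + 1 := ⟨(c - 1).toNat, by omega⟩
  have e1 : m = n + N * (k + 1) := by omega
  subst e1
  obtain ⟨z', hz', h⟩ := claim k le_rfl
  rwa [hf _ _ _ hz hz']

theorem chain_aff {E : Type*} {G : (E × ℤ) × ℤ → Prop} {N t : ℤ} (hN : 0 < N)
    {e : E} {u n y : ℤ} (hf : ∀ b y y', G (b, y) → G (b, y') → y = y')
    (hn : Chain (fun e n => ∃ y, G ((e, n), y) ∧ G ((e, n + N), y + t) ∧ G ((e, n - N), y - t))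
      N e u n) (hy : G ((e, u), y)) : ∃ z, G ((e, n), z) ∧ N * (z - y) = t * (n - u) := by
  obtain ⟨⟨c, hc⟩, h⟩ := hn
  rcases le_total 0 c with h0 | h0
  · obtain ⟨k, rfl⟩ := Int.eq_ofNat_of_zero_le h0
    have claim : ∀ j : ℕ, j ≤ k → G ((e, u + N * j), y + t * j) := by
      intro j
      induction j with
      | zero => intro _; simpa using hy
      | succ j ih =>
        intro hj
        have h1 := ih (by omega)
        have hjk : N * (j : ℤ) ≤ N * k := by gcongr; omega
        have h00 : 0 ≤ N * (j : ℤ) := by positivity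
        obtain ⟨z, hz, hz1, -⟩ := h (u + N * j) (by simp) (by omega)
        rw [hf _ _ _ hz h1] at hz1
        have e2 : u + N * ((j + 1 : ℕ) : ℤ) = u + N * j + N := by push_cast; ring
        have e3 : y + t * ((j + 1 : ℕ) : ℤ) = y + t * j + t := by push_cast; ring
        rw [e2, e3]; exact hz1
    have := claim k le_rfl
    have e1 : n = u + N * k := by omega
    subst e1
    exact ⟨_, this, by ring⟩
  · obtain ⟨k, hk⟩ := Int.eq_ofNat_of_zero_le (a := -c) (by omega)
    obtain rfl : c = -k := by omega
    have claim : ∀ j : ℕ, j ≤ k → G ((e, u - N * j), y - t * j) := by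
      intro j
      induction j with
      | zero => intro _; simpa using hy
      | succ j ih =>
        intro hj
        have h1 := ih (by omega)
        have hjk : N * (j : ℤ) ≤ N * k := by gcongr; omega
        have h00 : 0 ≤ N * (j : ℤ) := by positivity
        have hh : N * -(k : ℤ) = -(N * k) := by ring
        obtain ⟨z, hz, -, hz1⟩ := h (u - N * j) ⟨-j, by ring⟩ (by omega)
        rw [hf _ _ _ hz h1] at hz1
        have e2 : u - N * ((j + 1 : ℕ) : ℤ) = u - N * j - N := by push_cast; ring
        have e3 : y - t * ((j + 1 : ℕ) : ℤ) = y - t * j - t := by push_cast; ring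
        rw [e2, e3]; exact hz1
    have := claim k le_rfl
    have e1 : n = u - N * k := by linarith
    subst e1
    exact ⟨_, this, by ring⟩

include hD

theorem chainD {U : E × ℤ → Prop} (h : D (E × ℤ) U) (N : ℤ) :
    D ((E × ℤ) × ℤ) (fun q => Chain (fun e n => U (e, n)) N q.1.1 q.1.2 q.2) := by
  unfold Chain
  (with_reducible repeat' first | exact h | (refine DC.comp2 hD h ?_; fun_prop) | refine DC.ex hD ?_ | refine DC.all hD ?_ | refine DC.not hD ?_ | refine DC.and hD ?_ ?_ | refine DC.or hD ?_ ?_ | refine DC.imp hD ?_ ?_ | refine DC.iff hD ?_ ?_ | (refine DC.le hD ?_ ?_ <;> fun_prop) | (refine DC.lt hD ?_ ?_ <;> fun_prop) | (refine DC.eq hD ?_ ?_ <;> fun_prop) | (refine DC.dvd hD _ ?_; fun_prop))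

variable (hU : ∀ {E : Type} [AddCommGroup E] [AddMonoid.FG E] {P : E × ℤ → Prop}, D (E × ℤ) P →
  ∃ N : ℤ, 0 < N ∧ TameN (fun e n => P (e, n)) N)
include hU

theorem incBdd {G : (E × ℤ) × ℤ → Prop} (hG : D ((E × ℤ) × ℤ) G)
    (hf : ∀ b y y', G (b, y) → G (b, y') → y = y') {N : ℤ} (hN : 0 < N)
    (hT : TameN (fun e n => UpP G ((e, N), n)) N) :
    ∃ q : ℤ, 0 < q ∧ Bdd (fun e n => ∃ y y', G ((e, n), y) ∧ G ((e, n + N), y') ∧ y + q < y') := by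
  have hUp : D (E × ℤ) (fun q => UpP G ((q.1, N), q.2)) := by
    unfold UpP
    (with_reducible repeat' first | exact hG | (refine DC.comp2 hD hG ?_; fun_prop) | refine DC.ex hD ?_ | refine DC.all hD ?_ | refine DC.not hD ?_ | refine DC.and hD ?_ ?_ | refine DC.or hD ?_ ?_ | refine DC.imp hD ?_ ?_ | refine DC.iff hD ?_ ?_ | (refine DC.le hD ?_ ?_ <;> fun_prop) | (refine DC.lt hD ?_ ?_ <;> fun_prop) | (refine DC.eq hD ?_ ?_ <;> fun_prop) | (refine DC.dvd hD _ ?_; fun_prop))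
  obtain ⟨q, hq, hI⟩ := hU (E := E × ℤ)
    (P := fun b => ∃ n, Chain (fun e n => UpP G ((e, N), n)) N b.1.1 b.1.2 n ∧ G ((b.1.1, n), b.2)) (by
      refine hD.ex (hD.and ?_ ?_)
      · exact hD.comp2 (chainD hD hUp N) (t := fun q : ((E × ℤ) × ℤ) × ℤ => ((q.1.1.1, q.1.1.2), q.2)) (by fun_prop)
      · (with_reducible repeat' first | exact hG | (refine DC.comp2 hD hG ?_; fun_prop) | refine DC.ex hD ?_ | refine DC.all hD ?_ | refine DC.not hD ?_ | refine DC.and hD ?_ ?_ | refine DC.or hD ?_ ?_ | refine DC.imp hD ?_ ?_ | refine DC.iff hD ?_ ?_ | (refine DC.le hD ?_ ?_ <;> fun_prop) | (refine DC.lt hD ?_ ?_ <;> fun_prop) | (refine DC.eq hD ?_ ?_ <;> fun_prop) | (refine DC.dvd hD _ ?_; fun_prop)))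
  refine ⟨q, hq, ?_⟩
  have h1 : Bdd (fun (b : E × ℤ) n => Chain (fun e n => UpP G ((e, N), n)) N b.1 b.2 n ∧
      ∃ y y', G ((b.1, n), y) ∧ G ((b.1, n + N), y') ∧ y + q < y') := by
    classical
    refine Bdd.inj hI (fun b n => if h : ∃ y, G ((b.1, n), y) then h.choose else 0) ?_ ?_
    · rintro ⟨e, u⟩ n ⟨hc, y, y', hy, hy', hyy⟩
      have hex : ∃ y, G ((e, n), y) := ⟨y, hy⟩
      simp only [hex, dif_pos]
      have := hex.choose_spec
      rw [hf _ _ _ this hy]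
      intro hiff
      obtain ⟨m, hcm, hm⟩ := hiff.1 ⟨n, hc, hy⟩
      simp only at hc hcm hm
      rcases lt_trichotomy n m with h | h | h
      · have := chain_mono hN hf hc hcm h hy' hm
        omega
      · subst h
        have := hf _ _ _ hm hy
        omega
      · obtain ⟨z, z', hz, hz', hzz⟩ := hcm.2 m hcm.1 (by omega)
        simp only at hz hz'
        have := chain_mono hN hf hcm hc h hz' hy
        have := hf _ _ _ hz hm
        omega
    · rintro ⟨e, u⟩ n m ⟨hc, y, y', hy, hy', hyy⟩ ⟨hc2, z, z', hz, hz', hzz⟩ heq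
      have hex : ∃ y, G ((e, n), y) := ⟨y, hy⟩
      have hex2 : ∃ y, G ((e, m), y) := ⟨z, hz⟩
      simp only [hex, hex2, dif_pos] at heq
      rw [hf _ _ _ hex.choose_spec hy, hf _ _ _ hex2.choose_spec hz] at heq
      rcases lt_trichotomy n m with h | h | h
      · have := chain_mono hN hf hc hc2 h hy' hz
        omega
      · exact h
      · have := chain_mono hN hf hc2 hc h hz' hy
        omega
  refine ((Anc.bdd hT).bind h1).mono ?_
  rintro e n ⟨y, y', hy, hy', hyy⟩
  obtain ⟨u, hu, hc⟩ := walk (P := fun e n => UpP G ((e, N), n)) hN e n ⟨y, y', hy, hy', by omega⟩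
  exact ⟨u, hu, hc, y, y', hy, hy', hyy⟩

theorem step2 (hT : TT D (E × ℤ)) {G : (E × ℤ) × ℤ → Prop} (hG : D ((E × ℤ) × ℤ) G)
    (hf : ∀ b y y', G (b, y) → G (b, y') → y = y') : SL ((E × ℤ) × ℤ) G := by
  have hG' : D ((E × ℤ) × ℤ) (fun q => G (q.1, -q.2)) := hD.comp hG (by fun_prop)
  have hf' : ∀ b y y', G (b, -y) → G (b, -y') → y = y' := fun b y y' h h' => by
    have := hf _ _ _ h h'; omega
  have hB : D (E × ℤ) (fun b => ∃ y, G (b, y)) := by (with_reducible repeat' first | exact hG | (refine DC.comp2 hD hG ?_; fun_prop) | refine DC.ex hD ?_ | refine DC.all hD ?_ | refine DC.not hD ?_ | refine DC.and hD ?_ ?_ | refine DC.or hD ?_ ?_ | refine DC.imp hD ?_ ?_ | refine DC.iff hD ?_ ?_ | (refine DC.le hD ?_ ?_ <;> fun_prop) | (refine DC.lt hD ?_ ?_ <;> fun_prop) | (refine DC.eq hD ?_ ?_ <;> fun_prop) | (refine DC.dvd hD _ ?_; fun_prop))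
  obtain ⟨N1, hN1, hT1⟩ := hU hB
  obtain ⟨N2, hN2, hT2⟩ := hU (P := UpP G) (by unfold UpP; (with_reducible repeat' first | exact hG | (refine DC.comp2 hD hG ?_; fun_prop) | refine DC.ex hD ?_ | refine DC.all hD ?_ | refine DC.not hD ?_ | refine DC.and hD ?_ ?_ | refine DC.or hD ?_ ?_ | refine DC.imp hD ?_ ?_ | refine DC.iff hD ?_ ?_ | (refine DC.le hD ?_ ?_ <;> fun_prop) | (refine DC.lt hD ?_ ?_ <;> fun_prop) | (refine DC.eq hD ?_ ?_ <;> fun_prop) | (refine DC.dvd hD _ ?_; fun_prop)))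
  obtain ⟨N3, hN3, hT3⟩ := hU (P := UpP (fun q => G (q.1, -q.2))) (by unfold UpP; (with_reducible repeat' first | exact hG | (refine DC.comp2 hD hG ?_; fun_prop) | refine DC.ex hD ?_ | refine DC.all hD ?_ | refine DC.not hD ?_ | refine DC.and hD ?_ ?_ | refine DC.or hD ?_ ?_ | refine DC.imp hD ?_ ?_ | refine DC.iff hD ?_ ?_ | (refine DC.le hD ?_ ?_ <;> fun_prop) | (refine DC.lt hD ?_ ?_ <;> fun_prop) | (refine DC.eq hD ?_ ?_ <;> fun_prop) | (refine DC.dvd hD _ ?_; fun_prop)))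
  obtain ⟨N4, hN4, hT4⟩ := hU (P := EqP G) (by unfold EqP; (with_reducible repeat' first | exact hG | (refine DC.comp2 hD hG ?_; fun_prop) | refine DC.ex hD ?_ | refine DC.all hD ?_ | refine DC.not hD ?_ | refine DC.and hD ?_ ?_ | refine DC.or hD ?_ ?_ | refine DC.imp hD ?_ ?_ | refine DC.iff hD ?_ ?_ | (refine DC.le hD ?_ ?_ <;> fun_prop) | (refine DC.lt hD ?_ ?_ <;> fun_prop) | (refine DC.eq hD ?_ ?_ <;> fun_prop) | (refine DC.dvd hD _ ?_; fun_prop)))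
  obtain ⟨N, hN, hT1, hT2, hT3, hT4⟩ : ∃ N : ℤ, 0 < N ∧ TameN (fun e n => ∃ y, G ((e, n), y)) N ∧
      TameN (fun e n => UpP G ((e, N), n)) N ∧
      TameN (fun e n => UpP (fun q => G (q.1, -q.2)) ((e, N), n)) N ∧
      ∀ t, TameN (fun e n => EqP G (((e, N), t), n)) N := by
    refine ⟨N1 * N2 * N3 * N4, by positivity, ?_, ?_, ?_, fun t => ?_⟩
    · have := hT1.mulInt (N2 * N3 * N4) (by positivity)
      rwa [show N1 * (N2 * N3 * N4) = N1 * N2 * N3 * N4 by ring] at this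
    · have := (hT2.mulInt (N1 * N3 * N4) (by positivity)).comp (fun e => (e, N1 * N2 * N3 * N4))
      rwa [show N2 * (N1 * N3 * N4) = N1 * N2 * N3 * N4 by ring] at this
    · have := (hT3.mulInt (N1 * N2 * N4) (by positivity)).comp (fun e => (e, N1 * N2 * N3 * N4))
      rwa [show N3 * (N1 * N2 * N4) = N1 * N2 * N3 * N4 by ring] at this
    · have := (hT4.mulInt (N1 * N2 * N3) (by positivity)).comp
        (fun e => ((e, N1 * N2 * N3 * N4), t))
      rwa [show N4 * (N1 * N2 * N3) = N1 * N2 * N3 * N4 by ring] at this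
  obtain ⟨q1, hq1, hb1⟩ := incBdd hD hU hG hf hN hT2
  obtain ⟨q2, hq2, hb2⟩ := incBdd hD hU hG' hf' hN hT3
  set S : ℤ → E × ℤ → Prop := fun t b =>
    ∃ y, G ((b.1, b.2), y) ∧ G ((b.1, b.2 + N), y + t) ∧ G ((b.1, b.2 - N), y - t) with hS
  have hSD : ∀ t, D (E × ℤ) (S t) := by intro t; simp only [hS]; (with_reducible repeat' first | exact hG | (refine DC.comp2 hD hG ?_; fun_prop) | refine DC.ex hD ?_ | refine DC.all hD ?_ | refine DC.not hD ?_ | refine DC.and hD ?_ ?_ | refine DC.or hD ?_ ?_ | refine DC.imp hD ?_ ?_ | refine DC.iff hD ?_ ?_ | (refine DC.le hD ?_ ?_ <;> fun_prop) | (refine DC.lt hD ?_ ?_ <;> fun_prop) | (refine DC.eq hD ?_ ?_ <;> fun_prop) | (refine DC.dvd hD _ ?_; fun_prop))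
  have hSL : ∀ t, SL (E × ℤ) (S t) := fun t => hT _ (hSD t)
  have hSeq : ∀ t e n, S t (e, n) ↔ EqP G (((e, N), t), n) ∧ EqP G (((e, N), t), n + -N) := by
    intro t e n
    constructor
    · rintro ⟨y, h1, h2, h3⟩
      refine ⟨⟨y, h1, h2⟩, ⟨y - t, by simpa [sub_eq_add_neg] using h3, by simpa using h1⟩⟩
    · rintro ⟨⟨y, h1, h2⟩, ⟨z, h3, h4⟩⟩
      simp only [neg_add_cancel_right] at h1 h2 h3 h4
      have := hf _ _ _ h1 h4
      subst this
      exact ⟨_, h1, h2, by simpa [sub_eq_add_neg] using h3⟩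
  have hST : ∀ t, TameN (fun e n => S t (e, n)) N := by
    intro t
    have := (hT4 t).and ((hT4 t).shift (-N))
    simpa only [hSeq] using this
  have hbad : Bdd (fun e n => (∃ y, G ((e, n), y)) ∧ ¬ ∃ t ∈ Finset.Icc (-q2) q1, S t (e, n)) := by
    refine (((((Bdd.or hT1 (Bdd.shift hT1 (-N))).or hb1).or hb2).or
      (Bdd.finex (Finset.Icc (-q2) q1) (fun t => Bdd.shift (hT4 t) (-N))))).mono ?_
    rintro e n ⟨⟨y, hy⟩, hn⟩
    simp only [neg_add_cancel_right]
    by_contra hcon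
    push Not at hcon
    obtain ⟨⟨⟨⟨h1, h2⟩, h3⟩, h4⟩, h5⟩ := hcon
    obtain ⟨y1, hy1⟩ := h1.1 ⟨y, hy⟩
    have a1 := h3 y y1 hy hy1
    have a2 := h4 (-y) (-y1) (by simpa using hy) (by simpa using hy1)
    refine hn ⟨y1 - y, ?_, ?_⟩
    · simp; omega
    · rw [hSeq]
      have hh : EqP G (((e, N), y1 - y), n) := ⟨y, hy, by simpa using hy1⟩
      refine ⟨hh, (h5 (y1 - y) (by simp; omega)).2 hh⟩
  have hbD : D (E × ℤ) (fun b => (∃ y, G (b, y)) ∧ ¬ ∃ t ∈ Finset.Icc (-q2) q1, S t b) :=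
    hD.and hB (hD.not (hD.finex _ hSD))
  have hp1 := BF hD hT hbD hG hbad
  have hAD : ∀ t, D (E × ℤ) (fun b => Anc (fun e n => S t (e, n)) N b.1 b.2) := by
    intro t
    have := hSD t
    unfold Anc
    (with_reducible repeat' first | exact this | (refine DC.comp2 hD this ?_; fun_prop) | refine DC.ex hD ?_ | refine DC.all hD ?_ | refine DC.not hD ?_ | refine DC.and hD ?_ ?_ | refine DC.or hD ?_ ?_ | refine DC.imp hD ?_ ?_ | refine DC.iff hD ?_ ?_ | (refine DC.le hD ?_ ?_ <;> fun_prop) | (refine DC.lt hD ?_ ?_ <;> fun_prop) | (refine DC.eq hD ?_ ?_ <;> fun_prop) | (refine DC.dvd hD _ ?_; fun_prop))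
  have hp2 : ∀ t, SL ((E × ℤ) × ℤ) (fun q => Anc (fun e n => S t (e, n)) N q.1.1 q.1.2 ∧ G q) :=
    fun t => BF hD hT (hAD t) hG (Anc.bdd (hST t))
  have hCh : ∀ t, SL ((E × ℤ) × ℤ) (fun q => Chain (fun e n => S t (e, n)) N q.1.1 q.1.2 q.2) := by
    intro t
    exact chainD SL_dc (hSL t) N
  have hp3 : ∀ t, SL ((E × ℤ) × ℤ) (fun q => ∃ u yu,
      (Anc (fun e n => S t (e, n)) N q.1.1 u ∧ G ((q.1.1, u), yu)) ∧
      Chain (fun e n => S t (e, n)) N q.1.1 u q.1.2 ∧ N * (q.2 - yu) = t * (q.1.2 - u)) := by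
    intro t
    have hh := SL_dc
    refine hh.ex (hh.ex (hh.and ?_ (hh.and ?_ ?_)))
    · exact hh.comp2 (hp2 t) (t := fun q : (((E × ℤ) × ℤ) × ℤ) × ℤ => ((q.1.1.1.1, q.1.2), q.2)) (by fun_prop)
    · exact hh.comp2 (hCh t) (t := fun q : (((E × ℤ) × ℤ) × ℤ) × ℤ => ((q.1.1.1.1, q.1.2), q.1.1.1.2)) (by fun_prop)
    · exact hh.eq (by fun_prop) (by fun_prop)
  refine SL_dc.congr (SL_dc.or hp1 (SL_dc.finex (Finset.Icc (-q2) q1) hp3)) ?_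
  rintro ⟨⟨e, n⟩, y⟩
  constructor
  · intro h
    by_cases hb : ∃ t ∈ Finset.Icc (-q2) q1, S t (e, n)
    · obtain ⟨t, ht, hs⟩ := hb
      obtain ⟨u, hu, hc⟩ := walk (P := fun e n => S t (e, n)) hN e n hs
      obtain ⟨yu, hyu, -⟩ := hu.1
      obtain ⟨z, hz, hze⟩ := chain_aff hN hf hc hyu
      rw [hf _ _ _ hz h] at hze
      exact Or.inr ⟨t, ht, u, yu, ⟨hu, hyu⟩, hc, hze⟩
    · exact Or.inl ⟨⟨⟨y, h⟩, hb⟩, h⟩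
  · rintro (⟨-, h⟩ | ⟨t, ht, u, yu, ⟨hu, hyu⟩, hc, hze⟩)
    · exact h
    · simp only at hyu hc hze
      obtain ⟨z, hz, hz'⟩ := chain_aff hN hf hc hyu
      have : y = z := by
        have : N * (y - yu) = N * (z - yu) := by rw [hze, hz']
        have := mul_left_cancel₀ hN.ne' this
        omega
      rwa [this]

theorem TT_all (m : ℕ) : TT D (Fin m → ℤ) := by
  suffices h : TT D (Fin m → ℤ) ∧ GR D (Fin m → ℤ) from h.1
  induction m with
  | zero =>
    constructor
    · intro P hP
      refine SL_dc.congr (SL_dc.const (P 0)) ?_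
      intro e
      rw [Subsingleton.elim e 0]
    · refine GR_of_FN hD ?_
      intro P hP hf
      by_cases h : ∃ y, P (0, y)
      · obtain ⟨y, hy⟩ := h
        refine SL_dc.congr (SL_dc.eq (s := fun q : (Fin 0 → ℤ) × ℤ => q.2) (t := fun _ => y) (by fun_prop) (by fun_prop)) ?_
        rintro ⟨e, z⟩
        rw [Subsingleton.elim e 0]
        constructor
        · intro h; exact hf _ _ _ h hy
        · rintro rfl; exact hy
      · refine SL_dc.congr (SL_dc.const False) ?_
        rintro ⟨e, z⟩
        rw [Subsingleton.elim e 0]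
        simp only [iff_false]
        exact fun h' => h ⟨z, h'⟩
  | succ m ih =>
    have h1 : TT D ((Fin m → ℤ) × ℤ) := step1 hD hU ih.1 ih.2
    have h2 : GR D ((Fin m → ℤ) × ℤ) := GR_of_FN hD (fun P hP hf => step2 hD hU h1 hP hf)
    let s : (Fin m → ℤ) × ℤ → Fin (m + 1) → ℤ := fun q => Fin.cons q.2 q.1
    let t : (Fin (m + 1) → ℤ) → (Fin m → ℤ) × ℤ := fun v => (Fin.tail v, v 0)
    have hs : Aff s := by
      refine Aff.pi fun i => ?_
      refine Fin.cases ?_ (fun i => ?_) i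
      · simp only [s, Fin.cons_zero]; fun_prop
      · simp only [s, Fin.cons_succ]; exact Aff.app (s := fun e : (Fin m → ℤ) × ℤ => e.1) (by fun_prop) i
    have ht : Aff t := by
      refine Aff.prodMk ?_ (Aff.app (Aff.id') 0)
      refine Aff.pi fun i => Aff.app (Aff.id') _
    have hst : ∀ v, s (t v) = v := fun v => by simp [s, t]
    constructor
    · intro P hP
      refine SL_dc.congr (SL_dc.comp2 (h1 _ (hD.comp2 hP hs)) ht) ?_
      intro e; rw [hst]
    · intro P hP hb
      refine SL_dc.congr (SL_dc.comp2 (t := fun q : (Fin (m+1) → ℤ) × ℤ => (t q.1, q.2)) (h2 _ (hD.comp2 (t := fun q : ((Fin m → ℤ) × ℤ) × ℤ => (s q.1, q.2)) hP (by fun_prop)) ?_) (by fun_prop)) ?_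
      · exact hb.comp s
      · rintro ⟨e, y⟩; simp only [hst]

end PM

namespace PM
open Polynomial

section padic
variable {p : ℕ} [hp : Fact p.Prime]

theorem pp1 : (1:ℝ) < p := by exact_mod_cast hp.out.one_lt
theorem pp0 : (0:ℝ) < p := by exact_mod_cast hp.out.pos
theorem ppow0 (n : ℕ) : (0:ℝ) < (p:ℝ)^n := pow_pos pp0 n
theorem ppow1 (n : ℕ) : (1:ℝ) ≤ (p:ℝ)^n := one_le_pow₀ pp1.le

/-- Taylor terms -/
noncomputable def bt (f : ℚ_[p][X]) (c s : ℚ_[p]) (j : ℕ) : ℚ_[p] := (hasseDeriv j f).eval c * s ^ j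

theorem bt_sum {f : ℚ_[p][X]} {d : ℕ} (hd : f.natDegree ≤ d) (c s : ℚ_[p]) :
    f.eval (c + s) = ∑ j ∈ Finset.range (d+1), bt f c s j := by
  rw [add_comm, ← taylor_eval, eval_eq_sum_range' (n := d+1) (by rw [natDegree_taylor]; omega)]
  simp [bt, taylor_coeff]

theorem bt_big {f : ℚ_[p][X]} {j : ℕ} (hj : f.natDegree < j) (c s : ℚ_[p]) : bt f c s j = 0 := by
  simp [bt, hasseDeriv_eq_zero_of_lt_natDegree _ _ hj]

theorem norm_nat_le (n : ℕ) : ‖(n : ℚ_[p])‖ ≤ 1 := by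
  simpa using Padic.norm_int_le_one (p := p) n

theorem sum_le {ι : Type*} (s : Finset ι) (f : ι → ℚ_[p]) {B : ℝ} (hB : 0 ≤ B) (h : ∀ i ∈ s, ‖f i‖ ≤ B) :
    ‖∑ i ∈ s, f i‖ ≤ B :=
  IsUltrametricDist.norm_sum_le_of_forall_le_of_nonneg hB h

theorem bt_shift {f : ℚ_[p][X]} {c s u : ℚ_[p]} {B : ℝ} (h : ∀ j, ‖bt f c s j‖ ≤ B)
    (hu : ‖u‖ ≤ ‖s‖) (k : ℕ) : ‖bt f (c+u) s k‖ ≤ B := by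
  have hB : 0 ≤ B := (norm_nonneg _).trans (h 0)
  unfold bt
  rw [bt_sum (d := (hasseDeriv k f).natDegree) le_rfl, Finset.sum_mul]
  refine sum_le _ _ hB fun j _ => ?_
  have := hasseDeriv_comp (R := ℚ_[p]) j k
  have h2 := congrArg (fun l => (l f).eval c) this
  simp at h2
  unfold bt
  rw [h2]
  rw [norm_mul, norm_mul, norm_mul]
  calc _ ≤ 1 * ‖eval c (hasseDeriv (j+k) f)‖ * ‖s^j‖ * ‖s^k‖ := by
        have h3 : ‖u^j‖ ≤ ‖s^j‖ := by simp only [norm_pow]; gcongr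
        have := norm_nat_le (p := p) ((j+k).choose j)
        gcongr
    _ = ‖bt f c s (j+k)‖ := by unfold bt; rw [norm_mul, pow_add, norm_mul]; ring
    _ ≤ B := h _

def near (N : ℕ) (x y : ℚ_[p]) : Prop := ‖x - y‖ * p^N ≤ ‖y‖

theorem near_lem {f : ℚ_[p][X]} {c s s' : ℚ_[p]} {B : ℝ} (h : ∀ j, ‖bt f c s j‖ ≤ B) {N : ℕ}
    (hn : near N s' s) : ‖f.eval (c+s') - f.eval (c+s)‖ * p^N ≤ B := by
  have hB : 0 ≤ B := (norm_nonneg _).trans (h 0)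
  have h2 := bt_shift h (u := s) le_rfl
  have e : c + s' = (c+s) + (s'-s) := by ring
  rw [e, bt_sum (d := f.natDegree) le_rfl, Finset.sum_range_succ']
  have : bt f (c+s) (s'-s) 0 = f.eval (c+s) := by simp [bt]
  rw [this, add_sub_cancel_right]
  rw [← le_div_iff₀ (ppow0 N)]
  refine sum_le _ _ (by positivity) fun j _ => ?_
  rw [le_div_iff₀ (ppow0 N)]
  refine le_trans ?_ (h2 (j+1))
  unfold bt near at *
  rw [norm_mul, norm_mul, norm_pow, norm_pow, mul_assoc]
  gcongr
  calc ‖s'-s‖^(j+1) * p^N ≤ ‖s'-s‖^(j+1) * (p^N)^(j+1) := by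
        gcongr
        exact le_self_pow₀ (ppow1 N) (by omega)
    _ = (‖s'-s‖ * p^N)^(j+1) := by rw [mul_pow]
    _ ≤ _ := by gcongr

theorem near_norm {N : ℕ} (hN : 1 ≤ N) {x y : ℚ_[p]} (h : near N x y) : ‖x‖ = ‖y‖ := by
  unfold near at h
  by_cases hy : y = 0
  · subst hy
    simp at h
    have : ‖x‖ ≤ 0 := by
      by_contra hx
      push Not at hx
      have := mul_pos hx (ppow0 (p := p) N)
      linarith
    simp at this; simp [this]
  · apply Padic.norm_eq_of_norm_sub_lt_right
    have hy' := norm_pos_iff.2 hy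
    by_contra hc
    push Not at hc
    have h1 : (p:ℝ) ≤ p^N := le_self_pow₀ pp1.le (by omega)
    nlinarith [pp1 (p := p)]

theorem near_mono {M N : ℕ} (hN : M ≤ N) {x y : ℚ_[p]} (h : near N x y) : near M x y := by
  refine le_trans ?_ h
  have := pp1 (p := p)
  gcongr
  exact this.le

theorem hensel_t {h : ℚ_[p][X]} {t s : ℚ_[p]} {M : ℝ}
    (hM : ∀ i, ‖bt h t s i‖ ≤ M) (hlt : ‖h.eval t‖ * M < ‖h.derivative.eval t * s‖^2) :
    ∃ t', h.eval t' = 0 ∧ ‖t' - t‖ * ‖h.derivative.eval t‖ ≤ ‖h.eval t‖ ∧ ‖t' - t‖ < ‖s‖ := by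
  have hb0 : bt h t s 0 = h.eval t := by simp [bt]
  have hb1 : bt h t s 1 = h.derivative.eval t * s := by simp [bt, hasseDeriv_one']
  obtain ⟨i0, -, hi0⟩ := Finset.exists_max_image (Finset.range (h.natDegree+2)) (fun i => ‖bt h t s i‖) ⟨0, by simp⟩
  have hmax : ∀ i, ‖bt h t s i‖ ≤ ‖bt h t s i0‖ := by
    intro i
    by_cases hi : i ∈ Finset.range (h.natDegree+2)
    · exact hi0 i hi
    · simp at hi
      rw [bt_big (by omega)]; simp
  set y := bt h t s i0 with hy
  have hlt' : ‖h.eval t‖ * ‖y‖ < ‖h.derivative.eval t * s‖^2 := by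
    refine lt_of_le_of_lt ?_ hlt
    gcongr
    exact hM i0
  have hd : h.derivative.eval t * s ≠ 0 := by
    intro h0
    rw [h0] at hlt'
    simp at hlt'
    exact absurd hlt' (by have : 0 ≤ ‖h.eval t‖ * ‖y‖ := by positivity
                          linarith)
  have hy0 : y ≠ 0 := by
    intro h0
    have := hmax 1
    rw [h0, hb1, norm_zero] at this
    exact hd (norm_le_zero_iff.1 this)
  have hyp : 0 < ‖y‖ := norm_pos_iff.2 hy0
  have hbb : ∀ i, ∃ z : ℤ_[p], (z : ℚ_[p]) = bt h t s i / y := fun i =>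
    ⟨⟨bt h t s i / y, by rw [norm_div]; exact div_le_one_of_le₀ (hmax i) (norm_nonneg _)⟩, rfl⟩
  choose bb hbb using hbb
  let F : ℤ_[p][X] := ∑ i ∈ Finset.range (h.natDegree+2), monomial i (bb i)
  have hF : ∀ z : ℤ_[p], ((F.eval z : ℤ_[p]) : ℚ_[p]) = h.eval (t + s * z) / y := by
    intro z
    rw [bt_sum (d := h.natDegree+1) (by omega)]
    simp only [F, eval_finset_sum, eval_monomial, PadicInt.coe_sum, PadicInt.coe_mul, PadicInt.coe_pow, Finset.sum_div]
    refine Finset.sum_congr rfl fun i _ => ?_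
    rw [hbb]; simp [bt]; ring
  have hF' : ((F.derivative.eval 0 : ℤ_[p]) : ℚ_[p]) = h.derivative.eval t * s / y := by
    rw [← hb1, ← coeff_zero_eq_eval_zero, coeff_derivative]
    simp [F, coeff_monomial, hbb]
  have hF0 : ((F.eval 0 : ℤ_[p]) : ℚ_[p]) = h.eval t / y := by
    rw [hF]; simp
  have hn0 : ‖F.eval 0‖ = ‖h.eval t‖ / ‖y‖ := by
    rw [PadicInt.norm_def, hF0, norm_div]
  have hn1 : ‖F.derivative.eval 0‖ = ‖h.derivative.eval t * s‖ / ‖y‖ := by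
    rw [PadicInt.norm_def, hF', norm_div]
  obtain ⟨z, hz, hz1, -⟩ := hensels_lemma (p := p) (F := F) (a := 0) (by
    simp only [coe_aeval_eq_eval]
    rw [hn0, hn1, div_pow, div_lt_div_iff₀ hyp (by positivity)]
    nlinarith)
  simp only [coe_aeval_eq_eval, sub_zero] at hz hz1
  have hle1 : ‖F.derivative.eval 0‖ ≤ 1 := PadicInt.norm_le_one _
  have hzz : ‖z‖ * ‖F.derivative.eval 0‖ ≤ ‖F.eval 0‖ := by
    obtain ⟨k, hk⟩ := binomExpansion F 0 z
    simp only [zero_add, hz] at hk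
    have h1 : F.eval 0 + F.derivative.eval 0 * z = - (k * z^2) := by linear_combination -hk
    by_cases hz0 : z = 0
    · simp [hz0]
    have hzp : 0 < ‖z‖ := norm_pos_iff.2 hz0
    have hk1 : ‖k‖ ≤ 1 := PadicInt.norm_le_one _
    have h2 : ‖k * z^2‖ < ‖F.derivative.eval 0 * z‖ := by
      rw [norm_mul, norm_mul, norm_pow]
      nlinarith
    by_contra hc
    push Not at hc
    have h3 : F.derivative.eval 0 * z = -(k*z^2) + - F.eval 0 := by linear_combination h1
    have h4 := PadicInt.nonarchimedean (-(k*z^2)) (-F.eval 0)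
    rw [← h3, norm_neg, norm_neg] at h4
    have h5 : ‖F.derivative.eval 0 * z‖ = ‖z‖ * ‖F.derivative.eval 0‖ := by rw [norm_mul, mul_comm]
    rcases le_max_iff.1 h4 with h | h
    · linarith
    · linarith
  refine ⟨t + s * z, ?_, ?_, ?_⟩
  · have := hF z
    rw [hz] at this
    have := this.symm
    simpa [hy0] using this
  · have e : t + s * (z:ℚ_[p]) - t = s * z := by ring
    rw [e, norm_mul]
    rw [hn0, hn1, norm_mul, ← PadicInt.norm_def] at *
    rw [← mul_div_assoc, div_le_div_iff_of_pos_right hyp] at hzz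
    rw [PadicInt.norm_def] at hzz ⊢
    linarith
  · have e : t + s * (z:ℚ_[p]) - t = s * z := by ring
    have hs : 0 < ‖s‖ := norm_pos_iff.2 (by rintro rfl; simp at hd)
    rw [e, norm_mul]
    rw [PadicInt.norm_def] at hz1
    nlinarith
end padic
end PM

namespace PM
open Polynomial
section padic
variable {p : ℕ} [hp : Fact p.Prime]

theorem norm_nat_ge {j : ℕ} (hj : 1 ≤ j) : 1 ≤ ‖(j : ℚ_[p])‖ * p^j := by
  by_contra hc
  push Not at hc
  have h1 : ‖((j:ℤ) : ℚ_[p])‖ ≤ (p:ℝ)^(-(j:ℤ)) := by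
    rw [zpow_neg, zpow_natCast, ← one_div, le_div_iff₀ (ppow0 j)]
    simpa using hc.le
  rw [Padic.norm_int_le_pow_iff_dvd] at h1
  have h2 : p^j ∣ j := by exact_mod_cast h1
  have h3 := Nat.le_of_dvd (by omega) h2
  have h4 : j < p^j := Nat.lt_pow_self hp.out.one_lt
  omega

def TT' (d : ℕ) : ℕ → ℕ
  | 0 => 0
  | k+1 => 2 * TT' d k + 2 * d

theorem TT'_mono (d : ℕ) : Monotone (TT' d) := by
  apply monotone_nat_of_le_succ
  intro n
  simp [TT']; omega

theorem swarm {f : ℚ_[p][X]} {d : ℕ} {t s : ℚ_[p]} (hd : f.natDegree ≤ d)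
    (hroot : ∀ j x, hasseDeriv j f ≠ 0 → (hasseDeriv j f).eval x = 0 → ‖s‖ ≤ ‖x - t‖) (j : ℕ) :
    ‖bt f t s j‖ ≤ p^(TT' d d) * ‖f.eval t‖ := by
  obtain ⟨j0, hj0, hmax'⟩ := Finset.exists_max_image (Finset.range (d+1)) (fun i => ‖bt f t s i‖) ⟨0, by simp⟩
  have hmax : ∀ i, ‖bt f t s i‖ ≤ ‖bt f t s j0‖ := by
    intro i
    by_cases hi : i ∈ Finset.range (d+1)
    · exact hmax' i hi
    · simp at hi
      rw [bt_big (by omega)]; simp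
  simp only [Finset.mem_range] at hj0
  set M := ‖bt f t s j0‖ with hM
  by_cases hM0 : M = 0
  · exact (hmax j).trans (by rw [hM0]; positivity)
  have hMp : 0 < M := lt_of_le_of_ne (norm_nonneg _) (Ne.symm hM0)
  have key : ∀ k, k ≤ j0 → M ≤ p^(TT' d k) * ‖bt f t s (j0-k)‖ := by
    intro k
    induction k with
    | zero => intro _; simp [TT', ← hM]
    | succ k ih =>
      intro hk
      have ih := ih (by omega)
      by_contra hc
      push Not at hc
      obtain ⟨i, hi⟩ : ∃ i, j0 - k = i + 1 := ⟨j0 - (k+1), by omega⟩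
      have hi' : j0 - (k+1) = i := by omega
      rw [hi] at ih
      rw [hi'] at hc
      have hbi : bt f t s (i+1) ≠ 0 := by
        intro h0; rw [h0] at ih; simp at ih; linarith
      have hs : s ≠ 0 := by rintro rfl; simp [bt] at hbi
      have hsp : 0 < ‖s‖ := norm_pos_iff.2 hs
      have hder : derivative (hasseDeriv i f) = (i+1) • hasseDeriv (i+1) f := by
        have := hasseDeriv_comp (R := ℚ_[p]) 1 i
        have h2 := congrArg (fun l => (l f)) this
        simp [hasseDeriv_one', add_comm 1 i] at h2
        rw [h2]; simp [add_mul]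
      have hne : hasseDeriv i f ≠ 0 := by
        intro h0
        rw [h0] at hder
        simp at hder
        have : hasseDeriv (i+1) f ≠ 0 := by
          intro h; simp [bt, h] at hbi
        rcases hder with h | h
        · have : ((i+1 : ℕ) : ℚ_[p][X]) = 0 := by push_cast; exact h
          simp only [Nat.cast_eq_zero] at this
          omega
        · exact this h
      have hh : ∀ l, ‖bt (hasseDeriv i f) t s l‖ ≤ M / ‖s‖^i := by
        intro l
        rw [le_div_iff₀ (by positivity)]
        refine le_trans ?_ (hmax (l+i))
        have := hasseDeriv_comp (R := ℚ_[p]) l i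
        have h2 := congrArg (fun l => (l f).eval t) this
        simp at h2
        unfold bt
        rw [h2, norm_mul, norm_mul, norm_mul, norm_pow, norm_pow, pow_add]
        have := norm_nat_le (p := p) ((l+i).choose l)
        calc _ ≤ 1 * ‖eval t (hasseDeriv (l+i) f)‖ * ‖s‖^l * ‖s‖^i := by gcongr
          _ = _ := by ring
      obtain ⟨t', ht', -, ht''⟩ := hensel_t hh (by
        rw [hder]
        have e1 : ‖bt f t s i‖ = ‖eval t (hasseDeriv i f)‖ * ‖s‖^i := by simp [bt]
        have e2 : ‖bt f t s (i+1)‖ = ‖eval t (hasseDeriv (i+1) f)‖ * ‖s‖^i * ‖s‖ := by simp [bt, pow_succ, mul_assoc]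
        have e3 : eval t ((i+1) • hasseDeriv (i+1) f) = ((i+1:ℕ):ℚ_[p]) * eval t (hasseDeriv (i+1) f) := by simp
        rw [e3, norm_mul, norm_mul]
        have hj := norm_nat_ge (p := p) (j := i+1) (by omega)
        have hj2 : 1 ≤ ‖((i+1 : ℕ):ℚ_[p])‖ * p^d := by
          refine hj.trans ?_
          have := pp1 (p := p)
          gcongr
          · exact this.le
          · omega
        set a := ‖((i+1 : ℕ):ℚ_[p])‖
        have hsi : 0 < ‖s‖^i := by positivity
        set x := ‖eval t (hasseDeriv i f)‖ with hx
        set y := ‖eval t (hasseDeriv (i+1) f)‖ with hy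
        set q := ‖s‖^i with hq
        rw [e1] at hc
        rw [e2] at ih
        rw [mul_div_assoc', div_lt_iff₀ hsi]
        -- x * M < (a y s)^2 q
        have h1 : M ≤ (a * p^d) * (p^(TT' d k) * (y * q * ‖s‖)) := by
          refine ih.trans (le_mul_of_one_le_left (by positivity) hj2)
        have h2 : M * M ≤ (p^(TT' d (k+1))) * (a * y * ‖s‖ * q)^2 := by
          calc M * M ≤ ((a * p^d) * (p^(TT' d k) * (y * q * ‖s‖))) * ((a * p^d) * (p^(TT' d k) * (y * q * ‖s‖))) := by gcongr
            _ = _ := by simp only [TT']; rw [pow_add, pow_mul', pow_mul']; ring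
        have h3 : (p^(TT' d (k+1)) * (x * q)) * M < M * M := by gcongr
        have h4 : (p:ℝ)^(TT' d (k+1)) * (x * q * M) < (p^(TT' d (k+1))) * (a * y * ‖s‖ * q)^2 := by
          calc _ = (p^(TT' d (k+1)) * (x * q)) * M := by ring
            _ < _ := lt_of_lt_of_le h3 h2
        have h5 := lt_of_mul_lt_mul_left h4 (ppow0 _).le
        have h6 : q * (x * M) < q * ((a * y * ‖s‖)^2 * q) := by nlinarith
        exact lt_of_mul_lt_mul_left h6 hsi.le)
      have := hroot i t' hne ht'
      linarith
  have h1 := key j0 le_rfl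
  simp [bt] at h1
  refine (hmax j).trans (h1.trans ?_)
  have := pp1 (p := p)
  gcongr
  · exact this.le
  · exact TT'_mono d (by omega)
end padic
end PM

namespace PM
open Polynomial
section padic
variable {p : ℕ} [hp : Fact p.Prime]

theorem norm_ppow (k : ℤ) : ‖(p:ℚ_[p])^k‖ = (p:ℝ)^(-k) := by
  simp [norm_zpow]

theorem pq0 : (p:ℚ_[p]) ≠ 0 := by exact_mod_cast hp.out.ne_zero

theorem zp_inj {a b : ℤ} (h : (p:ℝ)^(-a) = (p:ℝ)^(-b)) : a = b := by
  have := zpow_right_injective₀ (pp0 (p := p)) (pp1 (p := p)).ne' h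
  simpa using this

theorem norm_iff {x : ℚ_[p]} {k : ℤ} : ‖x‖ = (p:ℝ)^(-k) ↔ x ≠ 0 ∧ x.valuation = k := by
  constructor
  · intro h
    have hx : x ≠ 0 := by
      rintro rfl
      simp at h
      exact (zpow_pos pp0 _).ne h
    refine ⟨hx, ?_⟩
    rw [Padic.norm_eq_zpow_neg_valuation hx] at h
    exact zp_inj h
  · rintro ⟨hx, rfl⟩
    exact Padic.norm_eq_zpow_neg_valuation hx

noncomputable def unitPart (x : ℚ_[p]) : ℤ_[p] := ⟨x * p^(-x.valuation), by
  by_cases hx : x = 0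
  · simp [hx]
  · rw [norm_mul, norm_ppow, Padic.norm_eq_zpow_neg_valuation hx, ← zpow_add₀ pp0.ne']; simp⟩

theorem unitPart_coe (x : ℚ_[p]) : (unitPart x : ℚ_[p]) = x * p^(-x.valuation) := rfl

theorem unitPart_spec (x : ℚ_[p]) : x = unitPart x * (p:ℚ_[p])^x.valuation := by
  rw [unitPart_coe, mul_assoc, ← zpow_add₀ pq0]; simp

theorem unitPart_mul (x y : ℚ_[p]) : unitPart (x*y) = unitPart x * unitPart y := by
  apply Subtype.ext
  rw [PadicInt.coe_mul]
  simp only [unitPart_coe]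
  by_cases hx : x = 0
  · simp [hx]
  by_cases hy : y = 0
  · simp [hy]
  rw [Padic.valuation_mul hx hy, neg_add, zpow_add₀ pq0]; ring

theorem unitPart_one : unitPart (1:ℚ_[p]) = 1 := by
  apply Subtype.ext
  show (1:ℚ_[p]) * _ = 1
  simp

theorem unitPart_ppow (k : ℤ) : unitPart ((p:ℚ_[p])^k) = 1 := by
  apply Subtype.ext
  show (p:ℚ_[p])^k * _ = 1
  rw [Padic.valuation_zpow]
  simp only [Padic.valuation_p, mul_one]
  rw [← zpow_add₀ pq0]; simp

noncomputable def ac (N : ℕ) (x : ℚ_[p]) : ZMod (p^N) := PadicInt.toZModPow N (unitPart x)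

theorem ac_mul (N : ℕ) (x y : ℚ_[p]) : ac N (x*y) = ac N x * ac N y := by
  simp [ac, unitPart_mul]

theorem ac_ppow (N : ℕ) (k : ℤ) : ac N ((p:ℚ_[p])^k) = 1 := by simp [ac, unitPart_ppow]

theorem ac_inv (N : ℕ) {x : ℚ_[p]} (hx : x ≠ 0) : ac N x⁻¹ = Ring.inverse (ac N x) := by
  have h : ac N x * ac N x⁻¹ = 1 := by
    rw [← ac_mul, mul_inv_cancel₀ hx]; simp [ac, unitPart_one]
  exact (Ring.inverse_unit (Units.mkOfMulEqOne _ _ h)).symm ▸ rfl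

theorem ac_cast {M N : ℕ} (h : M ≤ N) (x : ℚ_[p]) : ((ac N x).cast : ZMod (p^M)) = ac M x := by
  unfold ac; rw [PadicInt.cast_toZModPow _ _ h]

theorem toZ_iff (N : ℕ) (u w : ℤ_[p]) : PadicInt.toZModPow N u = PadicInt.toZModPow N w ↔
    ‖u - w‖ * p^N ≤ 1 := by
  rw [← sub_eq_zero, ← map_sub, ← RingHom.mem_ker, PadicInt.ker_toZModPow,
    ← PadicInt.norm_le_pow_iff_mem_span_pow, zpow_neg, zpow_natCast, ← one_div, le_div_iff₀ (ppow0 N)]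

theorem ac_iff {N : ℕ} {x y : ℚ_[p]} (h : ‖x‖ = ‖y‖) : ac N x = ac N y ↔ near N x y := by
  by_cases hy : y = 0
  · have : x = 0 := by simpa [hy] using h
    simp [hy, this, near]
  have hx : x ≠ 0 := by rintro rfl; rw [norm_zero] at h; exact hy (norm_eq_zero.1 h.symm)
  have hv : x.valuation = y.valuation := by
    have h1 := Padic.norm_eq_zpow_neg_valuation hx
    have h2 := Padic.norm_eq_zpow_neg_valuation hy
    exact zp_inj (p := p) (by rw [← h1, h, h2])
  unfold ac near
  rw [toZ_iff]
  have e : x - y = ((unitPart x - unitPart y : ℤ_[p]) : ℚ_[p]) * p^y.valuation := by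
    rw [PadicInt.coe_sub, unitPart_coe, unitPart_coe, hv, sub_mul, mul_assoc, mul_assoc,
      ← zpow_add₀ pq0]; simp
  rw [e, norm_mul, norm_ppow, Padic.norm_eq_zpow_neg_valuation hy, ← PadicInt.norm_def]
  have : (0:ℝ) < p^(-y.valuation) := zpow_pos pp0 _
  rw [mul_right_comm]
  constructor
  · intro h; nlinarith
  · intro h
    exact le_of_mul_le_mul_right (by simpa using h) this

theorem ac_zero_iff {N : ℕ} (hN : 1 ≤ N) {x : ℚ_[p]} : ac N x = 0 ↔ x = 0 := by
  constructor
  · intro h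
    by_contra hx
    have h1 : PadicInt.toZModPow N (unitPart x) = PadicInt.toZModPow N 0 := by simpa [ac] using h
    rw [toZ_iff, sub_zero, PadicInt.norm_def, unitPart_coe, norm_mul, norm_ppow,
      Padic.norm_eq_zpow_neg_valuation hx, ← zpow_add₀ pp0.ne'] at h1
    simp at h1
    have : (1:ℝ) < p^N := one_lt_pow₀ pp1 (by omega)
    linarith
  · rintro rfl
    have : unitPart (0:ℚ_[p]) = 0 := by apply Subtype.ext; rw [unitPart_coe]; simp
    simp [ac, this]

theorem near_ac {N : ℕ} (hN : 1 ≤ N) {x y : ℚ_[p]} (h : near N x y) : ac N x = ac N y :=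
  (ac_iff (near_norm hN h)).2 h

theorem appr_int (N : ℕ) (x : ℚ_[p]) (hx : ‖x‖ ≤ 1) : ∃ β : ℕ, β < p^N ∧ ‖x - β‖ * p^N ≤ 1 := by
  obtain ⟨z, hz⟩ : ∃ z : ℤ_[p], (z : ℚ_[p]) = x := ⟨⟨x, hx⟩, rfl⟩
  refine ⟨PadicInt.appr z N, PadicInt.appr_lt _ _, ?_⟩
  have := PadicInt.appr_spec N z
  rw [← PadicInt.norm_le_pow_iff_mem_span_pow, zpow_neg, zpow_natCast, ← one_div, le_div_iff₀ (ppow0 N),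
    PadicInt.norm_def, PadicInt.coe_sub, PadicInt.coe_natCast, hz] at this
  exact this

theorem exists_near (N : ℕ) {x : ℚ_[p]} (hx : x ≠ 0) :
    ∃ β : ℕ, β < p^N ∧ near N ((β:ℚ_[p]) * (p:ℚ_[p])^x.valuation) x := by
  obtain ⟨β, hβ, h⟩ := appr_int N (x * (p:ℚ_[p])^(-x.valuation)) (unitPart x).2
  refine ⟨β, hβ, ?_⟩
  unfold near
  have e : (β:ℚ_[p]) * (p:ℚ_[p])^x.valuation - x = -((x * p^(-x.valuation) - β) * p^x.valuation) := by
    rw [sub_mul, mul_assoc, ← zpow_add₀ pq0]; simp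
  rw [e, norm_neg, norm_mul, norm_ppow, ← Padic.norm_eq_zpow_neg_valuation hx]
  have := norm_nonneg x
  nlinarith

theorem norm_sub_comm_le {x y : ℚ_[p]} {B : ℝ} (hx : ‖x‖ ≤ B) (hy : ‖y‖ ≤ B) : ‖x - y‖ ≤ B := by
  have := Padic.nonarchimedean x (-y)
  rw [← sub_eq_add_neg, norm_neg] at this
  exact this.trans (max_le hx hy)
theorem norm_add_le' {x y : ℚ_[p]} {B : ℝ} (hx : ‖x‖ ≤ B) (hy : ‖y‖ ≤ B) : ‖x + y‖ ≤ B := 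
  (Padic.nonarchimedean x y).trans (max_le hx hy)
theorem near_symm {N : ℕ} (hN : 1 ≤ N) {x y : ℚ_[p]} (h : near N x y) : near N y x := by
  have := near_norm hN h
  unfold near at *
  rw [this, norm_sub_rev]; exact h
end padic
end PM

namespace PM
open Polynomial

theorem SL_ex {E F : Type} [AddCommGroup E] [AddMonoid.FG E] [AddCommGroup F] [AddMonoid.FG F]
    {P : E × F → Prop} (h : SL (E × F) P) : SL E (fun e => ∃ f, P (e, f)) := by
  have := IsSemilinearSet.image h (AddMonoidHom.fst E F)
  unfold SL
  convert! this using 1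
  ext e
  simp

section qd
variable {p : ℕ} [hp : Fact p.Prime]

def QD {Ω E : Type} [AddCommGroup E] [AddMonoid.FG E] (A : Set (Ω → ℚ_[p])) (P : Ω → E → Prop) : Prop :=
  ∃ (ι : Type) (_ : Finite ι) (F : ι → Ω → ℚ_[p]) (N : ℕ)
    (S : (ι → ZMod (p^N)) → ((ι → ℤ) × E) → Prop), (∀ i, F i ∈ A) ∧ (∀ r, SL _ (S r)) ∧
    ∀ ω e, P ω e ↔ S (fun i => ac N (F i ω)) (fun i => (F i ω).valuation, e)

namespace QD
variable {Ω E E' : Type} [AddCommGroup E] [AddMonoid.FG E] [AddCommGroup E'] [AddMonoid.FG E']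
  {A B : Set (Ω → ℚ_[p])} {P Q : Ω → E → Prop}

theorem congr (h : QD A P) (hPQ : ∀ ω e, Q ω e ↔ P ω e) : QD A Q := by
  have : Q = P := by ext ω e; exact hPQ ω e
  rwa [this]

theorem mono (h : QD A P) (hAB : A ⊆ B) : QD B P := by
  obtain ⟨ι, hι, F, N, S, h1, h2, h3⟩ := h
  exact ⟨ι, hι, F, N, S, fun i => hAB (h1 i), h2, h3⟩

theorem fin (h : QD A P) : ∃ C : Set (Ω → ℚ_[p]), C ⊆ A ∧ C.Finite ∧ QD C P := by
  obtain ⟨ι, hι, F, N, S, h1, h2, h3⟩ := h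
  refine ⟨Set.range F, ?_, Set.finite_range F, ι, hι, F, N, S, fun i => ⟨i, rfl⟩, h2, h3⟩
  rintro _ ⟨i, rfl⟩; exact h1 i

theorem not (h : QD A P) : QD A (fun ω e => ¬ P ω e) := by
  obtain ⟨ι, hι, F, N, S, h1, h2, h3⟩ := h
  exact ⟨ι, hι, F, N, fun r x => ¬ S r x, h1, fun r => SL_dc.not (h2 r), fun ω e => not_congr (h3 ω e)⟩

theorem and (h : QD A P) (h' : QD A Q) : QD A (fun ω e => P ω e ∧ Q ω e) := by
  obtain ⟨ι, hι, F, N, S, h1, h2, h3⟩ := h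
  obtain ⟨ι', hι', F', N', S', h1', h2', h3'⟩ := h'
  refine ⟨ι ⊕ ι', inferInstance, Sum.elim F F', max N N',
    fun r x => S (fun i => (r (.inl i)).cast) (fun i => x.1 (.inl i), x.2) ∧
      S' (fun i => (r (.inr i)).cast) (fun i => x.1 (.inr i), x.2), ?_, ?_, ?_⟩
  · rintro (i | i)
    · exact h1 i
    · exact h1' i
  · intro r
    refine SL_dc.and ?_ ?_
    · refine SL_dc.comp (h2 _) (t := fun x : (ι ⊕ ι' → ℤ) × E => (fun i => x.1 (.inl i), x.2)) ?_
      exact Aff.prodMk (Aff.pi fun i => Aff.app (Aff.fst Aff.id') (Sum.inl i)) (by fun_prop)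
    · refine SL_dc.comp (h2' _) (t := fun x : (ι ⊕ ι' → ℤ) × E => (fun i => x.1 (.inr i), x.2)) ?_
      exact Aff.prodMk (Aff.pi fun i => Aff.app (Aff.fst Aff.id') (Sum.inr i)) (by fun_prop)
  · intro ω e
    show (P ω e ∧ Q ω e) ↔ _
    rw [h3, h3']
    simp only [Sum.elim_inl, Sum.elim_inr, ac_cast (le_max_left N N'), ac_cast (le_max_right N N')]

theorem or (h : QD A P) (h' : QD A Q) : QD A (fun ω e => P ω e ∨ Q ω e) :=
  (not (and (not h) (not h'))).congr (by intro _ _; tauto)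

theorem imp (h : QD A P) (h' : QD A Q) : QD A (fun ω e => P ω e → Q ω e) :=
  (or (not h) h').congr (by intro _ _; tauto)

theorem ex {P : Ω → E → E' → Prop} (h : QD A (fun ω (x : E × E') => P ω x.1 x.2)) :
    QD A (fun ω e => ∃ f, P ω e f) := by
  obtain ⟨ι, hι, F, N, S, h1, h2, h3⟩ := h
  refine ⟨ι, hι, F, N, fun r x => ∃ f : E', S r (x.1, (x.2, f)), h1, fun r => ?_, fun ω e => ?_⟩
  · refine SL_ex (P := fun y : ((ι → ℤ) × E) × E' => S r (y.1.1, (y.1.2, y.2))) ?_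
    exact SL_dc.comp (h2 r) (t := fun y : ((ι → ℤ) × E) × E' => (y.1.1, (y.1.2, y.2))) (by fun_prop)
  · exact exists_congr fun f => h3 ω (e, f)

theorem comp (h : QD A P) {t : E' → E} (ht : Aff t) : QD A (fun ω e => P ω (t e)) := by
  obtain ⟨ι, hι, F, N, S, h1, h2, h3⟩ := h
  refine ⟨ι, hι, F, N, fun r x => S r (x.1, t x.2), h1, fun r => ?_, fun ω e => h3 ω (t e)⟩
  exact SL_dc.comp (h2 r) (t := fun x : (ι → ℤ) × E' => (x.1, t x.2)) (by fun_prop)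

theorem ofSL {R : E → Prop} (h : SL E R) : QD A (fun _ e => R e) :=
  ⟨Empty, inferInstance, Empty.elim, 0, fun _ x => R x.2, fun i => i.elim,
    fun _ => SL_dc.comp h (t := fun x : (Empty → ℤ) × E => x.2) (by fun_prop), fun _ _ => Iff.rfl⟩

theorem const (q : Prop) : QD A (fun (_ : Ω) (_ : E) => q) := ofSL (SL_dc.const q)

theorem finex {ι : Type*} {P : ι → Ω → E → Prop} (s : Finset ι) (h : ∀ i ∈ s, QD A (P i)) :
    QD A (fun ω e => ∃ i ∈ s, P i ω e) := by
  classical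
  induction s using Finset.induction_on with
  | empty => exact (const False).congr (by simp)
  | insert a s ha ih =>
    exact ((h a (by simp)).or (ih fun i hi => h i (by simp [hi]))).congr (by simp)

theorem fex {ι : Type*} [Finite ι] {P : ι → Ω → E → Prop} (h : ∀ i, QD A (P i)) :
    QD A (fun ω e => ∃ i, P i ω e) := by
  have := Fintype.ofFinite ι
  exact (finex Finset.univ fun i _ => h i).congr (by simp)

theorem fall {ι : Type*} [Finite ι] {P : ι → Ω → E → Prop} (h : ∀ i, QD A (P i)) :
    QD A (fun ω e => ∀ i, P i ω e) :=
  (not (fex fun i => (h i).not)).congr (by simp)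

theorem near (h : QD A P) : ∃ N : ℕ, ∀ M, N ≤ M → ∀ ω ω', (∀ F ∈ A, near M (F ω) (F ω')) → ∀ e, P ω e ↔ P ω' e := by
  obtain ⟨ι, hι, F, N, S, h1, h2, h3⟩ := h
  refine ⟨max N 1, fun M hM ω ω' hn e => ?_⟩
  rw [h3, h3]
  have hM1 : 1 ≤ M := le_trans (le_max_right _ _) hM
  have hMN : N ≤ M := le_trans (le_max_left _ _) hM
  have e1 : ∀ i, ac N (F i ω) = ac N (F i ω') := fun i => by
    rw [← ac_cast hMN, near_ac hM1 (hn _ (h1 i)), ac_cast hMN]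
  have e2 : ∀ i, (F i ω).valuation = (F i ω').valuation := fun i => by
    have := near_norm hM1 (hn _ (h1 i))
    by_cases h0 : F i ω' = 0
    · rw [h0] at this ⊢
      rw [norm_zero, norm_eq_zero] at this
      rw [this]
    · have h4 := Padic.norm_eq_zpow_neg_valuation h0
      rw [← this, norm_iff] at h4
      exact h4.2
  simp only [e1, e2]
end QD

/-- valuation/angular data of `h` relative to `Q` is definable -/
def QF {Ω E : Type} [AddCommGroup E] [AddMonoid.FG E] (A : Set (Ω → ℚ_[p])) (Q : Ω → E → Prop)
    (h : Ω → E → ℚ_[p]) : Prop :=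
  ∀ N (a : ZMod (p^N)), QD A (fun ω (x : E × ℤ) => Q ω x.1 ∧ ac N (h ω x.1) = a ∧ ‖h ω x.1‖ = (p:ℝ)^(-x.2))

namespace QF
variable {Ω E E' : Type} [AddCommGroup E] [AddMonoid.FG E] [AddCommGroup E'] [AddMonoid.FG E']
  {A B : Set (Ω → ℚ_[p])} {P Q : Ω → E → Prop} {h h' : Ω → E → ℚ_[p]}

instance (N : ℕ) : Finite (ZMod (p^N)) := by
  have : NeZero (p^N) := ⟨(pow_pos hp.out.pos N).ne'⟩
  infer_instance

theorem zpe (x : ℚ_[p]) : x = 0 ↔ ¬ ∃ k : ℤ, ‖x‖ = (p:ℝ)^(-k) := by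
  constructor
  · rintro rfl ⟨k, hk⟩
    rw [norm_iff] at hk; exact hk.1 rfl
  · intro h
    by_contra h0
    exact h ⟨_, Padic.norm_eq_zpow_neg_valuation h0⟩

theorem zero (hQ : QD A Q) (hh : QF A Q h) : QD A (fun ω e => Q ω e ∧ h ω e = 0) := by
  refine (hQ.and (QD.not (QD.ex (P := fun ω e k => Q ω e ∧ ac 0 (h ω e) = 0 ∧ ‖h ω e‖ = (p:ℝ)^(-k)) (hh 0 0)))).congr fun ω e => ?_
  have : ∀ x y : ZMod (p^0), x = y := fun x y => by
    have : Subsingleton (ZMod (p^0)) := by rw [pow_zero]; infer_instance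
    exact Subsingleton.elim x y
  simp only [this _ (0 : ZMod (p^0)), true_and]
  rw [zpe]
  simp
  tauto

theorem acv (hQ : QD A Q) (hh : QF A Q h) (N : ℕ) (a : ZMod (p^N)) :
    QD A (fun ω (x : E × ℤ) => Q ω x.1 ∧ ac N (h ω x.1) = a ∧ (h ω x.1).valuation = x.2) := by
  refine ((hh N a).or (((zero hQ hh).comp (t := fun x : E × ℤ => x.1) (by fun_prop)).and
    (QD.ofSL (SL_dc.and (SL_dc.const (ac N (0:ℚ_[p]) = a)) (SL_dc.eq (s := fun x : E × ℤ => 0) (t := fun x : E × ℤ => x.2) (by fun_prop) (by fun_prop)))))).congr ?_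
  rintro ω ⟨e, k⟩
  simp only [norm_iff]
  by_cases h0 : h ω e = 0
  · simp [h0, eq_comm]
  · simp [h0]

theorem mkS {ι : Type} [Finite ι] {N : ℕ} {S : (ι → ZMod (p^N)) → ((ι → ℤ) × E') → Prop}
    (hS : ∀ r, SL _ (S r)) {h : ι → Ω → E → ℚ_[p]} (hQ : QD A Q) (hh : ∀ i, QF A Q (h i))
    {t : E → E'} (ht : Aff t) :
    QD A (fun ω e => Q ω e ∧ S (fun i => ac N (h i ω e)) (fun i => (h i ω e).valuation, t e)) := by
  have : QD A (fun ω e => Q ω e ∧ ∃ r : ι → ZMod (p^N), ∃ γ : ι → ℤ,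
    (∀ i, Q ω e ∧ ac N (h i ω e) = r i ∧ (h i ω e).valuation = γ i) ∧ S r (γ, t e)) := by
    refine hQ.and (QD.fex fun r => QD.ex (QD.and (QD.fall fun i => ?_) (QD.ofSL ?_)))
    · exact (acv hQ (hh i) N (r i)).comp (t := fun x : E × (ι → ℤ) => (x.1, x.2 i))
        (Aff.prodMk (by fun_prop) (Aff.app (Aff.snd Aff.id') i))
    · exact SL_dc.comp (hS r) (t := fun x : E × (ι → ℤ) => (x.2, t x.1)) (by fun_prop)
  refine this.congr fun ω e => ?_
  constructor
  · rintro ⟨h1, h2⟩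
    exact ⟨h1, _, _, fun i => ⟨h1, rfl, rfl⟩, h2⟩
  · rintro ⟨h1, r, γ, h2, h3⟩
    refine ⟨h1, ?_⟩
    have e1 : r = fun i => ac N (h i ω e) := by ext i; exact (h2 i).2.1.symm
    have e2 : γ = fun i => (h i ω e).valuation := by ext i; exact (h2 i).2.2.symm
    rw [← e1, ← e2]; exact h3

theorem master {Ω' : Type} {A' : Set (Ω' → ℚ_[p])} {P : Ω' → E' → Prop} (hP : QD A' P)
    {τ : Ω → E → Ω'} (hQ : QD A Q) (hh : ∀ F ∈ A', QF A Q (fun ω e => F (τ ω e)))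
    {t : E → E'} (ht : Aff t) : QD A (fun ω e => Q ω e ∧ P (τ ω e) (t e)) := by
  obtain ⟨ι, hι, F, N, S, h1, h2, h3⟩ := hP
  refine (mkS h2 hQ (h := fun i ω e => F i (τ ω e)) (fun i => hh _ (h1 i)) ht).congr fun ω e => ?_
  rw [h3]

theorem mem {F : Ω → ℚ_[p]} (hF : F ∈ A) : QF A (fun _ (_ : E) => True) (fun ω _ => F ω) := by
  intro N a
  refine ⟨Unit, inferInstance, fun _ => F, N+1, fun r x => (r () ≠ 0 ∧ (r ()).cast = a) ∧ x.1 () = x.2.2, fun _ => hF, ?_, ?_⟩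
  · intro r
    exact SL_dc.and (SL_dc.const _) (SL_dc.eq (Aff.app (Aff.fst Aff.id') ()) (by fun_prop))
  · rintro ω ⟨e, k⟩
    simp only [norm_iff, ac_cast (Nat.le_succ N), ne_eq, ac_zero_iff (Nat.le_add_left 1 N)]
    tauto

theorem subst {Ω' : Type} {A' : Set (Ω' → ℚ_[p])} {P : Ω' → E → Prop} (hP : QD A' P)
    {τ : Ω → Ω'} (hh : ∀ F ∈ A', (fun ω => F (τ ω)) ∈ A) : QD A (fun ω e => P (τ ω) e) :=
  (master hP (τ := fun ω _ => τ ω) (QD.const True) (fun F hF => mem (hh F hF)) (t := fun e => e) (by fun_prop)).congr (by simp)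

theorem aconst (c : ℚ_[p]) : QF A (fun _ (_ : E) => True) (fun _ _ => c) := by
  intro N a
  refine QD.ofSL (R := fun x : E × ℤ => True ∧ ac N c = a ∧ ‖c‖ = (p:ℝ)^(-x.2)) ?_
  simp only [norm_iff]
  exact SL_dc.and (SL_dc.const _) (SL_dc.and (SL_dc.const _) (SL_dc.and (SL_dc.const _) (SL_dc.eq (by fun_prop) (by fun_prop))))

theorem ppow {σ : E → ℤ} (hσ : Aff σ) : QF A (fun (_ : Ω) (_ : E) => True) (fun _ e => (p:ℚ_[p])^(σ e)) := by
  intro N a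
  refine QD.ofSL (R := fun x : E × ℤ => True ∧ ac N ((p:ℚ_[p])^(σ x.1)) = a ∧ ‖(p:ℚ_[p])^(σ x.1)‖ = (p:ℝ)^(-x.2)) ?_
  simp only [norm_iff, ac_ppow]
  refine SL_dc.and (SL_dc.const _) (SL_dc.and (SL_dc.const _) ?_)
  exact SL_dc.congr (SL_dc.eq (s := fun x : E × ℤ => σ x.1) (t := fun x : E × ℤ => x.2) (by fun_prop) (by fun_prop)) (fun x => by simp [zpow_ne_zero _ (pq0 (p := p))])

theorem acomp (hh : QF A Q h) {t : E' → E} (ht : Aff t) : QF A (fun ω e => Q ω (t e)) (fun ω e => h ω (t e)) := by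
  intro N a
  exact (hh N a).comp (t := fun x : E' × ℤ => (t x.1, x.2)) (by fun_prop)

theorem mul (hh : QF A Q h) (hh' : QF A Q h') : QF A Q (fun ω e => h ω e * h' ω e) := by
  intro N a
  have : QD A (fun ω (x : E × ℤ) => ∃ r : {r : ZMod (p^N) × ZMod (p^N) // r.1 * r.2 = a}, ∃ k : ℤ,
      (Q ω x.1 ∧ ac N (h ω x.1) = r.1.1 ∧ ‖h ω x.1‖ = (p:ℝ)^(-k)) ∧
      (Q ω x.1 ∧ ac N (h' ω x.1) = r.1.2 ∧ ‖h' ω x.1‖ = (p:ℝ)^(-(x.2-k)))) := by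
    refine QD.fex fun r => QD.ex (QD.and ?_ ?_)
    · exact (hh N r.1.1).comp (t := fun x : (E × ℤ) × ℤ => (x.1.1, x.2)) (by fun_prop)
    · exact (hh' N r.1.2).comp (t := fun x : (E × ℤ) × ℤ => (x.1.1, x.1.2 - x.2)) (by fun_prop)
  refine this.congr ?_
  rintro ω ⟨e, k⟩
  simp only
  constructor
  · rintro ⟨h1, h2, h3⟩
    have h0 := (norm_iff.1 h3).1
    refine ⟨⟨(ac N (h ω e), ac N (h' ω e)), by rw [← h2, ac_mul]⟩, _, ⟨h1, rfl, Padic.norm_eq_zpow_neg_valuation (left_ne_zero_of_mul h0)⟩, h1, rfl, ?_⟩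
    rw [norm_iff] at h3 ⊢
    refine ⟨right_ne_zero_of_mul h0, ?_⟩
    rw [← h3.2, Padic.valuation_mul (left_ne_zero_of_mul h0) (right_ne_zero_of_mul h0)]; simp
  · rintro ⟨⟨r, hr⟩, l, ⟨h1, h2, h3⟩, -, h4, h5⟩
    refine ⟨h1, by rw [ac_mul, h2, h4, hr], ?_⟩
    rw [norm_mul, h3, h5, ← zpow_add₀ pp0.ne']; congr 1; ring

theorem inv (hh : QF A Q h) : QF A Q (fun ω e => (h ω e)⁻¹) := by
  intro N a
  have : QD A (fun ω (x : E × ℤ) => ∃ r : {r : ZMod (p^N) // Ring.inverse r = a}, 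
      (Q ω x.1 ∧ ac N (h ω x.1) = r.1 ∧ ‖h ω x.1‖ = (p:ℝ)^(-(-x.2)))) := by
    refine QD.fex fun r => ?_
    exact (hh N r.1).comp (t := fun x : (E × ℤ) => (x.1, -x.2)) (by fun_prop)
  refine this.congr ?_
  rintro ω ⟨e, k⟩
  simp only
  constructor
  · rintro ⟨h1, h2, h3⟩
    have h0 : h ω e ≠ 0 := by simpa using (norm_iff.1 h3).1
    refine ⟨⟨ac N (h ω e), by rw [← h2, ac_inv N h0]⟩, h1, rfl, ?_⟩
    rw [norm_inv, inv_eq_iff_eq_inv, ← zpow_neg] at h3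
    exact h3
  · rintro ⟨⟨r, hr⟩, h1, h2, h3⟩
    have h0 := (norm_iff.1 h3).1
    refine ⟨h1, by rw [ac_inv N h0, h2, hr], ?_⟩
    rw [norm_inv, h3, ← zpow_neg, neg_neg]

theorem one : QF A (fun (_ : Ω) (_ : E) => True) (fun _ _ => (1:ℚ_[p])) := aconst 1

theorem pow (hh : QF A (fun _ _ => True) h) (n : ℕ) : QF A (fun _ _ => True) (fun ω e => (h ω e)^n) := by
  induction n with
  | zero => simpa using one
  | succ n ih => simp only [pow_succ]; exact ih.mul hh
end QF
end qd
end PM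

namespace PM
open Polynomial
section qd
variable {p : ℕ} [hp : Fact p.Prime]
variable {Ω E E' : Type} [AddCommGroup E] [AddMonoid.FG E] [AddCommGroup E'] [AddMonoid.FG E']
  {A B : Set (Ω → ℚ_[p])} {P Q : Ω → E → Prop} {h h' : Ω → E → ℚ_[p]}

theorem zpow_mul_le {k : ℤ} {N : ℕ} : (p:ℝ)^(-k) * p^N ≤ 1 ↔ (N:ℤ) ≤ k := by
  rw [← zpow_natCast, ← zpow_add₀ pp0.ne', zpow_le_one_iff_right₀ pp1]
  omega

theorem leaf_aux (c : ℕ) (N : ℕ) (y : ℚ_[p]) : ‖y - c‖ * p^N ≤ 1 ↔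
    (‖(c:ℚ_[p])‖ * p^N ≤ 1 ∧ (y = 0 ∨ ∃ k : ℤ, (N:ℤ) ≤ k ∧ ‖y‖ = (p:ℝ)^(-k))) ∨
    ∃ d : Fin N, ∃ a : {a : ZMod (p^(N+1)) // ∃ x : ℚ_[p], ac (N+1) x = a ∧ ‖x‖ = (p:ℝ)^(-(d:ℤ)) ∧ ‖x - c‖ * p^N ≤ 1},
      ac (N+1) y = a.1 ∧ ‖y‖ = (p:ℝ)^(-(d:ℤ)) := by
  have hpN := ppow0 (p := p) N
  have hpN1 := ppow1 (p := p) N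
  have e : ∀ x : ℚ_[p], ‖x‖ * p^N ≤ 1 ↔ ‖x‖ ≤ 1 / p^N := fun x => (le_div_iff₀ hpN).symm
  have small : (y = 0 ∨ ∃ k : ℤ, (N:ℤ) ≤ k ∧ ‖y‖ = (p:ℝ)^(-k)) ↔ ‖y‖ * p^N ≤ 1 := by
    constructor
    · rintro (rfl | ⟨k, hk, h⟩)
      · simp
      · rw [h]; exact zpow_mul_le.2 hk
    · intro h
      by_cases h0 : y = 0
      · exact Or.inl h0
      · rw [Padic.norm_eq_zpow_neg_valuation h0] at h
        exact Or.inr ⟨_, zpow_mul_le.1 h, Padic.norm_eq_zpow_neg_valuation h0⟩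
  rw [small]
  simp only [e]
  constructor
  · intro h
    by_cases hy : ‖y‖ ≤ 1 / p^N
    · left
      refine ⟨?_, hy⟩
      have := norm_sub_comm_le hy h
      simpa using this
    · right
      have h0 : y ≠ 0 := by rintro rfl; simp at hy
      have hy1 : ‖y‖ ≤ 1 := by
        have := norm_add_le' (h.trans (show 1 / (p:ℝ)^N ≤ 1 from div_le_one_of_le₀ hpN1 hpN.le)) (norm_nat_le (p := p) c)
        simpa using this
      have hv := Padic.norm_eq_zpow_neg_valuation h0
      rw [← e, hv, zpow_mul_le] at hy
      rw [hv, show (1:ℝ) = (p:ℝ)^(0:ℤ) by simp, zpow_le_zpow_iff_right₀ pp1] at hy1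
      obtain ⟨d, hd⟩ : ∃ d : ℕ, y.valuation = d := ⟨y.valuation.toNat, by omega⟩
      refine ⟨⟨d, by omega⟩, ⟨_, y, rfl, ?_, (e _).2 h⟩, rfl, ?_⟩ <;> simp only [hv, hd]
  · rintro (⟨h1, h2⟩ | ⟨d, ⟨a, x, hx1, hx2, hx3⟩, h1, h2⟩)
    · exact norm_sub_comm_le h2 h1
    · have hxy : ‖y‖ = ‖x‖ := by rw [h2, hx2]
      have hn : near (N+1) y x := (ac_iff hxy).1 (by rw [h1]; exact hx1.symm)
      have hn := near_mono (Nat.le_succ N) hn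
      have hx1 : ‖x‖ ≤ 1 := by
        rw [hx2, show (1:ℝ) = (p:ℝ)^(0:ℤ) by simp, zpow_le_zpow_iff_right₀ pp1]; omega
      have : ‖y - x‖ ≤ 1 / p^N := (e _).1 (le_trans hn hx1)
      have := norm_add_le' this ((e _).1 hx3)
      simpa using this

theorem leaf (hh : QF A (fun _ _ => True) h) (c N : ℕ) : QD A (fun ω e => ‖h ω e - c‖ * p^N ≤ 1) := by
  simp only [leaf_aux]
  have hz : QD A (fun ω e => h ω e = 0) := (QF.zero (QD.const True) hh).congr (by simp)
  have hn : ∀ M a, QD A (fun ω (x : E × ℤ) => ac M (h ω x.1) = a ∧ ‖h ω x.1‖ = (p:ℝ)^(-x.2)) :=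
    fun M a => (hh M a).congr (by simp)
  refine QD.or (QD.and (QD.const _) (QD.or hz (QD.ex (QD.and (QD.ofSL ?_) ?_)))) (QD.fex fun d => QD.fex fun a => ?_)
  · exact SL_dc.le (by fun_prop) (by fun_prop)
  · refine (QD.fex fun a => hn 0 a).congr ?_
    rintro ω ⟨e, k⟩
    simp
    intros; trivial
  · exact (hn (N+1) a.1).comp (t := fun e => (e, (d:ℤ))) (by fun_prop)

theorem theta {J : Type} [Finite J] {b : J → Ω → E → ℚ_[p]} (hb : ∀ j, QF A (fun _ _ => True) (b j))
    {Θ : (J → ℚ_[p]) → Prop} (hom : ∀ (k : ℤ) b, Θ b → Θ (fun j => b j * (p:ℚ_[p])^k)) (N : ℕ) (hN : 1 ≤ N)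
    (inv : ∀ b b' j0, (∀ j, ‖b' j - b j‖ * p^N ≤ ‖b j0‖) → Θ b → Θ b') :
    QD A (fun ω e => Θ (fun j => b j ω e)) := by
  classical
  have key : ∀ x : J → ℚ_[p], Θ x ↔ ((∀ j, x j = 0) ∧ Θ (fun _ => 0)) ∨
      ∃ j0 : J, ∃ c : {c : J → Fin (p^N) // Θ (fun j => ((c j : ℕ) : ℚ_[p])) ∧ ‖((c j0 : ℕ) : ℚ_[p])‖ = 1}, ∃ μ : ℤ,
        ∀ j, ‖x j * (p:ℚ_[p])^μ - ((c.1 j : ℕ) : ℚ_[p])‖ * p^N ≤ 1 := by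
    intro x
    constructor
    · intro hx
      by_cases h0 : ∀ j, x j = 0
      · left
        refine ⟨h0, ?_⟩
        have : x = fun _ => 0 := funext h0
        rwa [this] at hx
      · right
        push Not at h0
        obtain ⟨j1, hj1⟩ := h0
        have := Fintype.ofFinite J
        obtain ⟨j0, -, hj0⟩ := Finset.exists_max_image Finset.univ (fun j => ‖x j‖) ⟨j1, by simp⟩
        have hx0 : x j0 ≠ 0 := by
          intro h; have := hj0 j1 (by simp); rw [h, norm_zero] at this; exact hj1 (norm_le_zero_iff.1 this)
        have hnn : ∀ j, ‖x j * (p:ℚ_[p])^(-(x j0).valuation)‖ = ‖x j‖ / ‖x j0‖ := fun j => by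
          rw [norm_mul, norm_ppow, Padic.norm_eq_zpow_neg_valuation hx0, div_eq_mul_inv, ← zpow_neg]
        have hxp : 0 < ‖x j0‖ := norm_pos_iff.2 hx0
        have h1 : ∀ j, ‖x j * (p:ℚ_[p])^(-(x j0).valuation)‖ ≤ 1 := fun j => by
          rw [hnn]; exact div_le_one_of_le₀ (hj0 j (by simp)) hxp.le
        choose β hβ hβ' using fun j => appr_int N _ (h1 j)
        have h2 : ‖x j0 * (p:ℚ_[p])^(-(x j0).valuation)‖ = 1 := by rw [hnn, div_self hxp.ne']
        refine ⟨j0, ⟨fun j => ⟨β j, hβ j⟩, ?_, ?_⟩, _, hβ'⟩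
        · refine inv _ _ j0 (fun j => ?_) (hom (-(x j0).valuation) x hx)
          rw [h2, norm_sub_rev]; exact hβ' j
        · have : near N (β j0 : ℚ_[p]) (x j0 * (p:ℚ_[p])^(-(x j0).valuation)) := by
            unfold near; rw [h2, norm_sub_rev]; exact hβ' j0
          rw [← h2]; exact near_norm hN this
    · rintro (⟨h0, h⟩ | ⟨j0, ⟨c, hc, hc1⟩, μ, h⟩)
      · have : x = fun _ => 0 := funext h0
        rwa [this]
      · have h1 : Θ (fun j => x j * (p:ℚ_[p])^μ) := inv _ _ j0 (fun j => by rw [hc1]; exact h j) hc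
        have h2 := hom (-μ) _ h1
        convert h2 using 2 with j
        rw [mul_assoc, ← zpow_add₀ pq0]; simp
  refine QD.congr ?_ (fun ω e => key _)
  refine QD.or (QD.and (QD.fall fun j => ?_) (QD.const _)) (QD.fex fun j0 => QD.fex fun c => QD.ex (QD.fall fun j => ?_))
  · exact (QF.zero (QD.const True) (hb j)).congr (by simp)
  · refine leaf (h := fun ω (x : E × ℤ) => b j ω x.1 * (p:ℚ_[p])^x.2) ?_ _ _
    exact ((hb j).acomp (t := fun x : E × ℤ => x.1) (by fun_prop)).mul (QF.ppow (by fun_prop))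
end qd
end PM

namespace PM
open Polynomial
section qd
variable {p : ℕ} [hp : Fact p.Prime]

theorem theta_aux {J : Type} [Fintype J] (w : J → ℕ) (κ n : ℕ) (hn : 1 ≤ n) {b b' : J → ℚ_[p]} (j0 : J)
    (h : ∀ j, ‖b' j - b j‖ * p^(κ+n) ≤ ‖b j0‖) (hb : ∀ j, ‖b j‖ ≤ p^κ * ‖∑ i, (w i : ℚ_[p]) * b i‖) :
    (∀ u : J → ℕ, ‖(∑ i, (u i : ℚ_[p]) * b' i) - ∑ i, (u i : ℚ_[p]) * b i‖ * p^n ≤ ‖∑ i, (w i : ℚ_[p]) * b i‖) ∧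
    near n (∑ i, (w i : ℚ_[p]) * b' i) (∑ i, (w i : ℚ_[p]) * b i) ∧
    (∀ j, ‖b' j‖ ≤ p^κ * ‖∑ i, (w i : ℚ_[p]) * b' i‖) ∧
    ∀ j, ‖b' j - b j‖ * p^n ≤ ‖∑ i, (w i : ℚ_[p]) * b i‖ := by
  set T := ‖∑ i, (w i : ℚ_[p]) * b i‖ with hT
  have hT0 : 0 ≤ T := norm_nonneg _
  have h4 : ∀ j, ‖b' j - b j‖ * p^n ≤ T := by
    intro j
    have h1 := (h j).trans (hb j0)
    rw [pow_add] at h1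
    have : (p:ℝ)^κ * (‖b' j - b j‖ * p^n) ≤ p^κ * T := by linarith
    exact le_of_mul_le_mul_left this (ppow0 κ)
  have h1 : ∀ u : J → ℕ, ‖(∑ i, (u i : ℚ_[p]) * b' i) - ∑ i, (u i : ℚ_[p]) * b i‖ * p^n ≤ T := by
    intro u
    rw [← Finset.sum_sub_distrib, ← le_div_iff₀ (ppow0 n)]
    refine sum_le _ _ (div_nonneg hT0 (ppow0 n).le) fun i _ => ?_
    rw [← mul_sub, norm_mul]
    have h5 := (le_div_iff₀ (ppow0 n)).2 (h4 i)
    have h6 := norm_nat_le (p := p) (u i)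
    calc _ ≤ 1 * ‖b' i - b i‖ := by gcongr
      _ ≤ _ := by rw [one_mul]; exact h5
  have h2 : near n (∑ i, (w i : ℚ_[p]) * b' i) (∑ i, (w i : ℚ_[p]) * b i) := h1 w
  refine ⟨h1, h2, fun j => ?_, h4⟩
  rw [near_norm hn h2, ← hT]
  have e : b' j = (b' j - b j) + b j := by ring
  rw [e]
  refine norm_add_le' ?_ (hb j)
  have h5 := h4 j
  have h6 := ppow1 (p := p) n
  have h7 := ppow1 (p := p) κ
  have := norm_nonneg (b' j - b j)
  nlinarith

variable {Ω : Type} {A : Subring (Ω → ℚ_[p])} {E : Type} [AddCommGroup E] [AddMonoid.FG E]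

noncomputable def evh (ω : Ω) : A →+* ℚ_[p] := (Pi.evalRingHom (fun _ => ℚ_[p]) ω).comp A.subtype
noncomputable def pv (ω : Ω) (f : A[X]) : ℚ_[p][X] := f.map (evh ω)
noncomputable def evf (f : A[X]) : Ω × ℚ_[p] → ℚ_[p] := fun x => (pv x.1 f).eval x.2
def EV (𝓕 : Set A[X]) : Set (Ω × ℚ_[p] → ℚ_[p]) := evf '' 𝓕

theorem pv_hasse (ω : Ω) (f : A[X]) (j : ℕ) : pv ω (hasseDeriv j f) = hasseDeriv j (pv ω f) := by
  ext n
  simp [pv, hasseDeriv_coeff]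

theorem pv_deriv (ω : Ω) (f : A[X]) : pv ω (derivative f) = derivative (pv ω f) := by
  simp [pv, derivative_map]

theorem pv_deg {ω : Ω} {f : A[X]} {d : ℕ} (h : f.natDegree ≤ d) : (pv ω f).natDegree ≤ d :=
  natDegree_map_le.trans h

theorem QF_bt (f : A[X]) (j : ℕ) (β : ℕ) : QF (EV (A := A) Set.univ) (fun (_ : Ω × ℚ_[p]) (_ : E × ℤ) => True)
    (fun x y => bt (pv x.1 f) x.2 ((β:ℚ_[p]) * (p:ℚ_[p])^y.2) j) := by
  unfold bt
  refine QF.mul ?_ (QF.pow (QF.mul (QF.aconst _) (QF.ppow (by fun_prop))) j)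
  have := QF.mem (A := EV (A := A) Set.univ) (E := E × ℤ) (F := evf (hasseDeriv j f)) ⟨_, trivial, rfl⟩
  simpa only [evf, pv_hasse] using this

def NC (e : ℕ) (f : ℚ_[p][X]) (c s : ℚ_[p]) : Prop := ∀ j, ‖bt f c s j‖ ≤ p^e * ‖f.eval (c+s)‖

def NCg (κ N : ℕ) (g : ℚ_[p][X]) (c s : ℚ_[p]) : Prop :=
  (∀ j, ‖bt g c s j‖ ≤ p^κ * ‖g.derivative.eval (c+s) * s‖) ∧
    ‖g.eval (c+s)‖ * p^N ≤ ‖g.derivative.eval (c+s) * s‖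

theorem bt_sum_fin {f : ℚ_[p][X]} {d : ℕ} (hd : f.natDegree ≤ d) (c s : ℚ_[p]) :
    f.eval (c + s) = ∑ j : Fin (d+1), ((1:ℕ):ℚ_[p]) * bt f c s j := by
  rw [bt_sum hd, Finset.sum_range]; simp

theorem bt_sum_deriv {f : ℚ_[p][X]} {d : ℕ} (hd : f.natDegree ≤ d) (c s : ℚ_[p]) :
    f.derivative.eval (c + s) * s = ∑ j : Fin (d+1), ((j:ℕ):ℚ_[p]) * bt f c s j := by
  rcases Nat.eq_zero_or_pos d with rfl | hd0
  · rw [eq_C_of_natDegree_le_zero hd]; simp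
  rw [bt_sum (d := d) ((natDegree_derivative_le f).trans (by omega)), Finset.sum_range_succ, bt_big, add_zero,
    Fin.sum_univ_succ, Finset.sum_range, Finset.sum_mul]
  · simp
    refine Finset.sum_congr rfl fun j _ => ?_
    have := hasseDeriv_comp (R := ℚ_[p]) j 1
    have h2 := congrArg (fun l => (l f).eval c) this
    simp [hasseDeriv_one'] at h2
    simp [bt]
    rw [h2]; ring
  · have := natDegree_derivative_le f
    omega

theorem bt_all {f : ℚ_[p][X]} {d : ℕ} (hd : f.natDegree ≤ d) {c s : ℚ_[p]} {B : ℝ} (hB : 0 ≤ B) :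
    (∀ j, ‖bt f c s j‖ ≤ B) ↔ ∀ j : Fin (d+1), ‖bt f c s j‖ ≤ B := by
  constructor
  · intro h j; exact h j
  · intro h j
    by_cases hj : j < d + 1
    · exact h ⟨j, hj⟩
    · rw [bt_big (by omega)]; simpa

theorem QD_NC (e : ℕ) (f : A[X]) (β : ℕ) : QD (EV (A := A) Set.univ) (fun x (y : E × ℤ) =>
    NC e (pv x.1 f) x.2 ((β:ℚ_[p]) * (p:ℚ_[p])^y.2)) := by
  have := theta (A := EV (A := A) Set.univ) (E := E × ℤ) (J := Fin (f.natDegree+1))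
    (b := fun j x y => bt (pv x.1 f) x.2 ((β:ℚ_[p]) * (p:ℚ_[p])^y.2) j)
    (fun j => QF_bt f j β) (Θ := fun b => ∀ j, ‖b j‖ ≤ p^e * ‖∑ i, (((fun _ => 1) i : ℕ) : ℚ_[p]) * b i‖)
    ?_ (e+1) (by omega) ?_
  · refine this.congr ?_
    rintro x y
    unfold NC
    rw [bt_all (pv_deg le_rfl) (by positivity), bt_sum_fin (pv_deg le_rfl)]
  · intro k b h j
    simp only [← mul_assoc, ← Finset.sum_mul]
    rw [norm_mul, norm_mul, ← mul_assoc]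
    gcongr; exact h j
  · intro b b' j0 h hb
    exact (theta_aux _ e 1 le_rfl j0 h hb).2.2.1

theorem QD_NCg (κ N : ℕ) (g : A[X]) (β : ℕ) : QD (EV (A := A) Set.univ) (fun x (y : E × ℤ) =>
    NCg κ N (pv x.1 g) x.2 ((β:ℚ_[p]) * (p:ℚ_[p])^y.2)) := by
  have := theta (A := EV (A := A) Set.univ) (E := E × ℤ) (J := Fin (g.natDegree+1))
    (b := fun j x y => bt (pv x.1 g) x.2 ((β:ℚ_[p]) * (p:ℚ_[p])^y.2) j)
    (fun j => QF_bt g j β) (Θ := fun b => (∀ j, ‖b j‖ ≤ p^κ * ‖∑ i, ((((fun i : Fin (g.natDegree+1) => (i:ℕ)) i) : ℕ) : ℚ_[p]) * b i‖) ∧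
      ‖∑ i, (((fun _ => 1) i : ℕ) : ℚ_[p]) * b i‖ * p^N ≤ ‖∑ i, ((((fun i : Fin (g.natDegree+1) => (i:ℕ)) i) : ℕ) : ℚ_[p]) * b i‖)
    ?_ (κ+(N+1)) (by omega) ?_
  · refine this.congr ?_
    rintro x y
    unfold NCg
    rw [bt_all (pv_deg le_rfl) (by positivity), bt_sum_fin (pv_deg le_rfl), bt_sum_deriv (pv_deg le_rfl)]
  · rintro k b ⟨h, h'⟩
    simp only [← mul_assoc, ← Finset.sum_mul]
    constructor
    · intro j
      rw [norm_mul, norm_mul, ← mul_assoc]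
      gcongr; exact h j
    · rw [norm_mul, norm_mul, mul_right_comm]
      gcongr
  · rintro b b' j0 h ⟨hb, hb'⟩
    obtain ⟨h1, h2, h3, h4⟩ := theta_aux _ κ (N+1) (by omega) j0 h hb
    refine ⟨h3, ?_⟩
    rw [near_norm (by omega) h2]
    have h5 := h1 (fun _ => 1)
    rw [← le_div_iff₀ (ppow0 N)] at hb' ⊢
    have h6 : ‖(∑ i, (((fun _ => 1) i : ℕ) : ℚ_[p]) * b' i) - ∑ i, (((fun _ => 1) i : ℕ) : ℚ_[p]) * b i‖ ≤
      ‖∑ i, ((((fun i : Fin (g.natDegree+1) => (i:ℕ)) i) : ℕ) : ℚ_[p]) * b i‖ / p^N := by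
      rw [le_div_iff₀ (ppow0 N)]
      refine le_trans ?_ h5
      rw [pow_succ, ← mul_assoc]
      exact le_mul_of_one_le_right (by positivity) pp1.le
    have := norm_add_le' h6 hb'
    simpa using this

theorem QF_NC (e : ℕ) (f : A[X]) (β : ℕ) : QF (EV (A := A) Set.univ) (fun x (y : E × ℤ) =>
    NC e (pv x.1 f) x.2 ((β:ℚ_[p]) * (p:ℚ_[p])^y.2))
    (fun x y => (pv x.1 f).eval (x.2 + (β:ℚ_[p]) * (p:ℚ_[p])^y.2)) := by
  intro M a
  have := theta (A := EV (A := A) Set.univ) (E := (E × ℤ) × ℤ) (J := Option (Fin (f.natDegree+1)))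
    (b := fun j => j.elim (fun x y => (p:ℚ_[p])^y.2) (fun j x y => bt (pv x.1 f) x.2 ((β:ℚ_[p]) * (p:ℚ_[p])^y.1.2) j))
    ?_ (Θ := fun b => (∀ j, ‖b j‖ ≤ p^e * ‖∑ i, (((fun j => j.elim 0 (fun _ => 1)) i : ℕ) : ℚ_[p]) * b i‖) ∧
      ac M (∑ i, (((fun j => j.elim 0 (fun _ => 1)) i : ℕ) : ℚ_[p]) * b i) = a ∧ 
      ‖∑ i, (((fun j => j.elim 0 (fun _ => 1)) i : ℕ) : ℚ_[p]) * b i‖ = ‖b none‖)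
    ?_ (e+(M+1)) (by omega) ?_
  · refine this.congr ?_
    rintro x y
    unfold NC
    beta_reduce
    rw [bt_all (pv_deg le_rfl) (by positivity)]
    simp only [Fintype.sum_option, Option.elim_none, Option.elim_some, Nat.cast_zero, zero_mul, zero_add,
      ← bt_sum_fin (pv_deg (le_refl f.natDegree)), Option.forall, norm_ppow]
    constructor
    · rintro ⟨h1, h2, h3⟩
      refine ⟨⟨?_, h1⟩, h2, h3⟩
      rw [h3]; exact le_mul_of_one_le_left (zpow_nonneg pp0.le _) (ppow1 e)
    · rintro ⟨⟨h0, h1⟩, h2, h3⟩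
      exact ⟨h1, h2, h3⟩
  · rintro (_ | j)
    · exact QF.ppow (by fun_prop)
    · exact (QF_bt (E := E) f j β).acomp (t := fun y : (E × ℤ) × ℤ => y.1) (by fun_prop)
  · rintro k b ⟨h, h', h''⟩
    simp only [← mul_assoc, ← Finset.sum_mul]
    refine ⟨?_, ?_, ?_⟩
    · intro j
      rw [norm_mul, norm_mul, ← mul_assoc]
      gcongr; exact h j
    · rw [ac_mul, ac_ppow, mul_one]; exact h'
    · rw [norm_mul, norm_mul, h'']
  · rintro b b' j0 h ⟨hb, hb', hb''⟩
    obtain ⟨h1, h2, h3, h4⟩ := theta_aux _ e (M+1) (by omega) j0 h hb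
    refine ⟨h3, ?_, ?_⟩
    · rw [← ac_cast (Nat.le_succ M), near_ac (by omega) h2, ac_cast (Nat.le_succ M), hb']
    · rw [near_norm (by omega) h2, hb'']
      refine (near_norm (N := M+1) (by omega) ?_).symm
      unfold near
      rw [← hb'']; exact h4 none

theorem QF.restrict {Ω : Type} {B : Set (Ω → ℚ_[p])} {Q R : Ω → E → Prop} {h : Ω → E → ℚ_[p]}
    (hh : QF B Q h) (hR : QD B R) (hRQ : ∀ ω e, R ω e → Q ω e) : QF B R h := by
  intro N a
  refine (QD.and (hR.comp (t := fun x : E × ℤ => x.1) (by fun_prop)) (hh N a)).congr ?_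
  rintro ω e
  have := hRQ ω e.1
  tauto

theorem core {𝓕 : Set A[X]} (h𝓕 : 𝓕.Finite) {P : Ω × ℚ_[p] → E → Prop} (hP : QD (EV 𝓕) P) (e β : ℕ) :
    QD (EV (A := A) Set.univ) (fun x (y : E × ℤ) => (∀ f ∈ 𝓕, NC e (pv x.1 f) x.2 ((β:ℚ_[p]) * (p:ℚ_[p])^y.2)) ∧
      P (x.1, x.2 + (β:ℚ_[p]) * (p:ℚ_[p])^y.2) y.1) := by
  have hQ : QD (EV (A := A) Set.univ) (fun x (y : E × ℤ) => (∀ f ∈ 𝓕, NC e (pv x.1 f) x.2 ((β:ℚ_[p]) * (p:ℚ_[p])^y.2))) := by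
    have := h𝓕.to_subtype
    refine (QD.fall (ι := 𝓕) fun f => QD_NC (E := E) e f.1 β).congr (by simp)
  refine QF.master hP (τ := fun x (y : E × ℤ) => (x.1, x.2 + (β:ℚ_[p]) * (p:ℚ_[p])^y.2)) hQ ?_ (t := fun y => y.1) (by fun_prop)
  rintro _ ⟨f, hf, rfl⟩
  exact (QF_NC e f β).restrict hQ (fun x y h => h f hf)
end qd
end PM

namespace PM
open Polynomial
section qd
variable {p : ℕ} [hp : Fact p.Prime]

theorem nc_transfer {f : ℚ_[p][X]} {c s s' : ℚ_[p]} {e N : ℕ} (h : NC e f c s) (hN : 1 ≤ N) (hn : near (N+e) s' s) :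
    NC e f c s' ∧ near N (f.eval (c+s')) (f.eval (c+s)) := by
  have h1 : near N (f.eval (c+s')) (f.eval (c+s)) := by
    have := near_lem h hn
    unfold near
    rw [pow_add] at this
    have h2 : (p:ℝ)^e * (‖f.eval (c+s') - f.eval (c+s)‖ * p^N) ≤ p^e * ‖f.eval (c+s)‖ := by linarith
    exact le_of_mul_le_mul_left h2 (ppow0 e)
  refine ⟨fun j => ?_, h1⟩
  rw [near_norm hN h1]
  have := h j
  unfold bt at this ⊢
  rw [norm_mul, norm_pow, near_norm (by omega) hn, ← norm_pow, ← norm_mul]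
  exact this

theorem bt_succ (g : ℚ_[p][X]) (c s : ℚ_[p]) (j : ℕ) :
    ((j+1 : ℕ):ℚ_[p]) * bt g c s (j+1) = bt g.derivative c s j * s := by
  have := hasseDeriv_comp (R := ℚ_[p]) j 1
  have h2 := congrArg (fun l => (l g).eval c) this
  simp [hasseDeriv_one'] at h2
  simp [bt]
  rw [h2]; ring

theorem ncg_of {g : ℚ_[p][X]} {c s s' : ℚ_[p]} {e d N : ℕ} (hd : g.natDegree ≤ d+1) (hg : g.eval (c+s) = 0)
    (h : NC e g.derivative c s) (hN : 1 ≤ N) (hn : near (N+(d+1+e)) s' s) : NCg (d+1+e) N g c s' := by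
  have hss := near_norm (by omega) hn
  have hT0 : 0 ≤ ‖g.derivative.eval (c+s) * s‖ := norm_nonneg _
  have h1 : ∀ j, ‖bt g c s (j+1)‖ ≤ p^(d+1+e) * ‖g.derivative.eval (c+s) * s‖ := by
    intro j
    by_cases hj : j ≤ d
    · have h2 := congrArg norm (bt_succ g c s j)
      rw [norm_mul, norm_mul] at h2
      have h3 := norm_nat_ge (p := p) (j := j+1) (by omega)
      have h4 := h j
      rw [norm_mul]
      have h5 : (p:ℝ)^(j+1) ≤ p^(d+1) := pow_le_pow_right₀ pp1.le (by omega)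
      have h6 : ‖bt g c s (j+1)‖ ≤ (‖((j+1:ℕ):ℚ_[p])‖ * p^(j+1)) * ‖bt g c s (j+1)‖ :=
        le_mul_of_one_le_left (norm_nonneg _) h3
      have h7 : (‖((j+1:ℕ):ℚ_[p])‖ * p^(j+1)) * ‖bt g c s (j+1)‖ = p^(j+1) * (‖bt g.derivative c s j‖ * ‖s‖) := by
        rw [← h2]; ring
      rw [h7] at h6
      refine h6.trans ?_
      rw [pow_add _ (d+1) e, mul_assoc ((p:ℝ)^(d+1)), ← mul_assoc ((p:ℝ)^e)]
      gcongr
    · rw [bt_big (by omega), norm_zero]; positivity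
  have h2 : ∀ j, ‖bt g c s j‖ ≤ p^(d+1+e) * ‖g.derivative.eval (c+s) * s‖ := by
    rintro (_ | j)
    · have := bt_sum hd c s
      rw [hg, Finset.sum_range_succ'] at this
      have h3 : bt g c s 0 = - ∑ k ∈ Finset.range (d+1), bt g c s (k+1) := by
        rw [eq_neg_iff_add_eq_zero, add_comm]; exact this.symm
      rw [h3, norm_neg]
      exact sum_le _ _ (by positivity) fun j _ => h1 j
    · exact h1 j
  have hn2 : near ((N+(d+1)) + e) s' s := by rwa [add_assoc]
  have hT : ‖g.derivative.eval (c+s') * s'‖ = ‖g.derivative.eval (c+s) * s‖ := by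
    rw [norm_mul, norm_mul, hss, near_norm (by omega) (nc_transfer h (by omega) hn2).2]
  refine ⟨fun j => ?_, ?_⟩
  · rw [hT]
    refine le_trans (le_of_eq ?_) (h2 j)
    unfold bt
    rw [norm_mul, norm_mul, norm_pow, norm_pow, hss]
  · rw [hT]
    have := near_lem h2 hn
    rw [hg, sub_zero, pow_add] at this
    have h3 : (p:ℝ)^(d+1+e) * (‖g.eval (c+s')‖ * p^N) ≤ p^(d+1+e) * ‖g.derivative.eval (c+s) * s‖ := by linarith
    exact le_of_mul_le_mul_left h3 (ppow0 _)

theorem ncg_root {g : ℚ_[p][X]} {c s : ℚ_[p]} {κ N : ℕ} (h : NCg κ N g c s) (hN : κ < N) :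
    ∃ s', near N s' s ∧ g.eval (c+s') = 0 := by
  obtain ⟨h1, h2⟩ := h
  by_cases hT : ‖g.derivative.eval (c+s) * s‖ = 0
  · refine ⟨s, by simp [near], ?_⟩
    rw [hT] at h2
    have := ppow0 (p := p) N
    have h3 : ‖g.eval (c+s)‖ ≤ 0 := by
      by_contra h4
      push Not at h4
      have := mul_pos h4 this
      linarith
    simpa using h3
  · have hT0 : 0 < ‖g.derivative.eval (c+s) * s‖ := lt_of_le_of_ne (norm_nonneg _) (Ne.symm hT)
    obtain ⟨t, ht, h3, h4⟩ := hensel_t (h := g) (t := c+s) (s := s) (M := p^κ * ‖g.derivative.eval (c+s) * s‖)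
      (fun i => bt_shift h1 le_rfl i) (by
        have h5 : (p:ℝ)^κ < p^N := pow_lt_pow_right₀ pp1 hN
        have h6 : ‖g.eval (c+s)‖ * p^κ < ‖g.derivative.eval (c+s) * s‖ := by
          rcases (norm_nonneg (g.eval (c+s))).eq_or_lt with h0 | h0
          · rw [← h0]; simpa using hT0
          · nlinarith
        nlinarith)
    refine ⟨t - c, ?_, by simpa using ht⟩
    unfold near
    have e1 : t - c - s = t - (c+s) := by ring
    rw [e1]
    rw [norm_mul] at h2 hT0
    have h5 : 0 < ‖g.derivative.eval (c+s)‖ := by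
      by_contra h6
      have : ‖g.derivative.eval (c+s)‖ = 0 := le_antisymm (not_lt.1 h6) (norm_nonneg _)
      rw [this] at hT0; simp at hT0
    refine le_of_mul_le_mul_left (a := ‖g.derivative.eval (c+s)‖) ?_ h5
    refine le_trans ?_ h2
    have := ppow0 (p := p) N
    nlinarith

variable {Ω : Type} {A : Subring (Ω → ℚ_[p])} {E : Type} [AddCommGroup E] [AddMonoid.FG E]

def Cen (H : Set A[X]) (ω : Ω) : Set ℚ_[p] := {c | c = 0 ∨ ∃ h ∈ H, pv ω h ≠ 0 ∧ (pv ω h).eval c = 0}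

theorem nearest {H : Set A[X]} (hH : H.Finite) (ω : Ω) (t : ℚ_[p]) :
    ∃ c ∈ Cen H ω, ∀ c' ∈ Cen H ω, ‖t - c‖ ≤ ‖t - c'‖ := by
  have hf : (Cen H ω).Finite := by
    have : Cen H ω ⊆ {0} ∪ ⋃ h ∈ H, {c | c ∈ (pv ω h).roots} := by
      rintro c (rfl | ⟨h, hh, h0, hc⟩)
      · exact Or.inl rfl
      · right
        simp only [Set.mem_iUnion]
        exact ⟨h, hh, by simp [h0, hc]⟩
    refine Set.Finite.subset ((Set.finite_singleton _).union (hH.biUnion fun h _ => ?_)) this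
    exact Multiset.finite_toSet _
  exact Set.exists_min_image _ (fun c => ‖t - c‖) hf ⟨0, Or.inl rfl⟩

def HS (𝓕 : Set A[X]) (D : ℕ) : Set A[X] := Set.image2 (fun f j => hasseDeriv j f) 𝓕 (Set.Iic D)

theorem HS_fin {𝓕 : Set A[X]} (h : 𝓕.Finite) (D : ℕ) : (HS 𝓕 D).Finite := h.image2 _ (Set.finite_Iic D)

theorem nc_near {𝓕 : Set A[X]} {D : ℕ} {f : A[X]} (hf : f ∈ 𝓕) (hd : f.natDegree ≤ D) {ω : Ω} {t c : ℚ_[p]}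
    (hc : ∀ c' ∈ Cen (HS 𝓕 D) ω, ‖t - c‖ ≤ ‖t - c'‖) : NC (TT' D D) (pv ω f) c (t - c) := by
  have h1 := swarm (f := pv ω f) (t := t) (s := t - c) (pv_deg hd) (by
    intro j x h0 hx
    rw [norm_sub_rev x t]
    apply hc
    right
    refine ⟨hasseDeriv j f, ⟨f, hf, j, ?_, rfl⟩, by rwa [pv_hasse], by rwa [pv_hasse]⟩
    by_contra hj
    simp only [Set.mem_Iic, not_le] at hj
    exact h0 (hasseDeriv_eq_zero_of_lt_natDegree _ _ (lt_of_le_of_lt (pv_deg hd) hj)))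
  intro j
  have h2 := bt_shift h1 (u := c - t) (by rw [norm_sub_rev]) j
  rw [show t + (c - t) = c by ring] at h2
  rwa [show c + (t - c) = t by ring]

def RR (A : Subring (Ω → ℚ_[p])) (d : ℕ) : Prop := ∀ (E : Type) [AddCommGroup E] [AddMonoid.FG E] (g : A[X]) (P : Ω × ℚ_[p] → E → Prop),
  g.natDegree ≤ d → QD (EV (A := A) Set.univ) P → QD (A : Set (Ω → ℚ_[p])) (fun ω e => ∃ t, pv ω g ≠ 0 ∧ (pv ω g).eval t = 0 ∧ P (ω, t) e)

theorem Cent {d : ℕ} (hR : RR A d) {H : Set A[X]} (hH : H.Finite) (hHd : ∀ h ∈ H, h.natDegree ≤ d)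
    {P : Ω × ℚ_[p] → E → Prop} (hP : QD (EV (A := A) Set.univ) P) :
    QD (A : Set (Ω → ℚ_[p])) (fun ω e => ∃ c ∈ Cen H ω, P (ω, c) e) := by
  have := hH.to_subtype
  have h1 := QD.fex (ι := H) fun h => hR E h.1 P (hHd _ h.2) hP
  have h2 : QD (A : Set (Ω → ℚ_[p])) (fun ω e => P (ω, 0) e) := by
    refine QF.subst hP ?_
    rintro _ ⟨f, -, rfl⟩
    have : (fun ω => evf f (ω, 0)) = ((f.coeff 0 : A) : Ω → ℚ_[p]) := by
      ext ω
      simp [evf, pv, ← coeff_zero_eq_eval_zero, evh]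
    rw [this]; exact (f.coeff 0).2
  refine (h2.or h1).congr fun ω e => ?_
  simp only [Cen, Set.mem_setOf_eq]
  constructor
  · rintro ⟨c, rfl | ⟨h, hh, h0, hc⟩, hP⟩
    · exact Or.inl hP
    · exact Or.inr ⟨⟨h, hh⟩, c, h0, hc, hP⟩
  · rintro (h | ⟨⟨h, hh⟩, c, h0, hc, hP⟩)
    · exact ⟨0, Or.inl rfl, h⟩
    · exact ⟨c, Or.inr ⟨h, hh, h0, hc⟩, hP⟩

theorem EV_fin {𝓖 : Set A[X]} {P : Ω × ℚ_[p] → E → Prop} (hP : QD (EV 𝓖) P) :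
    ∃ 𝓕 ⊆ 𝓖, 𝓕.Finite ∧ QD (EV 𝓕) P := by
  obtain ⟨C, hC, hCf, h⟩ := hP.fin
  have hC' : ∀ F ∈ C, ∃ g, g ∈ 𝓖 ∧ evf g = F := fun F hF => hC hF
  choose! g hg using hC'
  refine ⟨g '' C, ?_, hCf.image g, h.mono ?_⟩
  · rintro _ ⟨F, hF, rfl⟩; exact (hg F hF).1
  · intro F hF; exact ⟨g F, ⟨F, hF, rfl⟩, (hg F hF).2⟩

theorem near_pv {𝓕 : Set A[X]} {P : Ω × ℚ_[p] → E → Prop} (hP : QD (EV 𝓕) P) :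
    ∃ N, 1 ≤ N ∧ ∀ ω e c s s', (∀ f ∈ 𝓕, NC e (pv ω f) c s) → near (N+e) s' s →
      (∀ f ∈ 𝓕, NC e (pv ω f) c s') ∧ ∀ y, P (ω, c+s') y ↔ P (ω, c+s) y := by
  obtain ⟨N, hN⟩ := hP.near
  refine ⟨N+1, by omega, fun ω e c s s' h hn => ?_⟩
  refine ⟨fun f hf => (nc_transfer (h f hf) (by omega) hn).1, fun y => ?_⟩
  refine hN (N+1) (by omega) _ _ ?_ y
  rintro _ ⟨f, hf, rfl⟩
  exact (nc_transfer (h f hf) (by omega) hn).2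

theorem elim (hR : ∀ d, RR A d) {P : Ω × ℚ_[p] → E → Prop} (hP : QD (EV (A := A) Set.univ) P) :
    QD (A : Set (Ω → ℚ_[p])) (fun ω e => ∃ t, P (ω, t) e) := by
  obtain ⟨𝓕, -, h𝓕, hPF⟩ := EV_fin hP
  obtain ⟨D, hD⟩ : ∃ D, ∀ f ∈ 𝓕, f.natDegree ≤ D := by
    obtain ⟨D, hD⟩ := (h𝓕.image natDegree).bddAbove
    exact ⟨D, fun f hf => hD ⟨f, hf, rfl⟩⟩
  obtain ⟨N, hN1, hN⟩ := near_pv hPF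
  have hHf := HS_fin h𝓕 D
  have hHd : ∀ h ∈ HS 𝓕 D, h.natDegree ≤ D := by
    rintro _ ⟨f, hf, j, -, rfl⟩
    exact (natDegree_hasseDeriv_le _ _).trans ((Nat.sub_le _ _).trans (hD f hf))
  have hnc : ∀ ω t c, (∀ c' ∈ Cen (HS 𝓕 D) ω, ‖t - c‖ ≤ ‖t - c'‖) → ∀ f ∈ 𝓕, NC (TT' D D) (pv ω f) c (t - c) :=
    fun ω t c hct f hf => nc_near hf (hD f hf) hct
  generalize TT' D D = e at hnc
  have hA : QD (A : Set (Ω → ℚ_[p])) (fun ω y => ∃ c ∈ Cen (HS 𝓕 D) ω, P (ω, c) y) := Cent (hR D) hHf hHd hP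
  have hB : ∀ β : ℕ, QD (A : Set (Ω → ℚ_[p])) (fun ω y => ∃ c ∈ Cen (HS 𝓕 D) ω, ∃ σ : ℤ, (∀ f ∈ 𝓕, NC e (pv ω f) c ((β:ℚ_[p]) * (p:ℚ_[p])^σ)) ∧ P (ω, c + (β:ℚ_[p]) * (p:ℚ_[p])^σ) y) := by
    intro β
    have h1 := core h𝓕 hPF e β
    have h2 := QD.ex (P := fun (x : Ω × ℚ_[p]) (y : E) (σ : ℤ) => (∀ f ∈ 𝓕, NC e (pv x.1 f) x.2 ((β:ℚ_[p]) * (p:ℚ_[p])^σ)) ∧ P (x.1, x.2 + (β:ℚ_[p]) * (p:ℚ_[p])^σ) y) h1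
    exact Cent (hR D) hHf hHd h2
  refine (hA.or (QD.finex (Finset.range (p^(N+e))) fun β _ => hB β)).congr fun ω y => ?_
  constructor
  · rintro ⟨t, ht⟩
    obtain ⟨c, hc, hct⟩ := nearest hHf ω t
    by_cases hs : t - c = 0
    · left
      refine ⟨c, hc, ?_⟩
      rwa [← sub_eq_zero.1 hs]
    · right
      obtain ⟨β, hβ, hn⟩ := exists_near (N+e) hs
      have h1 : ∀ f ∈ 𝓕, NC (e) (pv ω f) c (t - c) := hnc ω t c hct
      obtain ⟨h2, h3⟩ := hN ω _ c _ _ h1 hn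
      refine ⟨β, by simpa using hβ, c, hc, _, h2, (h3 y).2 ?_⟩
      simpa using ht
  · rintro (⟨c, hc, h⟩ | ⟨β, hβ, c, hc, σ, h1, h2⟩)
    · exact ⟨c, h⟩
    · exact ⟨_, h2⟩
end qd
end PM

namespace PM
open Polynomial

theorem prem {R : Type*} [CommRing R] (g : R[X]) (d : ℕ) (hg : g.natDegree ≤ d+1) : ∀ (n : ℕ) (f : R[X]), f.natDegree ≤ n →
    ∃ (k : ℕ) (q r : R[X]), C (g.coeff (d+1))^k * f = q * g + r ∧ r.natDegree ≤ d := by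
  intro n
  induction n with
  | zero => intro f hf; exact ⟨0, 0, f, by simp, by omega⟩
  | succ n ih =>
    intro f hf
    by_cases hn : n + 1 ≤ d
    · exact ⟨0, 0, f, by simp, by omega⟩
    obtain ⟨m, rfl⟩ : ∃ m, n = d + m := ⟨n - d, by omega⟩
    obtain ⟨k, q, r, h1, h2⟩ := ih (C (g.coeff (d+1)) * f - C (f.coeff (d+m+1)) * X^m * g) (by
      have h3 : (C (g.coeff (d+1)) * f - C (f.coeff (d+m+1)) * X^m * g).natDegree ≤ d+m+1 := by
        refine (natDegree_sub_le _ _).trans (max_le ?_ ?_)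
        · exact (natDegree_C_mul_le _ _).trans hf
        · refine natDegree_mul_le.trans ?_
          have := natDegree_C_mul_X_pow_le (f.coeff (d+m+1)) m
          omega
      refine natDegree_le_pred h3 ?_
      rw [coeff_sub, coeff_C_mul, mul_assoc, coeff_C_mul, show d+m+1 = (d+1)+m by ring, coeff_X_pow_mul]
      ring)
    refine ⟨k+1, q + C (g.coeff (d+1))^k * C (f.coeff (d+m+1)) * X^m, r, ?_, h2⟩
    rw [pow_succ]
    linear_combination h1

section qd
variable {p : ℕ} [hp : Fact p.Prime]
variable {Ω : Type} {A : Subring (Ω → ℚ_[p])} {E : Type} [AddCommGroup E] [AddMonoid.FG E]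

theorem pseudo (g : A[X]) {d : ℕ} (hg : g.natDegree ≤ d+1) {P : Ω × ℚ_[p] → E → Prop} (hP : QD (EV (A := A) Set.univ) P) :
    ∃ P' : Ω × ℚ_[p] → E → Prop, QD (EV {f : A[X] | f.natDegree ≤ d}) P' ∧ ∀ ω t e, evh ω (g.coeff (d+1)) ≠ 0 →
      (pv ω g).eval t = 0 → (P (ω, t) e ↔ P' (ω, t) e) := by
  obtain ⟨ι, hι, F, N, S, h1, h2, h3⟩ := hP
  choose f hf using h1
  have := fun i => prem g d hg _ (f i) le_rfl
  choose k q r h4 h5 using this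
  have h6 := QF.mkS (A := EV {f : A[X] | f.natDegree ≤ d}) (Q := fun _ _ => True) h2
    (h := fun i x e => evf (r i) x * ((evf (C (g.coeff (d+1))) x)⁻¹)^(k i)) (QD.const True) (fun i => ?_)
    (t := fun e => e) (by fun_prop)
  · refine ⟨_, h6, fun ω t e hl ht => ?_⟩
    rw [h3]
    have : ∀ i, evf (r i) (ω, t) * ((evf (C (g.coeff (d+1))) (ω, t))⁻¹)^(k i) = F i (ω, t) := by
      intro i
      have h7 := congrArg (fun f => (pv ω f).eval t) (h4 i)
      simp only [pv, Polynomial.map_mul, Polynomial.map_add, Polynomial.map_pow, map_C, eval_mul, eval_add, eval_pow, eval_C] at h7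
      simp only [pv] at ht
      rw [ht, mul_zero, zero_add] at h7
      rw [← (hf i).2]
      simp only [evf, pv, map_C, eval_C]
      rw [← h7, inv_pow]
      field_simp
    simp only [this, true_and]
  · have m1 : evf (r i) ∈ EV {f : A[X] | f.natDegree ≤ d} := ⟨_, h5 i, rfl⟩
    have m2 : evf (C (g.coeff (d+1))) ∈ EV {f : A[X] | f.natDegree ≤ d} := ⟨_, by simp, rfl⟩
    exact QF.mul (QF.mem m1) (QF.pow (QF.inv (QF.mem m2)) _)

theorem RR_step {d : ℕ} (hR : RR A d) : RR A (d+1) := by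
  intro E _ _ g P hg hP
  have hl : QD (A : Set (Ω → ℚ_[p])) (fun ω (e : E) => evh ω (g.coeff (d+1)) = 0) := by
    have := QF.zero (QD.const True) (QF.mem (E := E) (A := (A : Set (Ω → ℚ_[p]))) (F := (g.coeff (d+1) : A)) (g.coeff (d+1)).2)
    exact this.congr fun ω e => by simp [evh]
  obtain ⟨R, hRQ, hRP⟩ : ∃ R : Ω → E → Prop, QD (A : Set (Ω → ℚ_[p])) R ∧ ∀ ω e, evh ω (g.coeff (d+1)) ≠ 0 →
      ((∃ t, pv ω g ≠ 0 ∧ (pv ω g).eval t = 0 ∧ P (ω, t) e) ↔ R ω e) := by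
    obtain ⟨P', hP', hPP⟩ := pseudo g hg hP
    obtain ⟨𝓕, hFd, h𝓕, hPF⟩ := EV_fin hP'
    obtain ⟨N, hN1, hN⟩ := near_pv hPF
    have hGf : (insert (derivative g) 𝓕).Finite := h𝓕.insert _
    have hGd : ∀ f ∈ insert (derivative g) 𝓕, f.natDegree ≤ d := by
      rintro f (rfl | hf)
      · exact (natDegree_derivative_le _).trans (by omega)
      · exact hFd hf
    set 𝓖 := insert (derivative g) 𝓕 with h𝓖
    have hnc : ∀ ω t c, (∀ c' ∈ Cen (HS 𝓖 d) ω, ‖t - c‖ ≤ ‖t - c'‖) → ∀ f ∈ 𝓖, NC (TT' d d) (pv ω f) c (t - c) :=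
      fun ω t c hct f hf => nc_near hf (hGd f hf) hct
    generalize TT' d d = e at hnc
    have hHf := HS_fin hGf d
    have hHd : ∀ h ∈ HS 𝓖 d, h.natDegree ≤ d := by
      rintro _ ⟨f, hf, j, -, rfl⟩
      exact (natDegree_hasseDeriv_le _ _).trans ((Nat.sub_le _ _).trans (hGd f hf))
    set κ := d+1+e with hκ
    set N2 := N + κ + 1 with hN2
    have hz : QD (EV (A := A) Set.univ) (fun x (y : E) => (pv x.1 g).eval x.2 = 0) :=
      (QF.zero (QD.const True) (QF.mem (E := E) (F := evf g) (A := EV (A := A) Set.univ) ⟨g, trivial, rfl⟩)).congr fun ω e => by simp [evf]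
    have hPu := hPF.mono (B := EV (A := A) Set.univ) (Set.image_mono (Set.subset_univ _))
    have hA : QD (A : Set (Ω → ℚ_[p])) (fun ω y => ∃ c ∈ Cen (HS 𝓖 d) ω, (pv ω g).eval c = 0 ∧ P' (ω, c) y) := Cent hR hHf hHd (hz.and hPu)
    have hB : ∀ β : ℕ, QD (A : Set (Ω → ℚ_[p])) (fun ω y => ∃ c ∈ Cen (HS 𝓖 d) ω, ∃ σ : ℤ, ((∀ f ∈ 𝓕, NC e (pv ω f) c ((β:ℚ_[p]) * (p:ℚ_[p])^σ)) ∧ P' (ω, c + (β:ℚ_[p]) * (p:ℚ_[p])^σ) y) ∧ NCg κ N2 (pv ω g) c ((β:ℚ_[p]) * (p:ℚ_[p])^σ)) := by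
      intro β
      have h1 := (core h𝓕 hPF e β).and (QD_NCg κ N2 g β)
      have h2 := QD.ex (P := fun (x : Ω × ℚ_[p]) (y : E) (σ : ℤ) => ((∀ f ∈ 𝓕, NC e (pv x.1 f) x.2 ((β:ℚ_[p]) * (p:ℚ_[p])^σ)) ∧ P' (x.1, x.2 + (β:ℚ_[p]) * (p:ℚ_[p])^σ) y)
        ∧ NCg κ N2 (pv x.1 g) x.2 ((β:ℚ_[p]) * (p:ℚ_[p])^σ)) h1
      exact Cent hR hHf hHd h2
    refine ⟨_, hA.or (QD.finex (Finset.range (p^(N2+κ))) fun β _ => hB β), fun ω y hlc => ?_⟩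
    constructor
    · rintro ⟨t, -, ht0, ht⟩
      rw [hPP ω t y hlc ht0] at ht
      obtain ⟨c, hc, hct⟩ := nearest hHf ω t
      by_cases hs : t - c = 0
      · left
        refine ⟨c, hc, ?_⟩
        rw [← sub_eq_zero.1 hs]
        exact ⟨ht0, ht⟩
      · right
        obtain ⟨β, hβ, hn⟩ := exists_near (N2+κ) hs
        have h1 : ∀ f ∈ 𝓖, NC e (pv ω f) c (t - c) := hnc ω t c hct
        obtain ⟨h2, h3⟩ := hN ω e c _ _ (fun f hf => h1 f (Or.inr hf)) (near_mono (by omega) hn)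
        refine ⟨β, by simpa using hβ, c, hc, _, ⟨h2, (h3 y).2 (by simpa using ht)⟩, ?_⟩
        have h4 := h1 _ (Or.inl rfl)
        rw [pv_deriv] at h4
        exact ncg_of (pv_deg hg) (by simpa using ht0) h4 (by omega) hn
    · have hg0 : pv ω g ≠ 0 := by
        intro h
        apply hlc
        have := congrArg (fun f => f.coeff (d+1)) h
        simpa [pv] using this
      rintro (⟨c, hc, h, h'⟩ | ⟨β, hβ, c, hc, σ, ⟨h1, h2⟩, h3⟩)
      · exact ⟨c, hg0, h, (hPP ω c y hlc h).2 h'⟩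
      · obtain ⟨s', hs', h0⟩ := ncg_root h3 (by omega)
        refine ⟨c + s', hg0, h0, (hPP ω _ y hlc h0).2 ?_⟩
        exact ((hN ω e c _ _ h1 (near_mono (by omega) hs')).2 y).2 h2
  have hE := hR E (g.erase (d+1)) P (by
    refine natDegree_le_pred (n := d+1) ?_ (by simp)
    refine le_trans ?_ hg
    exact natDegree_le_natDegree (degree_erase_le _ _)) hP
  refine ((hl.and hE).or (hl.not.and hRQ)).congr fun ω e => ?_
  by_cases h0 : evh ω (g.coeff (d+1)) = 0
  · have : pv ω (g.erase (d+1)) = pv ω g := by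
      ext n
      simp only [pv, coeff_map, coeff_erase]
      split_ifs with h
      · rw [h, h0, map_zero]
      · rfl
    simp [h0, this]
  · simp [h0, hRP ω e h0]

theorem RR_all (d : ℕ) : RR A d := by
  induction d with
  | zero =>
    intro E _ _ g P hg hP
    refine (QD.const False).congr fun ω e => ?_
    have h1 := eq_C_of_natDegree_le_zero (pv_deg (ω := ω) hg)
    simp only [iff_false]
    rintro ⟨t, h0, h2, -⟩
    rw [h1, eval_C] at h2
    rw [h1, h2] at h0
    simp at h0
  | succ d ih => exact RR_step ih

theorem elim' {P : Ω × ℚ_[p] → E → Prop} (hP : QD (EV (A := A) Set.univ) P) :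
    QD (A : Set (Ω → ℚ_[p])) (fun ω e => ∃ t, P (ω, t) e) := elim RR_all hP
end qd
end PM

namespace PM

theorem lin_tame {E : Type} [AddCommGroup E] {ι : Type*} [Fintype ι] (v : ι → E × ℤ) (a : E × ℤ)
    (hv : ∀ z : ι → ℤ, ∑ i, z i • v i = 0 → z = 0) :
    ∃ N : ℤ, 0 < N ∧ TameN (fun e n => ∃ c : ι → ℤ, (∀ i, 0 ≤ c i) ∧ (e, n) = a + ∑ i, c i • v i) N := by
  have huniq : ∀ c c' : ι → ℤ, ∑ i, c i • v i = ∑ i, c' i • v i → c = c' := by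
    intro c c' h
    rw [← sub_eq_zero]
    apply hv
    simp [sub_smul, h]
  by_cases hz : ∃ N : ℤ, 0 < N ∧ ∃ z : ι → ℤ, ∑ i, z i • v i = (0, N)
  · obtain ⟨N, hN, z, hz⟩ := hz
    refine ⟨N, hN, ?_⟩
    set L : E → ℤ → Prop := fun e n => ∃ c : ι → ℤ, (∀ i, 0 ≤ c i) ∧ (e, n) = a + ∑ i, c i • v i with hL
    have key : ∀ (ε : ℤ), (ε = 1 ∨ ε = -1) → ∀ e n m, L e n → ¬ L e (n + ε*N) → L e m → ¬ L e (m+ε*N) → N ∣ m - n → m = n := by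
      have h1 : ∀ (ε : ℤ), (ε = 1 ∨ ε = -1) → ∀ e n (k : ℕ), L e n → L e (n + ε * (k+1) * N) → L e (n + ε*N) := by
        rintro ε hε e n k ⟨c, hc, hn⟩ ⟨c', hc', hm⟩
        have h2 : c' = fun i => c i + ε * (k+1) * z i := by
          apply huniq
          have : a + ∑ i, c' i • v i = a + ∑ i, (c i + ε * (k+1) * z i) • v i := by
            rw [← hm]
            simp only [add_smul, mul_smul, Finset.sum_add_distrib, ← Finset.smul_sum]
            simp only [hz, ← add_assoc, ← hn]
            ext
            · simp
            · simp; ring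
          exact add_left_cancel this
        refine ⟨fun i => c i + ε * z i, fun i => ?_, ?_⟩
        · have h3 := hc i
          have h4 := hc' i
          rw [h2] at h4
          by_cases h5 : 0 ≤ ε * z i
          · linarith
          · push Not at h5
            have : (0:ℤ) ≤ k := by positivity
            nlinarith
        · simp only [add_smul, mul_smul, Finset.sum_add_distrib, ← Finset.smul_sum]
          simp only [hz, ← add_assoc, ← hn]
          ext <;> simp
      have h2 : ∀ (ε : ℤ), (ε = 1 ∨ ε = -1) → ∀ e n m, L e n → ¬ L e (n + ε*N) → L e m → N ∣ m - n → ¬ (0 < ε * (m - n)) := by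
        rintro ε hε e n m h1' h2' h3 ⟨q, hq⟩ h5
        have hq' : 0 < ε * q := by
          by_contra h6
          push Not at h6
          rw [hq] at h5
          have : ε * (N * q) = N * (ε * q) := by ring
          nlinarith
        obtain ⟨k, hk⟩ := Int.eq_ofNat_of_zero_le (show 0 ≤ ε * q - 1 by omega)
        apply h2'
        refine h1 ε hε e n k h1' ?_
        have h7 : (k:ℤ) + 1 = ε * q := by omega
        have h8 : n + ε * (k+1) * N = m := by
          have : ε * ε = 1 := by rcases hε with rfl | rfl <;> norm_num
          rw [h7]; linear_combination N * q * this - hq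
        rwa [h8]
      intro ε hε e n m a1 a2 a3 a4 hd
      have b1 := h2 ε hε e n m a1 a2 a3 hd
      have b2 := h2 ε hε e m n a3 a4 a1 (by rw [← Int.dvd_neg]; simpa using hd)
      rcases hε with rfl | rfl <;> omega
    have B1 : Bdd (fun e n => L e n ∧ ¬ L e (n+1*N)) := by
      refine (Bdd.fin (Finset.Ico 0 N)).inj (fun _ n => n % N) ?_ ?_
      · intro e n _; simp [Int.emod_nonneg _ hN.ne', Int.emod_lt_of_pos _ hN]
      · rintro e n m ⟨h1, h2⟩ ⟨h3, h4⟩ h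
        exact key 1 (by simp) e m n h3 h4 h1 h2 (Int.dvd_of_emod_eq_zero (Int.emod_eq_emod_iff_emod_sub_eq_zero.1 h))
    have B2 : Bdd (fun e n => L e n ∧ ¬ L e (n+(-1)*N)) := by
      refine (Bdd.fin (Finset.Ico 0 N)).inj (fun _ n => n % N) ?_ ?_
      · intro e n _; simp [Int.emod_nonneg _ hN.ne', Int.emod_lt_of_pos _ hN]
      · rintro e n m ⟨h1, h2⟩ ⟨h3, h4⟩ h
        exact key (-1) (by simp) e m n h3 h4 h1 h2 (Int.dvd_of_emod_eq_zero (Int.emod_eq_emod_iff_emod_sub_eq_zero.1 h))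
    refine (B1.or (B2.shift N)).mono ?_
    intro e n h
    rw [one_mul, show n + N + (-1)*N = n by ring]
    clear_value L
    tauto
  · refine ⟨1, one_pos, ?_⟩
    have B : Bdd (fun e n => ∃ c : ι → ℤ, (∀ i, 0 ≤ c i) ∧ (e, n) = a + ∑ i, c i • v i) := by
      refine (Bdd.fin {0}).inj (fun _ n => 0) (by simp) ?_
      rintro e n m ⟨c, hc, hn⟩ ⟨c', hc', hm⟩ -
      have h1 : ∀ (n m : ℤ) (c c' : ι → ℤ), (e, n) = a + ∑ i, c i • v i → (e, m) = a + ∑ i, c' i • v i → ¬ (n < m) := by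
        intro n m c c' hn hm hlt
        apply hz
        refine ⟨m - n, by omega, fun i => c' i - c i, ?_⟩
        simp only [sub_smul, Finset.sum_sub_distrib]
        have : ∑ i, c' i • v i - ∑ i, c i • v i = (e, m) - (e, n) := by rw [hn, hm]; abel
        rw [this]; simp
      have := h1 n m c c' hn hm
      have := h1 m n c' c hm hn
      omega
    generalize (fun e n => ∃ c : ι → ℤ, (∀ i, 0 ≤ c i) ∧ (e, n) = a + ∑ i, c i • v i) = L at B
    refine (B.or (B.shift 1)).mono ?_
    intro e n h
    tauto

theorem TameN.finex {E : Type*} {ι : Type*} {P : ι → E → ℤ → Prop} (s : Finset ι)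
    (h : ∀ i ∈ s, ∃ N : ℤ, 0 < N ∧ TameN (P i) N) : ∃ N : ℤ, 0 < N ∧ TameN (fun e n => ∃ i ∈ s, P i e n) N := by
  classical
  induction s using Finset.induction_on with
  | empty => exact ⟨1, one_pos, 0, by simp⟩
  | insert a s ha ih =>
    obtain ⟨N, hN, h1⟩ := h a (by simp)
    obtain ⟨M, hM, h2⟩ := ih fun i hi => h i (by simp [hi])
    refine ⟨N * M, mul_pos hN hM, ?_⟩
    have h3 := h2.mulInt N hN.le
    rw [mul_comm] at h3
    refine (Bdd.or (h1.mulInt M hM.le) h3).mono ?_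
    intro e n h
    simp only [Finset.mem_insert, exists_eq_or_imp] at h
    beta_reduce
    generalize (∃ i ∈ s, P i e n) = u at *
    generalize (∃ i ∈ s, P i e (n + N * M)) = w at *
    tauto

theorem SL_tame {E : Type} [AddCommGroup E] [AddMonoid.FG E] {P : E × ℤ → Prop} (h : SL (E × ℤ) P) :
    ∃ N : ℤ, 0 < N ∧ TameN (fun e n => P (e, n)) N := by
  classical
  obtain ⟨S, hS, hPS⟩ := isProperSemilinearSet_iff.1 (IsSemilinearSet.isProperSemilinearSet h)
  have := TameN.finex (P := fun (s : Set (E × ℤ)) e n => (e, n) ∈ s) S ?_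
  · obtain ⟨N, hN, h⟩ := this
    refine ⟨N, hN, Bdd.mono h ?_⟩
    intro e n
    have : ∀ x, P x ↔ ∃ s ∈ S, x ∈ s := fun x => by
      have := Set.ext_iff.1 hPS x
      simpa using this
    simp only [this]; exact id
  · intro s hs
    obtain ⟨a, t, ht, hs⟩ := isProperLinearSet_iff.1 (hS s hs)
    obtain ⟨N, hN, h⟩ := lin_tame (fun i : t => i.1) a (by
      intro z hz
      have h1 := (linearIndependent_iff_injective_fintypeLinearCombination (R := ℕ) (v := fun i : t => i.1)).1 ht
      have h2 : (fun i => (z i).toNat) = fun i => (-z i).toNat := by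
        apply h1
        simp only [Fintype.linearCombination_apply]
        have h3 : ∀ (n:ℕ) (x : E × ℤ), n • x = (n:ℤ) • x := fun n x => (natCast_zsmul x n).symm
        rw [← sub_eq_zero, ← Finset.sum_sub_distrib, ← hz]
        refine Finset.sum_congr rfl fun i _ => ?_
        simp only [id, h3, ← sub_smul]
        congr 1
        omega
      ext i
      have := congrFun h2 i
      simp at this ⊢
      omega)
    refine ⟨N, hN, Bdd.mono h ?_⟩
    have : ∀ x, x ∈ s ↔ ∃ c : t → ℤ, (∀ i, 0 ≤ c i) ∧ x = a + ∑ i, c i • i.1 := by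
      intro x
      rw [hs]
      simp only [Set.mem_vadd_set, SetLike.mem_coe, AddSubmonoid.mem_closure_finset', vadd_eq_add]
      constructor
      · rintro ⟨y, ⟨c, rfl⟩, rfl⟩
        exact ⟨fun i => c i, fun i => by positivity, by simp⟩
      · rintro ⟨c, hc, rfl⟩
        refine ⟨_, ⟨fun i => (c i).toNat, rfl⟩, ?_⟩
        congr 1
        refine Finset.sum_congr rfl fun i _ => ?_
        rw [← natCast_zsmul, Int.toNat_of_nonneg (hc i)]
    intro e n
    simp only [this]; exact id
end PM

namespace PM
open Polynomial
section qd
variable {p : ℕ} [hp : Fact p.Prime]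
variable {Ω : Type} {A : Subring (Ω → ℚ_[p])} {E : Type} [AddCommGroup E] [AddMonoid.FG E]

theorem QD_tame {B : Set (Ω → ℚ_[p])} {G : Ω → E × ℤ → Prop} (h : QD B G) :
    ∃ N : ℤ, 0 < N ∧ TameN (fun (q : Ω × E) n => G q.1 (q.2, n)) N := by
  classical
  obtain ⟨ι, hι, F, N0, S, h1, h2, h3⟩ := h
  have := Fintype.ofFinite ι
  have : NeZero (p^N0) := ⟨pow_ne_zero _ hp.out.ne_zero⟩
  obtain ⟨N, hN, h⟩ := TameN.finex (E := Ω × E) (P := fun (r : ι → ZMod (p^N0)) q n => (fun i => ac N0 (F i q.1)) = r ∧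
    S r (fun i => (F i q.1).valuation, q.2, n)) Finset.univ (by
      intro r _
      obtain ⟨N, hN, h⟩ := SL_tame (P := fun y : ((ι → ℤ) × E) × ℤ => S r (y.1.1, y.1.2, y.2))
        (SL_dc.comp (h2 r) (t := fun y : ((ι → ℤ) × E) × ℤ => (y.1.1, y.1.2, y.2)) (by fun_prop))
      refine ⟨N, hN, Bdd.mono (h.comp (fun q : Ω × E => (fun i => (F i q.1).valuation, q.2))) ?_⟩
      intro q n h
      beta_reduce at *
      tauto)
  refine ⟨N, hN, Bdd.mono h ?_⟩
  intro q n h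
  simpa [h3] using h

theorem nc_bad {f : ℚ_[p][X]} {D : ℕ} (hD : f.natDegree ≤ D) {c s : ℚ_[p]} (h : ¬ NC 0 f c s) :
    ∃ i ∈ Finset.range (D+1), ∃ j ∈ Finset.range (D+1), i ≠ j ∧ bt f c s i ≠ 0 ∧ ‖bt f c s i‖ = ‖bt f c s j‖ := by
  by_contra hc
  push Not at hc
  apply h
  obtain ⟨j0, hj0, hmax⟩ := Finset.exists_max_image (Finset.range (D+1)) (fun i => ‖bt f c s i‖) ⟨0, by simp⟩
  have hm : ∀ i, ‖bt f c s i‖ ≤ ‖bt f c s j0‖ := by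
    intro i
    by_cases hi : i ∈ Finset.range (D+1)
    · exact hmax i hi
    · rw [bt_big (by simp at hi; omega)]; simp
  intro j
  refine (hm j).trans ?_
  rw [pow_zero, one_mul]
  by_cases h0 : bt f c s j0 = 0
  · rw [h0]; simp
  rw [bt_sum hD, ← Finset.add_sum_erase _ _ hj0]
  have h1 : ‖∑ i ∈ (Finset.range (D+1)).erase j0, bt f c s i‖ < ‖bt f c s j0‖ := by
    refine Finset.sum_induction _ (fun x => ‖x‖ < ‖bt f c s j0‖) ?_ ?_ ?_
    · intro a b ha hb
      exact lt_of_le_of_lt (Padic.nonarchimedean a b) (max_lt ha hb)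
    · simpa using h0
    · intro i hi
      simp only [Finset.mem_erase] at hi
      refine lt_of_le_of_ne (hm i) ?_
      exact (hc j0 hj0 i hi.2 (Ne.symm hi.1) h0).symm
  rw [Padic.add_eq_max_of_ne h1.ne']
  exact le_max_left _ _

theorem nc_bdd (f : A[X]) : Bdd (fun (ω : Ω) (σ : ℤ) => ¬ NC 0 (pv ω f) 0 (((1:ℕ):ℚ_[p]) * (p:ℚ_[p])^σ)) := by
  refine Bdd.mono (Bdd.finex (Finset.range (f.natDegree+1)) fun i => Bdd.finex (Finset.range (f.natDegree+1)) fun j =>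
    Bdd.inj (P := fun (ω : Ω) (σ : ℤ) => i ≠ j ∧ bt (pv ω f) 0 (((1:ℕ):ℚ_[p]) * (p:ℚ_[p])^σ) i ≠ 0 ∧
      ‖bt (pv ω f) 0 (((1:ℕ):ℚ_[p]) * (p:ℚ_[p])^σ) i‖ = ‖bt (pv ω f) 0 (((1:ℕ):ℚ_[p]) * (p:ℚ_[p])^σ) j‖)
      (Bdd.fin {0}) (fun _ _ => 0) (by simp) ?_) (fun ω σ h => nc_bad (pv_deg le_rfl) h)
  have key : ∀ (ω : Ω) (σ : ℤ), bt (pv ω f) 0 (((1:ℕ):ℚ_[p]) * (p:ℚ_[p])^σ) i ≠ 0 ∧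
      ‖bt (pv ω f) 0 (((1:ℕ):ℚ_[p]) * (p:ℚ_[p])^σ) i‖ = ‖bt (pv ω f) 0 (((1:ℕ):ℚ_[p]) * (p:ℚ_[p])^σ) j‖ →
      ((hasseDeriv i (pv ω f)).eval 0).valuation + i * σ = ((hasseDeriv j (pv ω f)).eval 0).valuation + j * σ := by
    rintro ω σ ⟨h0, h⟩
    have h0' : bt (pv ω f) 0 (((1:ℕ):ℚ_[p]) * (p:ℚ_[p])^σ) j ≠ 0 := by
      rw [← norm_ne_zero_iff, ← h, norm_ne_zero_iff]; exact h0
    have hv : ∀ k, bt (pv ω f) 0 (((1:ℕ):ℚ_[p]) * (p:ℚ_[p])^σ) k ≠ 0 → 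
      (bt (pv ω f) 0 (((1:ℕ):ℚ_[p]) * (p:ℚ_[p])^σ) k).valuation = ((hasseDeriv k (pv ω f)).eval 0).valuation + k * σ := by
      intro k hk
      unfold bt at hk ⊢
      obtain ⟨h1, h2⟩ := mul_ne_zero_iff.1 hk
      rw [Padic.valuation_mul h1 h2]
      simp
    rw [← hv i h0, ← hv j h0']
    have := (norm_iff (p := p)).1 (h.trans (Padic.norm_eq_zpow_neg_valuation h0'))
    exact this.2
  rintro ω n m ⟨h1, h2⟩ ⟨-, h3⟩ -
  have e1 := key ω n h2
  have e2 := key ω m h3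
  have e3 : ((i:ℤ) - j) * (n - m) = 0 := by linarith
  rcases mul_eq_zero.1 e3 with h | h
  · exact absurd (by exact_mod_cast sub_eq_zero.1 h) h1
  · omega

theorem UA {P : Ω × ℚ_[p] → E → Prop} (hP : QD (EV (A := A) Set.univ) P) :
    ∃ N : ℤ, 0 < N ∧ TameN (fun (q : Ω × E) n => P (q.1, (p:ℚ_[p])^n) q.2) N := by
  obtain ⟨𝓕, -, h𝓕, hPF⟩ := EV_fin hP
  have h1 := core h𝓕 hPF 0 1
  have h2 : QD (A : Set (Ω → ℚ_[p])) (fun ω (y : E × ℤ) => (∀ f ∈ 𝓕, NC 0 (pv ω f) 0 (((1:ℕ):ℚ_[p]) * (p:ℚ_[p])^y.2)) ∧ P (ω, 0 + ((1:ℕ):ℚ_[p]) * (p:ℚ_[p])^y.2) y.1) := by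
    refine QF.subst h1 (τ := fun ω => (ω, 0)) ?_
    rintro _ ⟨f, -, rfl⟩
    have : (fun ω => evf f (ω, 0)) = ((f.coeff 0 : A) : Ω → ℚ_[p]) := by
      ext ω
      simp [evf, pv, ← coeff_zero_eq_eval_zero, evh]
    rw [this]; exact (f.coeff 0).2
  obtain ⟨N, hN, h3⟩ := QD_tame h2
  have h4 : Bdd (fun (q : Ω × E) (σ : ℤ) => ∃ f ∈ h𝓕.toFinset, ¬ NC 0 (pv q.1 f) 0 (((1:ℕ):ℚ_[p]) * (p:ℚ_[p])^σ)) :=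
    Bdd.finex _ fun f => (nc_bdd f).comp Prod.fst
  refine ⟨N, hN, ((Bdd.or h3 (h4.or (h4.shift N))).mono ?_)⟩
  intro q n h
  by_contra hc
  push Not at hc
  obtain ⟨c1, c2, c3⟩ := hc
  simp only [Set.Finite.mem_toFinset] at c2 c3
  apply h
  have c4 : ∀ f ∈ 𝓕, NC 0 (pv q.1 f) 0 (((1:ℕ):ℚ_[p]) * (p:ℚ_[p])^n) := c2
  have c5 : ∀ f ∈ 𝓕, NC 0 (pv q.1 f) 0 (((1:ℕ):ℚ_[p]) * (p:ℚ_[p])^(n+N)) := c3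
  have c6 : ∀ (a b c d : Prop), a → b → ((a ∧ c) ↔ (b ∧ d)) → (c ↔ d) := by tauto
  have c7 := c6 _ _ _ _ c4 c5 c1
  simpa only [Nat.cast_one, one_mul, zero_add] using c7
end qd

section fo
variable {p : ℕ} [hp : Fact p.Prime] {α : Type}

abbrev OM (p : ℕ) [Fact p.Prime] (α : Type) (n : ℕ) := (α → ℚ_[p]) × (Fin n → ℚ_[p])
noncomputable def AM (p : ℕ) [Fact p.Prime] (α : Type) (n : ℕ) : Subring (OM p α n → ℚ_[p]) :=
  Subring.closure (Set.range (fun (i : α ⊕ Fin n) (ω : OM p α n) => Sum.elim ω.1 ω.2 i))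

theorem AM_term [CompatibleRing ℚ_[p] ] {n : ℕ} (t : Language.ring.Term (α ⊕ Fin n)) :
    (fun ω : OM p α n => t.realize (Sum.elim ω.1 ω.2)) ∈ AM p α n := by
  induction t with
  | var i => exact Subring.subset_closure ⟨i, rfl⟩
  | func f ts ih =>
    simp only [Term.realize_func]
    cases f with
    | add => 
      have := (AM p α n).add_mem (ih 0) (ih 1)
      convert! this using 2 with ω
      exact CompatibleRing.funMap_add _
    | mul => 
      have := (AM p α n).mul_mem (ih 0) (ih 1)
      convert! this using 2 with ω
      exact CompatibleRing.funMap_mul _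
    | neg => 
      have := (AM p α n).neg_mem (ih 0)
      convert! this using 2 with ω
      exact CompatibleRing.funMap_neg _
    | zero => 
      have := (AM p α n).zero_mem
      convert! this using 2 with ω
      exact CompatibleRing.funMap_zero _
    | one => 
      have := (AM p α n).one_mem
      convert! this using 2 with ω
      exact CompatibleRing.funMap_one _

theorem AM_snoc {n : ℕ} {F : OM p α (n+1) → ℚ_[p]} (hF : F ∈ AM p α (n+1)) :
    (fun x : OM p α n × ℚ_[p] => F (x.1.1, Fin.snoc x.1.2 x.2)) ∈ EV (A := AM p α n) Set.univ := by
  induction hF using Subring.closure_induction with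
  | mem F hF =>
    obtain ⟨i, rfl⟩ := hF
    rcases i with i | i
    · refine ⟨C ⟨_, Subring.subset_closure ⟨Sum.inl i, rfl⟩⟩, trivial, ?_⟩
      ext x; simp [evf, pv, evh]
    · refine Fin.lastCases ?_ (fun i => ?_) i
      · refine ⟨X, trivial, ?_⟩
        ext x; simp [evf, pv, evh]
      · refine ⟨C ⟨_, Subring.subset_closure ⟨Sum.inr i, rfl⟩⟩, trivial, ?_⟩
        ext x; simp [evf, pv, evh]
  | zero => exact ⟨0, trivial, by ext x; simp [evf, pv]⟩
  | one => exact ⟨1, trivial, by ext x; simp [evf, pv]⟩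
  | add F G _ _ hF hG =>
    obtain ⟨f, -, hf⟩ := hF
    obtain ⟨g, -, hg⟩ := hG
    refine ⟨f + g, trivial, ?_⟩
    ext x
    have h1 := congrFun hf x
    have h2 := congrFun hg x
    simp only [evf, pv, Polynomial.map_add, eval_add] at h1 h2 ⊢
    rw [h1, h2]; rfl
  | neg F _ hF =>
    obtain ⟨f, -, hf⟩ := hF
    refine ⟨-f, trivial, ?_⟩
    ext x
    have h1 := congrFun hf x
    simp only [evf, pv, Polynomial.map_neg, eval_neg] at h1 ⊢
    rw [h1]; rfl
  | mul F G _ _ hF hG =>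
    obtain ⟨f, -, hf⟩ := hF
    obtain ⟨g, -, hg⟩ := hG
    refine ⟨f * g, trivial, ?_⟩
    ext x
    have h1 := congrFun hf x
    have h2 := congrFun hg x
    simp only [evf, pv, Polynomial.map_mul, eval_mul] at h1 h2 ⊢
    rw [h1, h2]; rfl

theorem fo [CompatibleRing ℚ_[p] ] {E : Type} [AddCommGroup E] [AddMonoid.FG E] {n : ℕ} (φ : Language.ring.BoundedFormula α n) :
    QD (AM p α n : Set (OM p α n → ℚ_[p])) (fun ω (_ : E) => φ.Realize ω.1 ω.2) := by
  induction φ with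
  | falsum => exact QD.const False
  | equal t1 t2 =>
    have := (AM p α _).sub_mem (AM_term t1) (AM_term t2)
    refine (QF.zero (QD.const True) (QF.mem (E := E) this)).congr fun ω e => ?_
    simp [BoundedFormula.Realize, sub_eq_zero]
  | rel R ts => exact isEmptyElim R
  | imp _ _ h1 h2 => exact h1.imp h2
  | all φ ih =>
    have h1 := QF.subst (A := EV (A := AM p α _) Set.univ) ih (τ := fun x : OM p α _ × ℚ_[p] => (x.1.1, Fin.snoc x.1.2 x.2)) (fun F hF => AM_snoc hF)
    have h2 := (elim' h1.not).not
    refine h2.congr fun ω e => ?_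
    simp [BoundedFormula.realize_all]

/-- uniform tameness for ring formulas -/
theorem fo_tame [CompatibleRing ℚ_[p] ] (φ : Language.ring.Formula (α ⊕ Fin 1)) :
    ∃ N : ℤ, 0 < N ∧ TameN (fun (v : α → ℚ_[p]) n => φ.Realize (Sum.elim v (fun _ => (p:ℚ_[p])^n))) N := by
  have h1 := fo (p := p) (E := ℤ) (BoundedFormula.relabel (n := 1) (k := 0) (id : α ⊕ Fin 1 → α ⊕ Fin 1) φ)
  have h2 := QF.subst (A := EV (A := AM p α 0) Set.univ) h1 (τ := fun x : OM p α _ × ℚ_[p] => (x.1.1, Fin.snoc x.1.2 x.2)) (fun F hF => AM_snoc hF)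
  obtain ⟨N, hN, h⟩ := UA h2
  refine ⟨N, hN, Bdd.mono (h.comp (fun v => ((v, Fin.elim0), 0))) ?_⟩
  intro v n
  have : ∀ n : ℤ, (BoundedFormula.relabel (n := 1) (k := 0) (id : α ⊕ Fin 1 → α ⊕ Fin 1) φ).Realize v (Fin.snoc Fin.elim0 ((p:ℚ_[p])^n)) ↔ φ.Realize (Sum.elim v (fun _ => (p:ℚ_[p])^n)) := by
    intro n
    rw [BoundedFormula.realize_relabel]
    unfold Formula.Realize
    convert! Iff.rfl using 2
  simp only [this]; exact id
end fo
end PM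

namespace PM
section pres
variable {β : Type}
abbrev ZF (f : (β → ℤ) → ℤ) : Prop := (Set.univ : Set ℤ).DefinableFun Presburger f

theorem ZF.add {f g : (β → ℤ) → ℤ} (hf : ZF f) (hg : ZF g) : ZF (fun v => f v + g v) := by
  have h := Set.DefinableFun.fun_symbol (M := ℤ) (L := Presburger) PresburgerFunc.add
  have h1 : (Set.univ : Set ℤ).DefinableMap Presburger (fun (v : β → ℤ) => ![f v, g v]) := by
    intro i; fin_cases i
    · exact hf
    · exact hg
  exact Set.DefinableFun.comp h1 h.of_empty

theorem ZF.sub {f g : (β → ℤ) → ℤ} (hf : ZF f) (hg : ZF g) : ZF (fun v => f v - g v) := by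
  have h := Set.DefinableFun.fun_symbol (M := ℤ) (L := Presburger) PresburgerFunc.sub
  have h1 : (Set.univ : Set ℤ).DefinableMap Presburger (fun (v : β → ℤ) => ![f v, g v]) := by
    intro i; fin_cases i
    · exact hf
    · exact hg
  exact Set.DefinableFun.comp h1 h.of_empty

theorem ZF.const (c : ℤ) : ZF (fun _ : β → ℤ => c) := definableFun_const _ _ (Set.mem_univ _)

theorem ZF.mul {f : (β → ℤ) → ℤ} (hf : ZF f) (k : ℤ) : ZF (fun v => k * f v) := by
  induction k using Int.induction_on with
  | zero => simpa using ZF.const 0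
  | succ k ih => simpa [add_mul] using ih.add hf
  | pred k ih => simpa [sub_mul] using ih.sub hf

theorem ZF.sum {κ : Type} {f : κ → (β → ℤ) → ℤ} (s : Finset κ) (hf : ∀ i, ZF (f i)) :
    ZF (fun v => ∑ i ∈ s, f i v) := by
  classical
  induction s using Finset.induction_on with
  | empty => simpa using ZF.const 0
  | insert a s ha ih => simpa [Finset.sum_insert ha] using (hf a).add ih

theorem ZF.nonneg {f : (β → ℤ) → ℤ} (hf : ZF f) :
    (Set.univ : Set ℤ).Definable Presburger {v | 0 ≤ f v} := by
  have h : (Set.univ : Set ℤ).Definable Presburger {w : Fin 2 → ℤ | w 0 < w 1} := by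
    refine Set.Definable.mono (A := ∅) (Set.empty_definable_iff.2 
      ⟨Relations.formula (PresburgerRel.lt : Presburger.Relations 2) ![Term.var 0, Term.var 1], ?_⟩) (Set.empty_subset _)
    ext w
    simp only [Set.mem_ofPred_eq, Formula.realize_rel]
    exact Iff.rfl
  have h1 : (Set.univ : Set ℤ).DefinableMap Presburger (fun (v : β → ℤ) => ![f v, 0]) := by
    intro i; fin_cases i
    · exact hf
    · exact ZF.const 0
  have h2 := (h.preimage_map h1).compl
  convert! h2 using 1
  ext v; simp

theorem lin_def {m : ℕ} {s : Set (Fin m → ℤ)} (h : IsLinearSet s) :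
    (Set.univ : Set ℤ).Definable Presburger s := by
  obtain ⟨a, n, f, rfl⟩ := isLinearSet_iff_exists_fin_addMonoidHom.1 h
  have h1 : ∀ (x : Fin n → ℕ) i, f x i = ∑ j, f (Pi.single j 1) i * (x j : ℤ) := by
    intro x i
    conv_lhs => rw [← Finset.univ_sum_single x, map_sum, Finset.sum_apply]
    refine Finset.sum_congr rfl fun j _ => ?_
    have : (Pi.single j (x j) : Fin n → ℕ) = x j • Pi.single j 1 := by
      ext k; by_cases hk : k = j
      · subst hk; simp
      · simp [hk]
    rw [this, map_nsmul]; simp [mul_comm]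
  have h2 : (Set.univ : Set ℤ).Definable Presburger
    ((⋂ j : Fin n, {w : Fin m ⊕ Fin n → ℤ | 0 ≤ w (Sum.inr j)}) ∩ 
     (⋂ i : Fin m, {w : Fin m ⊕ Fin n → ℤ | w (Sum.inl i) = a i + ∑ j, f (Pi.single j 1) i * w (Sum.inr j)})) := by
    refine (Set.definable_iInter_of_finite fun j => ZF.nonneg (Set.DefinableFun.proj _)).inter
      (Set.definable_iInter_of_finite fun i => Set.DefinableFun.ofPred_eq (Set.DefinableFun.proj _) ?_)
    exact (ZF.const _).add (ZF.sum _ fun j => ZF.mul (Set.DefinableFun.proj _) _)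
  convert! h2.exists_of_finite using 1
  ext v
  simp only [Set.mem_vadd_set, Set.mem_range, Set.mem_ofPred_eq, Set.mem_inter_iff, Set.mem_iInter, Sum.elim_inl, Sum.elim_inr]
  constructor
  · rintro ⟨_, ⟨x, rfl⟩, rfl⟩
    exact ⟨fun j => x j, by simp, fun i => congrArg (a i + ·) (h1 x i)⟩
  · rintro ⟨u, hu, hv⟩
    refine ⟨_, ⟨fun j => (u j).toNat, rfl⟩, ?_⟩
    ext i
    rw [hv]
    refine (congrArg (a i + ·) (h1 _ i)).trans ?_
    simp [hu]

theorem sl_def {m : ℕ} {s : Set (Fin m → ℤ)} (h : IsSemilinearSet s) :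
    (Set.univ : Set ℤ).Definable Presburger s := by
  obtain ⟨S, hS, h1, rfl⟩ := h
  have := hS.to_subtype
  rw [Set.sUnion_eq_iUnion]
  exact Set.definable_iUnion_of_finite fun i => lin_def (h1 _ i.2)
end pres
end PM

namespace PM
section ult
open Filter
variable {p : ℕ} [hp : Fact p.Prime]

theorem mul_count {Q : ℤ → Prop} {N : ℤ} {B : ℕ} (h : {n | ¬ (Q n ↔ Q (n + N))}.encard ≤ B) (c : ℕ) :
    {n | ¬ (Q n ↔ Q (n + N * c))}.encard ≤ (c * B : ℕ) := by
  refine le_trans (Set.encard_le_encard ?_)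
    (Bdd.encard_bind (Finset.range c : Set ℕ) (fun i => {n : ℤ | ¬ (Q (n + N * i) ↔ Q (n + N * i + N))}) c B (by rw [Set.encard_coe_eq_coe_finsetCard, Finset.card_range]) ?_)
  · intro n hn
    by_contra hc
    apply hn
    simp only [Set.mem_iUnion, Set.mem_ofPred_eq, not_exists, not_not, Finset.coe_range, Set.mem_Iio] at hc
    have : ∀ d ≤ c, Q n ↔ Q (n + N * d) := by
      intro d hd
      induction d with
      | zero => simp
      | succ d ih =>
        rw [ih (by omega), hc d (by omega)]
        have : n + N * ((d + 1 : ℕ) : ℤ) = n + N * d + N := by push_cast; ring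
        rw [this]
    exact this c le_rfl
  · intro i
    have : Set.InjOn (fun n : ℤ => n + N * i) {n : ℤ | ¬ (Q (n + N * i) ↔ Q (n + N * i + N))} :=
      fun n hn m hm h => by simpa using h
    rw [← this.encard_image]
    refine (Set.encard_le_encard ?_).trans h
    rintro _ ⟨n, hn, rfl⟩
    exact hn

theorem ev_iff {ι : Type*} {u : Ultrafilter ι} {A B : ι → Prop} (h : (∀ᶠ k in u, A k) ↔ ∀ᶠ k in u, B k) :
    ∀ᶠ k in u, (A k ↔ B k) := by
  by_cases hA : ∀ᶠ k in u, A k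
  · filter_upwards [hA, h.1 hA] with k h1 h2
    tauto
  · have hB : ¬ ∀ᶠ k in u, B k := fun hB => hA (h.2 hB)
    rw [← Ultrafilter.eventually_not] at hA hB
    filter_upwards [hA, hB] with k h1 h2
    tauto

theorem L_tame (L : FirstOrder.Language) [L.Structure ℚ_[p] ] (φ : Language.ring →ᴸ L)
    (hexp : letI : Language.ring.Structure ℚ_[p] := (compatibleRingOfRing ℚ_[p]).toStructure
      φ.IsExpansionOn ℚ_[p])
    (hmin : PMinimal p L φ) {γ : Type} (ψ : L.Formula (γ ⊕ Fin 1)) :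
    ∃ N : ℤ, 0 < N ∧ TameN (fun (v : γ → ℚ_[p]) n => ψ.Realize (Sum.elim v (fun _ => (p:ℚ_[p])^n))) N := by
  letI := compatibleRingOfRing ℚ_[p]
  have hexp' : φ.IsExpansionOn ℚ_[p] := hexp
  by_contra hc
  push Not at hc
  have h1 : ∀ k : ℕ, ∃ b : γ → ℚ_[p], ((k * k.factorial : ℕ) : ℕ∞) <
      {n : ℤ | ¬ (ψ.Realize (Sum.elim b (fun _ => (p:ℚ_[p])^n)) ↔ ψ.Realize (Sum.elim b (fun _ => (p:ℚ_[p])^(n+(k.factorial:ℤ)))))}.encard := by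
    intro k
    by_contra hk
    simp only [not_exists, not_lt] at hk
    exact hc k.factorial (by exact_mod_cast k.factorial_pos) ⟨k * k.factorial, hk⟩
  choose b hb using h1
  let u : Ultrafilter ℕ := hyperfilter ℕ
  let K := (u : Filter ℕ).Product (fun _ : ℕ => ℚ_[p])
  have hK : ℚ_[p] ≅[L] K := by
    rw [elementarilyEquivalent_iff]
    intro σ
    rw [Ultraproduct.sentence_realize]
    simp
  let mk : (ℕ → ℚ_[p]) → K := fun x => (x : (u : Filter ℕ).Product (fun _ : ℕ => ℚ_[p]))
  let bb : γ → K := fun i => mk (fun k => b k i)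
  have h2 := hmin K hK {y : K | ψ.Realize (Sum.elim bb (fun _ => y))} (by
    unfold Set.Definable₁
    rw [Set.definable_iff_exists_formula_sum]
    refine ⟨ψ.relabel (Sum.map (fun i => ⟨bb i, trivial⟩) id), ?_⟩
    ext x
    simp only [Set.mem_ofPred_eq, Formula.realize_relabel]
    refine iff_of_eq (congrArg _ ?_)
    ext i
    rcases i with i | i
    · rfl
    · simp [Subsingleton.elim i 0])
  unfold Set.Definable₁ at h2
  letI ringK : Language.ring.Structure K := φ.reduct K
  obtain ⟨χ, hχ⟩ := (Set.definable_iff_exists_formula_sum).1 h2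
  have hmk : ∀ y : K, ∃ x, mk x = y := Quotient.exists_rep
  choose rep hrep using hmk
  let c : ↥(Set.univ : Set K) → ℕ → ℚ_[p] := fun i => rep i.1
  have h3 : ∀ y : ℕ → ℚ_[p], ∀ᶠ k in (u : Filter ℕ), (ψ.Realize (Sum.elim (b k) (fun _ => y k)) ↔
      χ.Realize (Sum.elim (fun i => c i k) (fun _ => y k))) := by
    intro y
    apply ev_iff
    have e1 : ψ.Realize (Sum.elim bb (fun _ => mk y)) ↔ χ.Realize (Sum.elim (fun i : (Set.univ : Set K) => i.1) (fun _ : Fin 1 => mk y)) := by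
      have := Set.ext_iff.1 hχ (fun _ => mk y)
      simpa only [Set.mem_ofPred_eq] using this
    have e2 := Ultraproduct.realize_formula_cast (M := fun _ : ℕ => ℚ_[p]) (u := u) ψ
      (Sum.elim (fun i k => b k i) (fun _ => y))
    have e3 := Ultraproduct.realize_formula_cast (M := fun _ : ℕ => ℚ_[p]) (u := u) (φ.onFormula χ)
      (Sum.elim c (fun _ => y))
    have e4 : (φ.onFormula χ).Realize (Sum.elim (fun i : (Set.univ : Set K) => i.1) (fun _ : Fin 1 => mk y)) ↔
      χ.Realize (Sum.elim (fun i : (Set.univ : Set K) => i.1) (fun _ : Fin 1 => mk y)) := by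
      have : φ.IsExpansionOn K := LHom.isExpansionOn_reduct φ K
      exact LHom.realize_onFormula φ χ
    have f1 : (fun i => ((Sum.elim (fun i k => b k i) (fun _ => y) : γ ⊕ Fin 1 → ℕ → ℚ_[p]) i : (u : Filter ℕ).Product (fun _ : ℕ => ℚ_[p]))) = Sum.elim bb (fun _ => mk y) := by
      ext i; rcases i with i | i <;> rfl
    have f2 : (fun i => ((Sum.elim c (fun _ => y) : (Set.univ : Set K) ⊕ Fin 1 → ℕ → ℚ_[p]) i : (u : Filter ℕ).Product (fun _ : ℕ => ℚ_[p]))) = Sum.elim (fun i : (Set.univ : Set K) => i.1) (fun _ : Fin 1 => mk y) := by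
      ext i; rcases i with i | i
      · exact hrep _
      · rfl
    rw [f1] at e2
    rw [f2] at e3
    have e5 := (e2.symm.trans e1).trans (e4.symm.trans e3)
    have f3 : ∀ k, (fun i => (Sum.elim (fun i k => b k i) (fun _ => y) : γ ⊕ Fin 1 → ℕ → ℚ_[p]) i k) = Sum.elim (b k) (fun _ => y k) := by
      intro k; ext i; rcases i with i | i <;> rfl
    have f4 : ∀ k, (fun i => (Sum.elim c (fun _ => y) : (Set.univ : Set K) ⊕ Fin 1 → ℕ → ℚ_[p]) i k) = Sum.elim (fun i => c i k) (fun _ => y k) := by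
      intro k; ext i; rcases i with i | i <;> rfl
    simp only [f3, f4, LHom.realize_onFormula] at e5
    exact e5
  have h4 : ∀ᶠ k in (u : Filter ℕ), ∀ n : ℤ, (ψ.Realize (Sum.elim (b k) (fun _ => (p:ℚ_[p])^n)) ↔
      χ.Realize (Sum.elim (fun i => c i k) (fun _ => (p:ℚ_[p])^n))) := by
    have : ∀ k : ℕ, ∃ n : ℤ, (ψ.Realize (Sum.elim (b k) (fun _ => (p:ℚ_[p])^n)) ↔
      χ.Realize (Sum.elim (fun i => c i k) (fun _ => (p:ℚ_[p])^n))) → ∀ n : ℤ, (ψ.Realize (Sum.elim (b k) (fun _ => (p:ℚ_[p])^n)) ↔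
      χ.Realize (Sum.elim (fun i => c i k) (fun _ => (p:ℚ_[p])^n))) := by
      intro k
      by_contra hk
      push Not at hk
      obtain ⟨_, n, hn⟩ := hk 0
      have := (hk n).1
      tauto
    choose n hn using this
    filter_upwards [h3 (fun k => (p:ℚ_[p])^(n k))] with k hk
    exact hn k hk
  obtain ⟨N, hN, B, hB⟩ := fo_tame (p := p) χ
  have h5 : ∀ᶠ k in (u : Filter ℕ), B ≤ k ∧ N.toNat ≤ k := by
    have : (u : Filter ℕ) ≤ atTop := by
      rw [← Nat.cofinite_eq_atTop]; exact hyperfilter_le_cofinite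
    exact this ((eventually_ge_atTop B).and (eventually_ge_atTop _))
  obtain ⟨k, hk, hkB, hkN⟩ := (h4.and h5).exists
  obtain ⟨j, hj⟩ := Nat.dvd_factorial (by omega : 0 < N.toNat) hkN
  have hjN : (k.factorial : ℤ) = N * j := by
    rw [hj]; push_cast; rw [Int.toNat_of_nonneg hN.le]
  have hjk : j ≤ k.factorial := by
    rw [hj]; exact Nat.le_mul_of_pos_left _ (by omega)
  have h6 := mul_count (hB (fun i => c i k)) j
  have h7 := hb k
  simp only [hk] at h7
  rw [hjN] at h7
  have h8 := lt_of_lt_of_le h7 h6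
  have h9 : k * k.factorial < j * B := by exact_mod_cast h8
  have : j * B ≤ k.factorial * k := Nat.mul_le_mul hjk hkB
  rw [mul_comm k.factorial] at this
  omega
end ult
end PM

namespace PM
section zp
variable {p : ℕ} [hp : Fact p.Prime]

theorem zp_def (y : ℚ_[p]) : (∃ z : ℚ_[p], z^(p+1) = 1 + p * y^(p+1)) ↔ ‖y‖ ≤ 1 := by
  have hp1 := hp.out.one_lt
  constructor
  · rintro ⟨z, hz⟩
    by_contra hy
    push Not at hy
    have hy0 : y ≠ 0 := by rintro rfl; simp at hy; linarith
    have hv : y.valuation ≤ -1 := by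
      by_contra hv
      have : ‖y‖ ≤ 1 := Padic.norm_le_one_iff_val_nonneg y |>.2 (by omega)
      linarith
    have hp0 : (p:ℚ_[p]) ≠ 0 := by exact_mod_cast hp.out.ne_zero
    have hw0 : (p:ℚ_[p]) * y^(p+1) ≠ 0 := mul_ne_zero hp0 (pow_ne_zero _ hy0)
    have hw : ((p:ℚ_[p]) * y^(p+1)).valuation = 1 + (p+1) * y.valuation := by
      rw [Padic.valuation_mul hp0 (pow_ne_zero _ hy0)]
      simp
    have hlt : 1 + ((p:ℤ)+1) * y.valuation < 0 := by nlinarith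
    have hn : 1 < ‖(p:ℚ_[p]) * y^(p+1)‖ := by
      by_contra hh
      push Not at hh
      have := (Padic.norm_le_one_iff_val_nonneg _).1 hh
      omega
    have hs : ‖1 + (p:ℚ_[p]) * y^(p+1)‖ = ‖(p:ℚ_[p]) * y^(p+1)‖ := by
      rw [Padic.add_eq_max_of_ne (by rw [norm_one]; exact hn.ne), norm_one, max_eq_right hn.le]
    have hz0 : z ≠ 0 := by
      rintro rfl
      rw [← hz] at hs
      simp at hs
      rcases hs.symm with h | h
      · exact hy0 h
      · exact absurd h hp.out.ne_zero
    have hval : (z^(p+1)).valuation = ((p:ℚ_[p]) * y^(p+1)).valuation := by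
      rw [← hz] at hs
      rw [Padic.norm_eq_zpow_neg_valuation (pow_ne_zero _ hz0), Padic.norm_eq_zpow_neg_valuation hw0] at hs
      have := zpow_right_injective₀ (by exact_mod_cast hp.out.pos : (0:ℝ) < p) (by exact_mod_cast hp1.ne') hs
      simpa using this
    rw [hw] at hval
    simp only [Padic.valuation_pow] at hval
    push_cast at hval
    have h1 : ((p:ℤ)+1) * (z.valuation - y.valuation) = 1 := by linarith
    have := Int.eq_one_or_neg_one_of_mul_eq_one h1
    have hp2 : (1:ℤ) < p := by exact_mod_cast hp1
    omega
  · intro hy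
    let Y : ℤ_[p] := ⟨y, hy⟩
    let F : Polynomial ℤ_[p] := Polynomial.X^(p+1) - Polynomial.C (1 + p * Y^(p+1))
    have h1 : ‖F.aeval (1:ℤ_[p])‖ < ‖F.derivative.aeval (1:ℤ_[p])‖^2 := by
      have e1 : F.aeval (1:ℤ_[p]) = - (p * Y^(p+1)) := by simp [F]
      have e2 : F.derivative.aeval (1:ℤ_[p]) = 1 + p := by
        simp only [F, Polynomial.derivative_sub, Polynomial.derivative_C]
        simp; ring
      have e3 : ‖(1 + p : ℤ_[p])‖ = 1 := by
        have hp' : ‖(p:ℤ_[p])‖ < 1 := by rw [PadicInt.norm_p]; exact inv_lt_one_of_one_lt₀ (by exact_mod_cast hp1)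
        rw [PadicInt.norm_add_eq_max_of_ne (by rw [norm_one]; exact hp'.ne'), norm_one, max_eq_left hp'.le]
      rw [e1, e2, e3, norm_neg, norm_mul, norm_pow]
      have h2 : ‖Y‖^(p+1) ≤ 1 := pow_le_one₀ (norm_nonneg _) (PadicInt.norm_le_one _)
      have hp' : ‖(p:ℤ_[p])‖ < 1 := by rw [PadicInt.norm_p]; exact inv_lt_one_of_one_lt₀ (by exact_mod_cast hp1)
      have := mul_le_mul_of_nonneg_left h2 (norm_nonneg (p:ℤ_[p]))
      nlinarith
    obtain ⟨z, hz, -⟩ := hensels_lemma h1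
    refine ⟨z, ?_⟩
    have : z^(p+1) = 1 + p * Y^(p+1) := by
      simpa [F, sub_eq_zero] using hz
    have := congrArg (fun x : ℤ_[p] => (x : ℚ_[p])) this
    push_cast at this
    exact this
theorem zpow_p_ne (n : ℤ) : (p:ℚ_[p])^n ≠ 0 := zpow_ne_zero _ (by exact_mod_cast hp.out.ne_zero)
end zp

section D
variable {p : ℕ} [hp : Fact p.Prime] (L : FirstOrder.Language) [L.Structure ℚ_[p] ] (φ : Language.ring →ᴸ L)
    (hexp : letI : Language.ring.Structure ℚ_[p] := (compatibleRingOfRing ℚ_[p]).toStructure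
      φ.IsExpansionOn ℚ_[p])
variable {β : Type} [Finite β]
abbrev QFn (f : (β → ℚ_[p]) → ℚ_[p]) : Prop := (Set.univ : Set ℚ_[p]).DefinableFun L f
variable {L φ}
theorem QFn.const (c : ℚ_[p]) : QFn L (fun _ : β → ℚ_[p] => c) := definableFun_const _ _ (Set.mem_univ _)
include hexp
theorem QFn.add {f g : (β → ℚ_[p]) → ℚ_[p]} (hf : QFn L f) (hg : QFn L g) : QFn L (fun v => f v + g v) := by
  letI := compatibleRingOfRing ℚ_[p]
  have hexp' : φ.IsExpansionOn ℚ_[p] := hexp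
  have h := (Set.DefinableFun.fun_symbol (M := ℚ_[p]) (L := Language.ring) ringFunc.add).of_empty (A := Set.univ)
  have h' : QFn L _ := Set.Definable.map_expansion h φ
  have h1 : (Set.univ : Set ℚ_[p]).DefinableMap L (fun (v : β → ℚ_[p]) => ![f v, g v]) := by
    intro i; fin_cases i
    · exact hf
    · exact hg
  exact Set.DefinableFun.comp h1 h'
theorem QFn.mul {f g : (β → ℚ_[p]) → ℚ_[p]} (hf : QFn L f) (hg : QFn L g) : QFn L (fun v => f v * g v) := by
  letI := compatibleRingOfRing ℚ_[p]
  have hexp' : φ.IsExpansionOn ℚ_[p] := hexp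
  have h := (Set.DefinableFun.fun_symbol (M := ℚ_[p]) (L := Language.ring) ringFunc.mul).of_empty (A := Set.univ)
  have h' : QFn L _ := Set.Definable.map_expansion h φ
  have h1 : (Set.univ : Set ℚ_[p]).DefinableMap L (fun (v : β → ℚ_[p]) => ![f v, g v]) := by
    intro i; fin_cases i
    · exact hf
    · exact hg
  exact Set.DefinableFun.comp h1 h'
theorem QFn.pow {f : (β → ℚ_[p]) → ℚ_[p]} (hf : QFn L f) (k : ℕ) : QFn L (fun v => f v ^ k) := by
  induction k with
  | zero => simpa using QFn.const 1
  | succ k ih => simpa [pow_succ] using QFn.mul hexp ih hf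
theorem QFn.inv {f : (β → ℚ_[p]) → ℚ_[p]} (hf : QFn L f) : QFn L (fun v => (f v)⁻¹) := by
  have hf' : QFn L (fun w : Option β → ℚ_[p] => f (fun i => w (some i))) := Set.DefinableFun.comp (g := fun (w : Option β → ℚ_[p]) i => w (some i)) (fun i => Set.DefinableFun.proj _) hf
  have h1 := (Set.DefinableFun.ofPred_eq (QFn.mul hexp hf' (Set.DefinableFun.proj L (i := none))) (QFn.const 1)).union
    ((Set.DefinableFun.ofPred_eq hf' (QFn.const 0)).inter (Set.DefinableFun.ofPred_eq (Set.DefinableFun.proj L (i := none)) (QFn.const 0)))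
  unfold QFn Set.DefinableFun
  convert! h1 using 1
  ext w
  have : ∀ a b : ℚ_[p], a⁻¹ = b ↔ a * b = 1 ∨ a = 0 ∧ b = 0 := by
    intro a b
    by_cases ha : a = 0
    · subst ha; simp [eq_comm]
    · rw [inv_eq_iff_eq_inv, eq_comm (a := a)]
      simp only [ha, false_and, or_false]
      constructor
      · intro h; rw [← h]
        exact inv_mul_cancel₀ (by rintro rfl; simp at h; exact ha h.symm)
      · intro h; exact inv_eq_of_mul_eq_one_left h
  exact this _ _
theorem QFn.zpow {f : (β → ℚ_[p]) → ℚ_[p]} (hf : QFn L f) (k : ℤ) : QFn L (fun v => f v ^ k) := by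
  obtain ⟨k, rfl | rfl⟩ := k.eq_nat_or_neg
  · simpa using QFn.pow hexp hf k
  · simpa using QFn.inv hexp (QFn.pow hexp hf k)
theorem QFn.prod {κ : Type} {f : κ → (β → ℚ_[p]) → ℚ_[p]} (s : Finset κ) (hf : ∀ i, QFn L (f i)) :
    QFn L (fun v => ∏ i ∈ s, f i v) := by
  classical
  induction s using Finset.induction_on with
  | empty => simpa using QFn.const 1
  | insert a s ha ih => simpa [Finset.prod_insert ha] using QFn.mul hexp (hf a) ih
theorem QFn.zp {f : (β → ℚ_[p]) → ℚ_[p]} (hf : QFn L f) :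
    (Set.univ : Set ℚ_[p]).Definable L {v | ‖f v‖ ≤ 1} := by
  have hf' : QFn L (fun w : β ⊕ Fin 1 → ℚ_[p] => f (fun i => w (.inl i))) := Set.DefinableFun.comp (g := fun (w : β ⊕ Fin 1 → ℚ_[p]) i => w (.inl i)) (fun i => Set.DefinableFun.proj _) hf
  have h1 := Set.DefinableFun.ofPred_eq (QFn.pow hexp (Set.DefinableFun.proj L (i := (Sum.inr 0 : β ⊕ Fin 1))) (p+1))
    (QFn.add hexp (QFn.const 1) (QFn.mul hexp (QFn.const p) (QFn.pow hexp hf' (p+1))))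
  convert! h1.exists_of_finite using 1
  ext v
  simp only [Set.mem_ofPred_eq, Sum.elim_inl, Sum.elim_inr]
  rw [← zp_def]
  exact ⟨fun ⟨z, hz⟩ => ⟨fun _ => z, hz⟩, fun ⟨z, hz⟩ => ⟨z 0, hz⟩⟩
end D

section DDs
variable {p : ℕ} [hp : Fact p.Prime] {L : FirstOrder.Language} [L.Structure ℚ_[p] ] {φ : Language.ring →ᴸ L}
    (hexp : letI : Language.ring.Structure ℚ_[p] := (compatibleRingOfRing ℚ_[p]).toStructure
      φ.IsExpansionOn ℚ_[p])

def DD (p : ℕ) [Fact p.Prime] (L : FirstOrder.Language) [L.Structure ℚ_[p] ] (E : Type) [AddCommGroup E] [AddMonoid.FG E] (P : E → Prop) : Prop :=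
  ∀ (m : ℕ) (h : (Fin m → ℤ) →+ E) (c : E), (Set.univ : Set ℚ_[p]).Definable L
    {x : Fin m → ℚ_[p] | (∀ i, x i ≠ 0) ∧ P (h (fun i => (x i).valuation) + c)}

theorem nz_def (m : ℕ) : (Set.univ : Set ℚ_[p]).Definable L {x : Fin m → ℚ_[p] | ∀ i, x i ≠ 0} := by
  rw [Set.ofPred_forall]
  exact Set.definable_iInter_of_finite fun i => (Set.DefinableFun.ofPred_eq (Set.DefinableFun.proj L) (QFn.const 0)).compl

theorem val_prod {ι : Type} (s : Finset ι) (f : ι → ℚ_[p]) (hf : ∀ i, f i ≠ 0) :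
    (∏ i ∈ s, f i).valuation = ∑ i ∈ s, (f i).valuation := by
  classical
  induction s using Finset.induction_on with
  | empty => simp
  | insert a s ha ih =>
    rw [Finset.prod_insert ha, Finset.sum_insert ha, Padic.valuation_mul (hf a) (Finset.prod_ne_zero_iff.2 fun i _ => hf i), ih]

include hexp in
theorem DD_dc : DC (DD p L) where
  and h1 h2 m h c := by
    convert! (h1 m h c).inter (h2 m h c) using 1
    ext x; simp only [Set.mem_ofPred_eq, Set.mem_inter_iff]; tauto
  not h1 m h c := by
    convert! (nz_def m).inter (h1 m h c).compl using 1
    ext x; simp only [Set.mem_ofPred_eq, Set.mem_inter_iff, Set.mem_compl_iff]; tauto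
  comp := by
    rintro E F _ _ _ _ P t hP ⟨f, c', ht⟩ m h c
    convert! hP m (f.comp h) (f c + c') using 1
    ext x; simp [ht, add_assoc]
  ex' := by
    intro E _ _ P hP m h c
    let r : (Fin (m+1) → ℤ) →+ (Fin m → ℤ) := ⟨⟨fun v i => v i.castSucc, rfl⟩, fun _ _ => rfl⟩
    have := (hP (m+1) ((h.comp r).prod (Pi.evalAddMonoidHom (fun _ => ℤ) (Fin.last m))) (c, 0)).image_comp Fin.castSucc
    convert! this using 1
    ext x
    constructor
    · rintro ⟨hx, n, hn⟩
      refine ⟨Fin.snoc x ((p:ℚ_[p])^n), ⟨?_, ?_⟩, ?_⟩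
      · intro i
        refine Fin.lastCases ?_ (fun i => ?_) i
        · simp [zpow_p_ne]
        · simpa using hx i
      · simpa [r] using hn
      · ext i; simp
    · rintro ⟨y, ⟨h1, h2⟩, rfl⟩
      refine ⟨fun i => h1 _, (y (Fin.last m)).valuation, ?_⟩
      simpa [r] using h2
  nonneg := by
    intro m h c
    have h1 : QFn L (fun x : Fin m → ℚ_[p] => (∏ i, x i ^ (h (Pi.single i 1))) * (p:ℚ_[p])^c) :=
      QFn.mul hexp (QFn.prod hexp _ fun i => QFn.zpow hexp (Set.DefinableFun.proj L) _) (QFn.const _)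
    convert! (nz_def m).inter (QFn.zp hexp h1) using 1
    ext x
    simp only [Set.mem_ofPred_eq, Set.mem_inter_iff]
    refine and_congr_right fun hx => ?_
    have hx' : ∀ i, x i ^ (h (Pi.single i 1)) ≠ 0 := fun i => zpow_ne_zero _ (hx i)
    rw [Padic.norm_le_one_iff_val_nonneg, Padic.valuation_mul (Finset.prod_ne_zero_iff.2 fun i _ => hx' i) (zpow_ne_zero _ (by exact_mod_cast hp.out.ne_zero)),
      val_prod _ _ hx']
    have h2 : h (fun i => (x i).valuation) = ∑ i, (x i ^ (h (Pi.single i 1))).valuation := by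
      conv_lhs => rw [← Finset.univ_sum_single (fun i => (x i).valuation), map_sum]
      refine Finset.sum_congr rfl fun j _ => ?_
      have : (Pi.single j (x j).valuation : Fin m → ℤ) = (x j).valuation • Pi.single j 1 := by
        ext k; by_cases hk : k = j
        · subst hk; simp
        · simp [hk]
      rw [this, map_zsmul]; simp [mul_comm]
    rw [h2]; simp

include hexp in
theorem DD_U (hmin : PMinimal p L φ) {E : Type} [AddCommGroup E] [AddMonoid.FG E] {P : E × ℤ → Prop} (hP : DD p L (E × ℤ) P) :
    ∃ N : ℤ, 0 < N ∧ TameN (fun e n => P (e, n)) N := by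
  have : AddGroup.FG E := AddGroup.fg_iff_addMonoid_fg.2 inferInstance
  have : Module.Finite ℤ E := Module.Finite.iff_addGroup_fg.2 inferInstance
  obtain ⟨m, f, hf⟩ := Module.Finite.exists_fin' ℤ E
  choose g hg using hf
  let r : (Fin (m+1) → ℤ) →+ (Fin m → ℤ) := ⟨⟨fun v i => v i.castSucc, rfl⟩, fun _ _ => rfl⟩
  have h1 := hP (m+1) ((f.toAddMonoidHom.comp r).prod (Pi.evalAddMonoidHom (fun _ => ℤ) (Fin.last m))) 0
  obtain ⟨ψ, hψ⟩ := Set.definable_iff_exists_formula_sum.1 h1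
  let lab : ↥(Set.univ : Set ℚ_[p]) ⊕ Fin (m+1) → (↥(Set.univ : Set ℚ_[p]) ⊕ Fin m) ⊕ Fin 1 :=
    Sum.elim (fun i => .inl (.inl i)) (Fin.snoc (α := fun _ => (↥(Set.univ : Set ℚ_[p]) ⊕ Fin m) ⊕ Fin 1) (fun i => .inl (.inr i)) (.inr 0))
  obtain ⟨N, hN, h2⟩ := L_tame L φ hexp hmin (ψ.relabel lab)
  refine ⟨N, hN, ?_⟩
  have h3 := h2.comp (fun e : E => (Sum.elim (fun i => i.1) (fun i => (p:ℚ_[p])^(g e i)) : ↥(Set.univ : Set ℚ_[p]) ⊕ Fin m → ℚ_[p]))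
  refine Bdd.mono h3 ?_
  have key : ∀ (e : E) (n : ℤ), P (e, n) ↔ (ψ.relabel lab).Realize (Sum.elim (Sum.elim (fun i => i.1) (fun i => (p:ℚ_[p])^(g e i))) (fun _ => (p:ℚ_[p])^n)) := by
    intro e n
    have h4 := Set.ext_iff.1 hψ (Fin.snoc (fun i => (p:ℚ_[p])^(g e i)) ((p:ℚ_[p])^n))
    rw [Formula.realize_relabel]
    have h5 : (Sum.elim (Sum.elim (fun i => i.1) (fun i => (p:ℚ_[p])^(g e i))) (fun _ => (p:ℚ_[p])^n)) ∘ lab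
      = Sum.elim (fun i : ↥(Set.univ : Set ℚ_[p]) => i.1) (Fin.snoc (fun i => (p:ℚ_[p])^(g e i)) ((p:ℚ_[p])^n) : Fin (m+1) → ℚ_[p]) := by
      ext i
      rcases i with i | i
      · rfl
      · refine Fin.lastCases ?_ (fun i => ?_) i
        · simp [lab]
        · simp [lab]
    rw [h5]
    refine Iff.trans ?_ h4
    simp only [Set.mem_ofPred_eq]
    have h6 : ∀ i, (Fin.snoc (fun i => (p:ℚ_[p])^(g e i)) ((p:ℚ_[p])^n) : Fin (m+1) → ℚ_[p]) i ≠ 0 := by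
      intro i
      refine Fin.lastCases ?_ (fun i => ?_) i
      · simp [zpow_p_ne]
      · simp [zpow_p_ne]
    rw [and_iff_right h6]
    have h7 : f (g e) = e := hg e
    simp [r, h7]
  intro e n h
  simpa only [key] using h
end DDs

theorem final (p : ℕ) [hp : Fact p.Prime]
    (L : FirstOrder.Language) [L.Structure ℚ_[p] ] (φ : Language.ring →ᴸ L)
    (hexp : letI : Language.ring.Structure ℚ_[p] := (compatibleRingOfRing ℚ_[p]).toStructure
      φ.IsExpansionOn ℚ_[p])
    (hmin : PMinimal p L φ) (m : ℕ)
    (X : Set (Fin m → ℚ_[p])) (hX0 : ∀ x ∈ X, ∀ i, x i ≠ 0)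
    (hXdef : (Set.univ : Set ℚ_[p]).Definable L X) :
    (Set.univ : Set ℤ).Definable Presburger
      {v : Fin m → ℤ | ∃ x ∈ X, ∀ i, (x i).valuation = v i} := by
  have hD : DC (DD p L) := DD_dc hexp
  refine sl_def (TT_all hD (fun h => DD_U hexp hmin h) m _ ?_)
  intro n h c
  have key : ∀ i, DD p L ((Fin n → ℤ) × (Fin m → ℤ)) (fun w => w.2 i = (h w.1 + c) i) := by
    intro i
    refine hD.eq (Aff.app (by fun_prop) i) (Aff.app (Aff.add ⟨h.comp (AddMonoidHom.fst _ _), 0, by simp⟩ (by fun_prop)) i)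
  let e1 : (Fin (n+m) → ℤ) →+ ((Fin n → ℤ) × (Fin m → ℤ)) :=
    ⟨⟨fun v => (fun i => v (Fin.castAdd m i), fun i => v (Fin.natAdd n i)), rfl⟩, fun _ _ => rfl⟩
  have h1 := Set.definable_iInter_of_finite fun i => key i (n+m) e1 0
  have h2 := (((nz_def (L := L) (p := p) (n+m)).inter h1).inter (hXdef.preimage_comp (Fin.natAdd n))).image_comp (Fin.castAdd m)
  convert! h2 using 1
  ext x
  constructor
  · rintro ⟨hx, y, hy, hv⟩
    refine ⟨Fin.append x y, ⟨⟨?_, ?_⟩, ?_⟩, ?_⟩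
    · intro i
      refine Fin.addCases (fun i => ?_) (fun i => ?_) i
      · simpa using hx i
      · simpa using hX0 y hy i
    · simp only [Set.mem_iInter, Set.mem_ofPred_eq]
      intro i
      refine ⟨?_, ?_⟩
      · intro i
        refine Fin.addCases (fun i => ?_) (fun i => ?_) i
        · simpa using hx i
        · simpa using hX0 y hy i
      · simpa [e1] using hv i
    · have : Fin.append x y ∘ Fin.natAdd n = y := by ext i; simp
      show Fin.append x y ∘ Fin.natAdd n ∈ X
      rw [this]; exact hy
    · ext i; simp
  · rintro ⟨y, ⟨⟨h1, h2⟩, h3⟩, rfl⟩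
    refine ⟨fun i => h1 _, _, h3, fun i => ?_⟩
    simp only [Set.mem_iInter, Set.mem_ofPred_eq] at h2
    simpa [e1] using (h2 i).2
end PM

/-- If `(ℚ_p, L)` is `P`-minimal, then for every `L`-definable (with parameters)
`X ⊆ (ℚ_p \ {0})^m`, the set `ord(X) = {(ord x₁, …, ord xₘ) : x ∈ X} ⊆ ℤ^m` is definable with
parameters in the Presburger structure `(ℤ, +, −, <, 0, 1)`. -/
theorem pminimal_ord_image_presburger_definable (p : ℕ) [Fact p.Prime]
    (L : FirstOrder.Language) [L.Structure ℚ_[p] ] (φ : Language.ring →ᴸ L)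
    (hexp : letI : Language.ring.Structure ℚ_[p] := (compatibleRingOfRing ℚ_[p]).toStructure
      φ.IsExpansionOn ℚ_[p])
    (hmin : PMinimal p L φ) (m : ℕ)
    (X : Set (Fin m → ℚ_[p])) (hX0 : ∀ x ∈ X, ∀ i, x i ≠ 0)
    (hXdef : (Set.univ : Set ℚ_[p]).Definable L X) :
    (Set.univ : Set ℤ).Definable Presburger
      {v : Fin m → ℤ | ∃ x ∈ X, ∀ i, (x i).valuation = v i} := by
  exact PM.final p L φ hexp hmin m X hX0 hXdef
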